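/- (Almost-sure strong Wulff shape for reachable sets of the G-equation.) Assume the G-equation hypotheses on (c,v) over a probability space (Ω,F,P), assume measurability in ω of all travel times, and assume lim_{s→∞} s^α φ_H(s) = 0 for some α > 0, where H := (c,v). Then there exist M ≥ 1 and a convex bounded open set S ⊆ ℝ^d with B_{1/M}(0) ⊆ S ⊆ B_M(0), such that for almost every ω ∈ Ω the following holds: for every δ ∈ (0,1) and Λ ≥ 1 there is T (depending on ω, δ, Λ) such that for every t ≥ T and every x_0 ∈ B_{Λt}(0): x_0 + (1−δ)tS ⊆ Γ(t,ω; 0, x_0) ⊆ x_0 + (1+δ)tS. -/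

import Mathlib

open MeasureTheory Filter Metric

noncomputable section

/-- `ℝ^d` with the Euclidean norm. -/
abbrev Euc (d : ℕ) : Type := EuclideanSpace ℝ (Fin d)

/-- `(t₁, x₁)` is reachable from `(t₀, x₀)`: there is an absolutely continuous path
`γ : [t₀,t₁] → ℝ^d` (given by the integral of its a.e. derivative `g`) with `γ(t₀) = x₀`,
`γ(t₁) = x₁`, and `|γ'(t) − v(t,γ(t))| ≤ c(t,γ(t))` for a.e. `t ∈ [t₀,t₁]`. -/
def Reachable {d : ℕ} (c : ℝ → Euc d → ℝ) (v : ℝ → Euc d → Euc d)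
    (t0 : ℝ) (x0 : Euc d) (t1 : ℝ) (x1 : Euc d) : Prop :=
  t0 ≤ t1 ∧ ∃ γ g : ℝ → Euc d,
    IntervalIntegrable g volume t0 t1 ∧
    (∀ t ∈ Set.Icc t0 t1, γ t = x0 + ∫ s in t0..t, g s) ∧
    γ t1 = x1 ∧
    ∀ᵐ s ∂(volume.restrict (Set.Icc t0 t1)), ‖g s - v s (γ s)‖ ≤ c s (γ s)

/-- The reachable set `Γ(t; t₀, x₀)`. -/
def reachSet {d : ℕ} (c : ℝ → Euc d → ℝ) (v : ℝ → Euc d → Euc d)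
    (t t0 : ℝ) (x0 : Euc d) : Set (Euc d) :=
  {x | Reachable c v t0 x0 (t0 + t) x}

/-- The travel time `τ^{t₀}(x₀, x) = inf { t ≥ 0 : x ∈ Γ(t; t₀, x₀) }`. -/
def travelTime {d : ℕ} (c : ℝ → Euc d → ℝ) (v : ℝ → Euc d → Euc d)
    (t0 : ℝ) (x0 x : Euc d) : ℝ :=
  sInf {t | 0 ≤ t ∧ x ∈ reachSet c v t t0 x0}

/-- The σ-algebra `F_t^+(H)` generated by `H(s,x,·) = (c(s,x,·), v(s,x,·))` for `s ≥ t`. -/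
def sigmaPlus {d : ℕ} {Ω : Type*} [MeasurableSpace Ω]
    (c : ℝ → Euc d → Ω → ℝ) (v : ℝ → Euc d → Ω → Euc d) (t : ℝ) : MeasurableSpace Ω :=
  ⨆ (s : ℝ) (_ : t ≤ s) (x : Euc d),
    MeasurableSpace.comap (fun ω => (c s x ω, v s x ω)) inferInstance

/-- The σ-algebra `F_t^-(H)` generated by `H(s,x,·) = (c(s,x,·), v(s,x,·))` for `s ≤ t`. -/
def sigmaMinus {d : ℕ} {Ω : Type*} [MeasurableSpace Ω]
    (c : ℝ → Euc d → Ω → ℝ) (v : ℝ → Euc d → Ω → Euc d) (t : ℝ) : MeasurableSpace Ω :=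
  ⨆ (s : ℝ) (_ : s ≤ t) (x : Euc d),
    MeasurableSpace.comap (fun ω => (c s x ω, v s x ω)) inferInstance

/-- The mixing coefficient `φ_H(s)` of `H = (c,v)`. -/
def phiH {d : ℕ} {Ω : Type*} [MeasurableSpace Ω] (P : Measure Ω)
    (c : ℝ → Euc d → Ω → ℝ) (v : ℝ → Euc d → Ω → Euc d) (s : ℝ) : ℝ :=
  sSup {r | ∃ t : ℝ, ∃ Ev Fv : Set Ω,
    MeasurableSet[sigmaMinus c v t] Ev ∧ MeasurableSet[sigmaPlus c v (t + s)] Fv ∧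
    0 < P Ev ∧ r = |(P (Fv ∩ Ev)).toReal / (P Ev).toReal - (P Fv).toReal|}

namespace GEq

/-- numerical parameters -/
structure Par where
  K : ℝ
  Lp : ℝ
  a : ℝ
  b : ℝ
  L0 : ℝ
  M : ℝ → ℝ
  K_pos : 0 < K
  Lp_nonneg : 0 ≤ Lp
  a_nonneg : 0 ≤ a
  a_lt_b : a < b
  L0_pos : 0 < L0
  M_nonneg : ∀ u, 0 ≤ M u
  M_mono : Monotone M
  M_le : ∀ u, M u ≤ 2 * K
  M_small : ∀ η : ℝ, 0 < η → ∃ δ : ℝ, 0 < δ ∧ ∀ u, u ≤ δ → M u ≤ η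

/-- the averaging box -/
def box (d : ℕ) (L : ℝ) : Set (Euc d) := {y : Euc d | ∀ i, y i ∈ Set.Icc (0:ℝ) L}

structure Env {d : ℕ} (p : Par) (c : ℝ → Euc d → ℝ) (v : ℝ → Euc d → Euc d) : Prop where
  cb : ∀ t x, p.b ≤ c t x
  cK : ∀ t x, c t x ≤ p.K
  vK : ∀ t x, ‖v t x‖ ≤ p.K
  cM : ∀ t t' x, |c t x - c t' x| ≤ p.M |t - t'|
  vM : ∀ t t' x, ‖v t x - v t' x‖ ≤ p.M |t - t'|
  cL : ∀ t x x', |c t x - c t x'| ≤ p.Lp * ‖x - x'‖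
  vL : ∀ t x x', ‖v t x - v t x'‖ ≤ p.Lp * ‖x - x'‖
  div0 : ∀ t, ∀ᵐ x ∂(volume : Measure (Euc d)),
      LinearMap.trace ℝ (Euc d) (fderiv ℝ (fun y => v t y) x).toLinearMap = 0
  avg : ∀ t x, ‖(p.L0 ^ d)⁻¹ • ∫ y in box d p.L0, v t (x + y)‖ ≤ p.a

variable {d : ℕ} {p : Par} {c : ℝ → Euc d → ℝ} {v : ℝ → Euc d → Euc d}

lemma Env.c_pos (_h : Env p c v) (t : ℝ) (x : Euc d) : 0 < c t x :=
  lt_of_lt_of_le (lt_of_le_of_lt p.a_nonneg p.a_lt_b) (_h.cb t x)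

lemma Env.shift (h : Env p c v) (s : ℝ) (y : Euc d) :
    Env p (fun t x => c (t + s) (x + y)) (fun t x => v (t + s) (x + y)) where
  cb t x := h.cb _ _
  cK t x := h.cK _ _
  vK t x := h.vK _ _
  cM t t' x := by simpa using h.cM (t + s) (t' + s) (x + y)
  vM t t' x := by simpa using h.vM (t + s) (t' + s) (x + y)
  cL t x x' := by simpa using h.cL (t + s) (x + y) (x' + y)
  vL t x x' := by simpa using h.vL (t + s) (x + y) (x' + y)
  div0 t := by
    have h1 := h.div0 (t + s)
    have h2 : ∀ᵐ x ∂(volume : Measure (Euc d)),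
      LinearMap.trace ℝ (Euc d) (fderiv ℝ (fun y => v (t + s) y) (x + y)).toLinearMap = 0 :=
      (measurePreserving_add_right volume y).quasiMeasurePreserving.ae h1
    filter_upwards [h2] with x hx
    rw [fderiv_comp_add_right (f := fun z => v (t + s) z) y]
    exact hx
  avg t x := by
    have := h.avg (t + s) (x + y)
    convert this using 6
    abel_nf

lemma Env.rev (h : Env p c v) :
    Env p (fun t x => c (-t) x) (fun t x => - v (-t) x) where
  cb t x := h.cb _ _
  cK t x := h.cK _ _
  vK t x := by simpa using h.vK _ _
  cM t t' x := by
    have := h.cM (-t) (-t') x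
    rwa [neg_sub_neg, abs_sub_comm t' t] at this
  vM t t' x := by
    have := h.vM (-t') (-t) x
    rw [neg_sub_neg] at this
    convert this using 2
    abel
  cL t x x' := h.cL _ _ _
  vL t x x' := by
    have := h.vL (-t) x' x
    rw [norm_sub_rev x' x] at this
    convert this using 2
    abel
  div0 t := by
    filter_upwards [h.div0 (-t)] with x hx
    have : fderiv ℝ (fun y => - v (-t) y) x = - fderiv ℝ (fun y => v (-t) y) x := by
      exact fderiv_neg
    rw [this]
    simp [hx]
  avg t x := by
    have := h.avg (-t) x
    rw [integral_neg, smul_neg, norm_neg]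
    exact this

lemma reach_refl (t : ℝ) (x : Euc d) : Reachable c v t x t x := by
  refine ⟨le_rfl, fun _ => x, fun _ => 0, by simp, ?_, rfl, ?_⟩
  · simp
  · simp [Set.Icc_self]

lemma reach_shift (s : ℝ) (y : Euc d) {t0 t1 : ℝ} {x0 x1 : Euc d}
    (h : Reachable (fun t x => c (t + s) (x + y)) (fun t x => v (t + s) (x + y)) t0 x0 t1 x1) :
    Reachable c v (t0 + s) (x0 + y) (t1 + s) (x1 + y) := by
  obtain ⟨h01, γ, g, hg, hγ, h1, hae⟩ := h
  refine ⟨by linarith, fun t => γ (t - s) + y, fun t => g (t - s), ?_, ?_, ?_, ?_⟩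
  · exact (hg.comp_sub_right s)
  · intro t ht
    have ht' : t - s ∈ Set.Icc t0 t1 := ⟨by linarith [ht.1], by linarith [ht.2]⟩
    simp only
    rw [hγ _ ht', intervalIntegral.integral_comp_sub_right (fun t => g t) s]
    simp only [add_sub_cancel_right]
    abel
  · simp [h1]
  · rw [ae_restrict_iff' measurableSet_Icc] at hae ⊢
    have := (measurePreserving_sub_right volume s).quasiMeasurePreserving.ae hae
    filter_upwards [this] with t ht hmem
    have := ht ⟨by linarith [hmem.1], by linarith [hmem.2]⟩
    simpa using this

lemma reach_shift_iff (s : ℝ) (y : Euc d) {t0 t1 : ℝ} {x0 x1 : Euc d} :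
    Reachable (fun t x => c (t + s) (x + y)) (fun t x => v (t + s) (x + y)) t0 x0 t1 x1 ↔
    Reachable c v (t0 + s) (x0 + y) (t1 + s) (x1 + y) := by
  refine ⟨reach_shift s y, fun h => ?_⟩
  have := reach_shift (c := fun t x => c (t + s) (x + y)) (v := fun t x => v (t + s) (x + y))
    (-s) (-y) (t0 := t0 + s) (t1 := t1 + s) (x0 := x0 + y) (x1 := x1 + y)
    (by simpa using h)
  simpa using this

lemma reach_rev {t0 t1 : ℝ} {x0 x1 : Euc d}
    (h : Reachable (fun t x => c (-t) x) (fun t x => - v (-t) x) (-t1) x1 (-t0) x0) :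
    Reachable c v t0 x0 t1 x1 := by
  obtain ⟨h01, γ, g, hg, hγ, h1, hae⟩ := h
  have h01' : t0 ≤ t1 := by linarith
  have hgi : ∀ t ∈ Set.Icc t0 t1, IntervalIntegrable g volume (-t1) (-t) := by
    intro t ht
    refine hg.mono_set ?_
    rw [Set.uIcc_of_le (by linarith [ht.2]), Set.uIcc_of_le h01]
    exact Set.Icc_subset_Icc le_rfl (by linarith [ht.1])
  refine ⟨h01', fun t => γ (-t), fun t => - g (-t), ?_, ?_, ?_, ?_⟩
  · have h2 := hg.symm.comp_mul_left (c := -1)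
    simp only [neg_mul, one_mul, neg_div_neg_eq, div_one] at h2
    convert! h2.neg using 1 
    all_goals simp
  · intro t ht
    have hm : -t ∈ Set.Icc (-t1) (-t0) := ⟨by linarith [ht.2], by linarith [ht.1]⟩
    have hm0 : -t0 ∈ Set.Icc (-t1) (-t0) := ⟨by linarith [ht.2], le_rfl⟩
    have e1 := hγ _ hm
    have e0 := hγ _ hm0
    simp only
    rw [intervalIntegral.integral_neg, intervalIntegral.integral_comp_neg (fun t => g t), e1, ← h1, e0]
    rw [← intervalIntegral.integral_add_adjacent_intervals (hgi t ht) ((hgi t ht).symm.trans hg)]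
    abel
  · have e1 := hγ (-t1) ⟨le_rfl, h01⟩
    simpa using e1
  · rw [ae_restrict_iff' measurableSet_Icc] at hae ⊢
    have := (Measure.measurePreserving_neg (volume : Measure ℝ)).quasiMeasurePreserving.ae hae
    filter_upwards [this] with t ht hmem
    have := ht ⟨by linarith [hmem.2], by linarith [hmem.1]⟩
    simp only [neg_neg, sub_neg_eq_add] at this
    have e : -g (-t) - v t (γ (-t)) = -(g (-t) + v t (γ (-t))) := by abel
    rw [e, norm_neg]
    exact this

lemma reach_trans {t0 t1 t2 : ℝ} {x0 x1 x2 : Euc d} (h : Reachable c v t0 x0 t1 x1)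
    (h' : Reachable c v t1 x1 t2 x2) : Reachable c v t0 x0 t2 x2 := by
  obtain ⟨h01, γ, g, hg, hγ, h1, hae⟩ := h
  obtain ⟨h12, γ', g', hg', hγ', h1', hae'⟩ := h'
  have hI1 : IntervalIntegrable (fun s => if s ≤ t1 then g s else g' s) volume t0 t1 := by
    refine hg.congr ?_
    intro s hs
    rw [Set.uIoc_of_le h01] at hs
    simp [hs.2]
  have hI2 : IntervalIntegrable (fun s => if s ≤ t1 then g s else g' s) volume t1 t2 := by
    refine hg'.congr ?_
    intro s hs
    rw [Set.uIoc_of_le h12] at hs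
    simp [hs.1]
  have e1 : ∀ t ∈ Set.Icc t0 t1, ∫ s in t0..t, (if s ≤ t1 then g s else g' s) = ∫ s in t0..t, g s := by
    intro t ht
    refine intervalIntegral.integral_congr_ae (ae_of_all _ ?_)
    intro s hs
    rw [Set.uIoc_of_le ht.1] at hs
    simp [hs.2.trans ht.2]
  have e2 : ∀ t ∈ Set.Icc t1 t2, ∫ s in t1..t, (if s ≤ t1 then g s else g' s) = ∫ s in t1..t, g' s := by
    intro t ht
    refine intervalIntegral.integral_congr_ae (ae_of_all _ ?_)
    intro s hs
    rw [Set.uIoc_of_le ht.1] at hs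
    simp [hs.1]
  refine ⟨h01.trans h12, fun s => if s ≤ t1 then γ s else γ' s,
    fun s => if s ≤ t1 then g s else g' s, hI1.trans hI2, ?_, ?_, ?_⟩
  · intro t ht
    simp only
    split_ifs with h
    · rw [e1 t ⟨ht.1, h⟩, hγ t ⟨ht.1, h⟩]
    · push Not at h
      have hm : t ∈ Set.Icc t1 t2 := ⟨h.le, ht.2⟩
      have hI3 : IntervalIntegrable (fun s => if s ≤ t1 then g s else g' s) volume t1 t := by
        refine hI2.mono_set ?_
        rw [Set.uIcc_of_le h12, Set.uIcc_of_le h.le]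
        exact Set.Icc_subset_Icc le_rfl ht.2
      rw [← intervalIntegral.integral_add_adjacent_intervals hI1 hI3, e1 t1 ⟨h01, le_rfl⟩, e2 t hm,
        hγ' t hm, ← add_assoc, ← hγ t1 ⟨h01, le_rfl⟩, h1]
  · simp only
    split_ifs with h
    · have : t1 = t2 := le_antisymm h12 h
      subst this
      have := hγ' t1 ⟨le_rfl, le_rfl⟩
      simp only [intervalIntegral.integral_same, add_zero] at this
      rw [h1, ← this, h1']
    · exact h1'
  · rw [ae_restrict_iff' measurableSet_Icc] at hae hae' ⊢
    filter_upwards [hae, hae'] with s hs hs' hm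
    split_ifs with h
    · exact hs ⟨hm.1, h⟩
    · exact hs' ⟨(not_le.mp h).le, hm.2⟩

/-- path extraction -/
lemma reach_path {t0 t1 : ℝ} {x0 x1 : Euc d} (h : Reachable c v t0 x0 t1 x1) :
    ∃ γ : ℝ → Euc d, γ t0 = x0 ∧ γ t1 = x1 ∧ ∀ s s', t0 ≤ s → s ≤ s' → s' ≤ t1 →
      Reachable c v s (γ s) s' (γ s') := by
  obtain ⟨h01, γ, g, hg, hγ, h1, hae⟩ := h
  have hgi : ∀ s s', t0 ≤ s → s ≤ s' → s' ≤ t1 → IntervalIntegrable g volume s s' := by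
    intro s s' h1 h2 h3
    refine hg.mono_set ?_
    rw [Set.uIcc_of_le h2, Set.uIcc_of_le h01]
    exact Set.Icc_subset_Icc h1 h3
  refine ⟨γ, by simpa using hγ t0 ⟨le_rfl, h01⟩, h1, ?_⟩
  intro s s' hs hss hs'
  refine ⟨hss, γ, g, hgi s s' hs hss hs', ?_, rfl, ?_⟩
  · intro t ht
    rw [hγ t ⟨hs.trans ht.1, ht.2.trans hs'⟩, hγ s ⟨hs, hss.trans hs'⟩,
      ← intervalIntegral.integral_add_adjacent_intervals (hgi t0 s le_rfl hs (hss.trans hs'))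
        (hgi s t hs ht.1 (ht.2.trans hs')), add_assoc]
  · exact ae_restrict_of_ae_restrict_of_subset (Set.Icc_subset_Icc hs hs') hae

lemma reach_speed (he : Env p c v) {t0 t1 : ℝ} {x0 x1 : Euc d} (h : Reachable c v t0 x0 t1 x1) :
    ‖x1 - x0‖ ≤ 2 * p.K * (t1 - t0) := by
  obtain ⟨h01, γ, g, hg, hγ, h1, hae⟩ := h
  have e := hγ t1 ⟨h01, le_rfl⟩
  rw [h1] at e
  rw [e, add_sub_cancel_left]
  have := intervalIntegral.norm_integral_le_of_norm_le_const_ae (a := t0) (b := t1) (f := g)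
    (C := 2 * p.K) ?_
  · rwa [abs_of_nonneg (by linarith)] at this
  · rw [ae_restrict_iff' measurableSet_Icc] at hae
    filter_upwards [hae] with s hs hm
    rw [Set.uIoc_of_le h01] at hm
    have h2 := hs ⟨hm.1.le, hm.2⟩
    have := norm_le_norm_add_norm_sub' (g s) (v s (γ s))
    linarith [he.vK s (γ s), he.cK s (γ s)]

lemma reach_line {t0 t1 : ℝ} (h01 : t0 ≤ t1) (x0 u : Euc d)
    (hu : ∀ s ∈ Set.Icc t0 t1, ‖u - v s (x0 + (s - t0) • u)‖ ≤ c s (x0 + (s - t0) • u)) :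
    Reachable c v t0 x0 t1 (x0 + (t1 - t0) • u) := by
  refine ⟨h01, fun s => x0 + (s - t0) • u, fun _ => u, by simp, ?_, rfl, ?_⟩
  · intro t _
    simp
  · rw [ae_restrict_iff' measurableSet_Icc]
    exact ae_of_all _ hu

end GEq

namespace GEq
open scoped NNReal ENNReal

/-- clamp to `[0,r]` -/
def cl (r t : ℝ) : ℝ := max 0 (min t r)

lemma cl_cont (r : ℝ) : Continuous (cl r) := by unfold cl; fun_prop

lemma cl_oneD {K : ℝ≥0} {g : ℝ → ℝ} (hg : LipschitzWith K g) (r x y : ℝ) :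
    ENNReal.ofReal |cl r (g x) - cl r (g y)| ≤
      K * volume (Set.uIcc x y ∩ {s | 0 < g s ∧ g s < r}) := by
  have hsub : Set.Ioo (min (cl r (g x)) (cl r (g y))) (max (cl r (g x)) (cl r (g y))) ⊆
      g '' (Set.uIcc x y ∩ {s | 0 < g s ∧ g s < r}) := by
    intro u hu
    have hmem : u ∈ Set.uIcc (g x) (g y) ∧ 0 < u ∧ u < r := by
      obtain ⟨h1, h2⟩ := hu
      rw [min_lt_iff] at h1
      rw [lt_max_iff] at h2
      rw [Set.mem_uIcc]
      simp only [cl, max_lt_iff, min_lt_iff, lt_max_iff, lt_min_iff] at h1 h2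
      grind
    obtain ⟨hm, h0, hr⟩ := hmem
    obtain ⟨s, hs, rfl⟩ := intermediate_value_uIcc (hg.continuous.continuousOn) hm
    exact ⟨s, ⟨hs, h0, hr⟩, rfl⟩
  have h1 := measure_mono (μ := volume) hsub
  rw [Real.volume_Ioo, max_sub_min_eq_abs] at h1
  have h2 := hg.hausdorffMeasure_image_le (d := 1) zero_le_one
    (Set.uIcc x y ∩ {s | 0 < g s ∧ g s < r})
  rw [hausdorffMeasure_real] at h2
  rw [abs_sub_comm]
  refine h1.trans (h2.trans ?_)
  simp

/-- one dimensional weight -/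
def rho (ε s : ℝ) : ℝ := Real.exp (-√(1 + ε ^ 2 * s ^ 2))

lemma rho_pos (ε s : ℝ) : 0 < rho ε s := Real.exp_pos _

lemma rho_cont (ε : ℝ) : Continuous (rho ε) := by unfold rho; fun_prop

lemma rho_le {ε : ℝ} (hε : 0 < ε) (s : ℝ) : rho ε s ≤ Real.exp (-ε * |s|) := by
  unfold rho
  apply Real.exp_le_exp.mpr
  have : ε * |s| ≤ √(1 + ε ^ 2 * s ^ 2) := by
    apply Real.le_sqrt_of_sq_le
    rw [mul_pow, sq_abs]; linarith
  linarith

lemma le_rho {ε : ℝ} (hε : 0 < ε) (s : ℝ) : Real.exp (-ε * |s|) ≤ Real.exp 1 * rho ε s := by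
  unfold rho
  rw [← Real.exp_add]
  apply Real.exp_le_exp.mpr
  have : √(1 + ε ^ 2 * s ^ 2) ≤ 1 + ε * |s| := by
    apply Real.sqrt_le_iff.mpr
    constructor
    · positivity
    · have : 0 ≤ ε * |s| := by positivity
      nlinarith [sq_abs s]
  linarith

lemma rho_even (ε s : ℝ) : rho ε (-s) = rho ε s := by simp [rho]

lemma rho_int_Ioi {ε : ℝ} (hε : 0 < ε) {s : ℝ} (hs : 0 ≤ s) :
    ∫⁻ u in Set.Ioi s, ENNReal.ofReal (rho ε u) ≤ ENNReal.ofReal (Real.exp 1 / ε * rho ε s) := by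
  have hi : IntegrableOn (fun u => Real.exp (-ε * u)) (Set.Ioi s) :=
    integrableOn_exp_mul_Ioi (by linarith) s
  calc ∫⁻ u in Set.Ioi s, ENNReal.ofReal (rho ε u)
      ≤ ∫⁻ u in Set.Ioi s, ENNReal.ofReal (Real.exp (-ε * u)) := by
        refine setLIntegral_mono (by fun_prop) fun u hu => ?_
        apply ENNReal.ofReal_le_ofReal
        have := rho_le hε u
        rwa [abs_of_nonneg (hs.trans (le_of_lt hu))] at this
    _ = ENNReal.ofReal (∫ u in Set.Ioi s, Real.exp (-ε * u)) := by
        rw [ofReal_integral_eq_lintegral_ofReal hi (ae_of_all _ fun _ => (Real.exp_pos _).le)]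
    _ ≤ _ := by
        apply ENNReal.ofReal_le_ofReal
        rw [integral_exp_mul_Ioi (by linarith)]
        have := le_rho hε s
        rw [abs_of_nonneg hs] at this
        rw [neg_div_neg_eq, div_mul_eq_mul_div]
        gcongr

lemma rho_int_Iio {ε : ℝ} (hε : 0 < ε) {s : ℝ} (hs : s ≤ 0) :
    ∫⁻ u in Set.Iio s, ENNReal.ofReal (rho ε u) ≤ ENNReal.ofReal (Real.exp 1 / ε * rho ε s) := by
  have := rho_int_Ioi hε (s := -s) (by linarith)
  rw [rho_even] at this
  refine le_trans (le_of_eq ?_) this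
  have h := (Measure.measurePreserving_neg (volume : Measure ℝ)).setLIntegral_comp_preimage
    (s := Set.Ioi (-s)) measurableSet_Ioi (f := fun u => ENNReal.ofReal (rho ε u))
    (by have := rho_cont ε; fun_prop)
  rw [← h]
  simp [rho_even]

lemma rho_int_fin {ε : ℝ} (hε : 0 < ε) : ∫⁻ u, ENNReal.ofReal (rho ε u) < ⊤ := by
  have h1 := (rho_int_Ioi hε (s := 0) le_rfl).trans_lt ENNReal.ofReal_lt_top
  have h2 := (rho_int_Iio hε (s := 0) le_rfl).trans_lt ENNReal.ofReal_lt_top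
  rw [← lintegral_add_compl _ (measurableSet_Ioi (a := (0:ℝ)))]
  rw [Set.compl_Ioi, ← restrict_Iio_eq_restrict_Iic]
  exact ENNReal.add_lt_top.mpr ⟨h1, h2⟩

lemma rho_integrable {ε : ℝ} (hε : 0 < ε) : Integrable (rho ε) := by
  refine ⟨(rho_cont ε).aestronglyMeasurable, ?_⟩
  rw [hasFiniteIntegral_iff_ofReal (ae_of_all _ fun s => (rho_pos ε s).le)]
  exact rho_int_fin hε

def zz (ε : ℝ) : ℝ := ∫ s, rho ε s

lemma zz_pos {ε : ℝ} (hε : 0 < ε) : 0 < zz ε := by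
  unfold zz
  rw [integral_pos_iff_support_of_nonneg (fun s => (rho_pos ε s).le) (rho_integrable hε)]
  have : Function.support (rho ε) = Set.univ := by
    ext s; simp [(rho_pos ε s).ne']
  rw [this]; simp

/-- normalized density -/
def qq (ε s : ℝ) : ℝ := rho ε s / zz ε

lemma qq_pos {ε : ℝ} (hε : 0 < ε) (s : ℝ) : 0 < qq ε s := div_pos (rho_pos _ _) (zz_pos hε)

lemma qq_cont (ε : ℝ) : Continuous (qq ε) := (rho_cont ε).div_const _

lemma qq_integrable {ε : ℝ} (hε : 0 < ε) : Integrable (qq ε) := (rho_integrable hε).div_const _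

lemma qq_int {ε : ℝ} (hε : 0 < ε) : ∫ s, qq ε s = 1 := by
  unfold qq
  rw [integral_div]
  exact div_self (zz_pos hε).ne'

def nu (ε : ℝ) : Measure ℝ := volume.withDensity fun s => ENNReal.ofReal (qq ε s)

lemma nu_prob {ε : ℝ} (hε : 0 < ε) : IsProbabilityMeasure (nu ε) := by
  constructor
  rw [nu, withDensity_apply _ MeasurableSet.univ, Measure.restrict_univ,
    ← ofReal_integral_eq_lintegral_ofReal (qq_integrable hε) (ae_of_all _ fun s => (qq_pos hε s).le),
    qq_int hε, ENNReal.ofReal_one]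

lemma nu_tail {ε : ℝ} (hε : 0 < ε) (s : ℝ) :
    nu ε (Set.Iic s) * nu ε (Set.Ici s) ≤ ENNReal.ofReal (Real.exp 1 / ε) * ENNReal.ofReal (qq ε s) := by
  have := nu_prob hε
  have key : ∀ A : Set ℝ, MeasurableSet A → 
     ∫⁻ u in A, ENNReal.ofReal (rho ε u) ≤ ENNReal.ofReal (Real.exp 1 / ε * rho ε s) →
     nu ε A ≤ ENNReal.ofReal (Real.exp 1 / ε) * ENNReal.ofReal (qq ε s) := by
    intro A hA h
    rw [nu, withDensity_apply _ hA]
    have hz := zz_pos hε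
    have e : ∀ u, ENNReal.ofReal (qq ε u) = ENNReal.ofReal ((zz ε)⁻¹) * ENNReal.ofReal (rho ε u) := by
      intro u
      rw [← ENNReal.ofReal_mul (by positivity), qq, div_eq_inv_mul]
    simp_rw [e]
    rw [lintegral_const_mul _ (by have := rho_cont ε; fun_prop), mul_left_comm,
      ← ENNReal.ofReal_mul (by positivity)]
    gcongr
  rcases le_total 0 s with hs | hs
  · calc _ ≤ 1 * nu ε (Set.Ici s) := by gcongr; exact prob_le_one
      _ ≤ _ := by
        rw [one_mul]
        apply key _ measurableSet_Ici
        rw [← restrict_Ioi_eq_restrict_Ici]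
        exact rho_int_Ioi hε hs
  · calc _ ≤ nu ε (Set.Iic s) * 1 := by gcongr; exact prob_le_one
      _ ≤ _ := by
        rw [mul_one]
        apply key _ measurableSet_Iic
        rw [← restrict_Iio_eq_restrict_Iic]
        exact rho_int_Iio hε hs

def kap (ε : ℝ) : ℝ≥0∞ := 2 * ENNReal.ofReal (Real.exp 1 / ε)

lemma cheeger_one {ε : ℝ} (hε : 0 < ε) {g : ℝ → ℝ} (hg : LipschitzWith 1 g) (r : ℝ) :
    ∫⁻ x, ∫⁻ y, ENNReal.ofReal |cl r (g x) - cl r (g y)| ∂(nu ε) ∂(nu ε) ≤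
      kap ε * nu ε {s | 0 < g s ∧ g s < r} := by
  have := nu_prob hε
  set G : Set ℝ := {s | 0 < g s ∧ g s < r} with hG
  have hGm : MeasurableSet G :=
    (measurableSet_lt measurable_const hg.continuous.measurable).inter
      (measurableSet_lt hg.continuous.measurable measurable_const)
  have hm : MeasurableSet {q : (ℝ × ℝ) × ℝ | q.2 ∈ Set.uIcc q.1.1 q.1.2} := by
    have : {q : (ℝ × ℝ) × ℝ | q.2 ∈ Set.uIcc q.1.1 q.1.2} =
      {q | min q.1.1 q.1.2 ≤ q.2} ∩ {q | q.2 ≤ max q.1.1 q.1.2} := by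
      ext q; simp [Set.uIcc, Set.mem_Icc]
    rw [this]
    exact (measurableSet_le (by fun_prop) (by fun_prop)).inter
      (measurableSet_le (by fun_prop) (by fun_prop))
  set I : ℝ × ℝ → ℝ → ℝ≥0∞ := fun q s => (Set.uIcc q.1 q.2).indicator 1 s with hI
  have hIm : Measurable (Function.uncurry I) := by
    have : Function.uncurry I = ({q : (ℝ × ℝ) × ℝ | q.2 ∈ Set.uIcc q.1.1 q.1.2}).indicator 1 := by
      ext q
      simp only [Function.uncurry, hI, Set.indicator]
      rfl
    rw [this]
    exact measurable_one.indicator hm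
  rw [← lintegral_prod (f := fun q : ℝ × ℝ => ENNReal.ofReal |cl r (g q.1) - cl r (g q.2)|)
    (by
      have := cl_cont r
      have := hg.continuous
      apply Measurable.aemeasurable
      refine ENNReal.measurable_ofReal.comp (Continuous.measurable ?_)
      fun_prop)]
  calc ∫⁻ q, ENNReal.ofReal |cl r (g q.1) - cl r (g q.2)| ∂((nu ε).prod (nu ε))
      ≤ ∫⁻ q, ∫⁻ s : ℝ, I q s * G.indicator 1 s ∂volume ∂((nu ε).prod (nu ε)) := by
        refine lintegral_mono fun q => ?_
        refine (cl_oneD hg r q.1 q.2).trans ?_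
        rw [ENNReal.coe_one, one_mul, ← lintegral_indicator_one (measurableSet_uIcc.inter hGm)]
        refine lintegral_mono fun s => ?_
        simp only [hI, Set.indicator]
        split_ifs <;> simp_all
    _ = ∫⁻ s, ∫⁻ q, I q s * G.indicator 1 s ∂((nu ε).prod (nu ε)) := by
        rw [lintegral_lintegral_swap]
        apply Measurable.aemeasurable
        exact hIm.mul ((measurable_one.indicator hGm).comp measurable_snd)
    _ ≤ ∫⁻ s, (kap ε * ENNReal.ofReal (qq ε s)) * G.indicator 1 s := by
        refine lintegral_mono fun s => ?_
        simp only
        have hIs : Measurable fun q => I q s := hIm.comp (measurable_id.prodMk measurable_const)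
        rw [lintegral_mul_const _ hIs]
        gcongr
        calc ∫⁻ q, I q s ∂((nu ε).prod (nu ε)) ≤ ∫⁻ q, (Set.Iic s ×ˢ Set.Ici s).indicator 1 q +
              (Set.Ici s ×ˢ Set.Iic s).indicator 1 q ∂((nu ε).prod (nu ε)) := by
              refine lintegral_mono fun q => ?_
              simp only [hI, Set.indicator, Set.mem_uIcc, Set.mem_prod, Set.mem_Iic, Set.mem_Ici]
              split_ifs <;> simp_all
          _ = nu ε (Set.Iic s) * nu ε (Set.Ici s) + nu ε (Set.Iic s) * nu ε (Set.Ici s) := by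
              rw [lintegral_add_left, lintegral_indicator_one, lintegral_indicator_one,
                Measure.prod_prod, Measure.prod_prod, mul_comm (nu ε (Set.Ici s))]
              · exact measurableSet_Ici.prod measurableSet_Iic
              · exact measurableSet_Iic.prod measurableSet_Ici
              · exact measurable_one.indicator (measurableSet_Iic.prod measurableSet_Ici)
          _ ≤ _ := by
              rw [← two_mul, kap, mul_assoc]
              exact mul_le_mul' le_rfl (nu_tail hε s)
    _ = kap ε * nu ε G := by
        rw [nu, withDensity_apply _ hGm, ← lintegral_indicator hGm, ← lintegral_const_mul]
        · congr 1; ext s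
          simp only [Set.indicator]
          split_ifs <;> simp
        · exact Measurable.indicator (by have := qq_cont ε; fun_prop) hGm

/-- product measure -/
def mun (ε : ℝ) (n : ℕ) : Measure (Fin n → ℝ) := Measure.pi fun _ => nu ε

lemma mun_succ {ε : ℝ} (hε : 0 < ε) (n : ℕ) {f : (Fin (n+1) → ℝ) → ℝ≥0∞} (hf : Measurable f) :
    ∫⁻ x, f x ∂(mun ε (n+1)) = ∫⁻ a, ∫⁻ x, f (Fin.cons a x) ∂(mun ε n) ∂(nu ε) := by
  have := nu_prob hε
  have h := (measurePreserving_piFinSuccAbove (fun _ : Fin (n+1) => nu ε) 0).symm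
  unfold mun
  rw [← h.lintegral_comp hf, lintegral_prod]
  · simp [MeasurableEquiv.piFinSuccAbove, Fin.insertNthEquiv]
  · exact (hf.comp h.measurable).aemeasurable

lemma mun_prob {ε : ℝ} (hε : 0 < ε) (n : ℕ) : IsProbabilityMeasure (mun ε n) := by
  have := nu_prob hε
  unfold mun
  infer_instance

lemma cheeger_n {ε : ℝ} (hε : 0 < ε) (r : ℝ) (n : ℕ) : ∀ (F : (Fin n → ℝ) → ℝ), Continuous F →
    (∀ i x, LipschitzWith 1 (fun s => F (Function.update x i s))) →
    ∫⁻ x, ∫⁻ y, ENNReal.ofReal |cl r (F x) - cl r (F y)| ∂(mun ε n) ∂(mun ε n) ≤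
      n * kap ε * mun ε n {x | 0 < F x ∧ F x < r} := by
  have hc := cl_cont r
  have := nu_prob hε
  induction n with
  | zero =>
    intro F hF hL
    have : ∀ x y : Fin 0 → ℝ, x = y := fun x y => Subsingleton.elim _ _
    have h0 : ∀ x y, ENNReal.ofReal |cl r (F x) - cl r (F y)| = 0 := by
      intro x y; rw [this x y]; simp
    simp [h0]
  | succ n ih =>
    intro F hF hL
    have := mun_prob hε n
    have hcons : Continuous fun q : ℝ × (Fin n → ℝ) => F (Fin.cons q.1 q.2) := by
      apply hF.comp
      fun_prop
    have hcons' : ∀ {X : Type} [TopologicalSpace X] (a : X → ℝ) (x : X → (Fin n → ℝ)), Continuous a →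
        Continuous x → Continuous fun q => F (Fin.cons (a q) (x q)) := by
      intro X _ a x ha hx
      exact hcons.comp (ha.prodMk hx)
    set G : Set (Fin (n+1) → ℝ) := {x | 0 < F x ∧ F x < r} with hG
    have hGm : MeasurableSet G :=
      (measurableSet_lt measurable_const hF.measurable).inter
        (measurableSet_lt hF.measurable measurable_const)
    have e1 : mun ε (n+1) G = ∫⁻ a, ∫⁻ x, G.indicator 1 (Fin.cons a x : Fin (n+1) → ℝ) ∂(mun ε n) ∂(nu ε) := by
      rw [← lintegral_indicator_one hGm, mun_succ hε n (measurable_one.indicator hGm)]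
    have hm1 : ∀ x, Measurable fun y => ENNReal.ofReal |cl r (F x) - cl r (F y)| := by
      intro x
      refine ENNReal.measurable_ofReal.comp (Continuous.measurable ?_)
      fun_prop
    have hmm : Measurable fun x => ∫⁻ y, ENNReal.ofReal |cl r (F x) - cl r (F y)| ∂(mun ε (n+1)) := by
      have := mun_prob hε (n+1)
      apply Measurable.lintegral_prod_right' (f := fun q : (Fin (n+1) → ℝ) × (Fin (n+1) → ℝ) => ENNReal.ofReal |cl r (F q.1) - cl r (F q.2)|)
      refine ENNReal.measurable_ofReal.comp (Continuous.measurable ?_)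
      fun_prop
    have hGc : Measurable fun q : ℝ × (Fin n → ℝ) => G.indicator (1 : (Fin (n+1) → ℝ) → ℝ≥0∞) (Fin.cons q.1 q.2 : Fin (n+1) → ℝ) := by
      refine (measurable_one.indicator hGm).comp ?_
      apply Continuous.measurable
      fun_prop
    rw [mun_succ hε n hmm]
    simp_rw [mun_succ hε n (hm1 _)]
    set u : ℝ → (Fin n → ℝ) → ℝ := fun a x => cl r (F (Fin.cons a x)) with hu
    have hucont : Continuous fun q : ℝ × (Fin n → ℝ) => u q.1 q.2 := hc.comp hcons
    have A1 : ∫⁻ a, ∫⁻ x, ∫⁻ b, ENNReal.ofReal |u a x - u b x| ∂(nu ε) ∂(mun ε n) ∂(nu ε) ≤ 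
        kap ε * mun ε (n+1) G := by
      rw [lintegral_lintegral_swap]
      · calc ∫⁻ x, ∫⁻ a, ∫⁻ b, ENNReal.ofReal |u a x - u b x| ∂(nu ε) ∂(nu ε) ∂(mun ε n)
            ≤ ∫⁻ x, kap ε * ∫⁻ a, G.indicator 1 (Fin.cons a x : Fin (n+1) → ℝ) ∂(nu ε) ∂(mun ε n) := by
              refine lintegral_mono fun x => ?_
              have hL' : LipschitzWith 1 fun a => F (Fin.cons a x) := by
                have := hL 0 (Fin.cons 0 x)
                simpa [Fin.update_cons_zero] using this
              refine (cheeger_one hε hL' r).trans ?_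
              rw [← lintegral_indicator_one]
              · exact le_rfl
              · exact (measurableSet_lt measurable_const hL'.continuous.measurable).inter
                  (measurableSet_lt hL'.continuous.measurable measurable_const)
          _ = _ := by
              rw [lintegral_const_mul, e1, lintegral_lintegral_swap]
              · exact (hGc.comp measurable_swap).aemeasurable
              · exact Measurable.lintegral_prod_left' hGc
      · apply Measurable.aemeasurable
        apply Measurable.lintegral_prod_right' (f := fun q : (ℝ × (Fin n → ℝ)) × ℝ => ENNReal.ofReal |u q.1.1 q.1.2 - u q.2 q.1.2|)
        refine ENNReal.measurable_ofReal.comp (Continuous.measurable ?_)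
        have := hcons' (fun q : (ℝ × (Fin n → ℝ)) × ℝ => q.1.1) (fun q => q.1.2) (by fun_prop) (by fun_prop)
        have := hcons' (fun q : (ℝ × (Fin n → ℝ)) × ℝ => q.2) (fun q => q.1.2) (by fun_prop) (by fun_prop)
        simp only [hu]
        fun_prop
    have A2 : ∫⁻ b, ∫⁻ x, ∫⁻ y, ENNReal.ofReal |u b x - u b y| ∂(mun ε n) ∂(mun ε n) ∂(nu ε) ≤ 
        n * kap ε * mun ε (n+1) G := by
      calc ∫⁻ b, ∫⁻ x, ∫⁻ y, ENNReal.ofReal |u b x - u b y| ∂(mun ε n) ∂(mun ε n) ∂(nu ε)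
          ≤ ∫⁻ b, n * kap ε * ∫⁻ x, G.indicator 1 (Fin.cons b x : Fin (n+1) → ℝ) ∂(mun ε n) ∂(nu ε) := by
            refine lintegral_mono fun b => ?_
            have hFb : Continuous fun x : Fin n → ℝ => F (Fin.cons b x) := 
              hcons' (fun _ => b) (fun x => x) (by fun_prop) (by fun_prop)
            refine (ih (fun x => F (Fin.cons b x)) hFb ?_).trans ?_
            · intro i x
              have := hL i.succ (Fin.cons b x)
              simpa [Fin.cons_update] using this
            · rw [← lintegral_indicator_one]
              · exact le_rfl
              · exact (measurableSet_lt measurable_const hFb.measurable).inter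
                  (measurableSet_lt hFb.measurable measurable_const)
        _ = _ := by
            rw [lintegral_const_mul, e1]
            exact Measurable.lintegral_prod_right' hGc
    calc ∫⁻ a, ∫⁻ x, ∫⁻ b, ∫⁻ y, ENNReal.ofReal |u a x - u b y| ∂(mun ε n) ∂(nu ε) ∂(mun ε n) ∂(nu ε)
        ≤ ∫⁻ a, ∫⁻ x, ((∫⁻ b, ENNReal.ofReal |u a x - u b x| ∂(nu ε)) + ∫⁻ b, ∫⁻ y, ENNReal.ofReal |u b x - u b y| ∂(mun ε n) ∂(nu ε)) ∂(mun ε n) ∂(nu ε) := by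
          refine lintegral_mono fun a => lintegral_mono fun x => ?_
          have hua : Measurable fun b => ENNReal.ofReal |u a x - u b x| := by
            refine ENNReal.measurable_ofReal.comp (Continuous.measurable ?_)
            have := hcons' (fun b => b) (fun _ => x) (by fun_prop) (by fun_prop)
            simp only [hu]; fun_prop
          rw [← lintegral_add_left hua]
          refine lintegral_mono fun b => ?_
          calc ∫⁻ y, ENNReal.ofReal |u a x - u b y| ∂(mun ε n) 
              ≤ ∫⁻ y, (ENNReal.ofReal |u a x - u b x| + ENNReal.ofReal |u b x - u b y|) ∂(mun ε n) := by
                refine lintegral_mono fun y => ?_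
                rw [← ENNReal.ofReal_add (abs_nonneg _) (abs_nonneg _)]
                exact ENNReal.ofReal_le_ofReal (abs_sub_le _ _ _)
            _ = _ := by
                rw [lintegral_add_left measurable_const]
                simp
      _ = (∫⁻ a, ∫⁻ x, ∫⁻ b, ENNReal.ofReal |u a x - u b x| ∂(nu ε) ∂(mun ε n) ∂(nu ε))
          + ∫⁻ b, ∫⁻ x, ∫⁻ y, ENNReal.ofReal |u b x - u b y| ∂(mun ε n) ∂(mun ε n) ∂(nu ε) := by
          have hq : Measurable fun q : (ℝ × (Fin n → ℝ)) × ℝ => ENNReal.ofReal |u q.1.1 q.1.2 - u q.2 q.1.2| := by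
            refine ENNReal.measurable_ofReal.comp (Continuous.measurable ?_)
            have := hcons' (fun q : (ℝ × (Fin n → ℝ)) × ℝ => q.1.1) (fun q => q.1.2) (by fun_prop) (by fun_prop)
            have := hcons' (fun q : (ℝ × (Fin n → ℝ)) × ℝ => q.2) (fun q => q.1.2) (by fun_prop) (by fun_prop)
            simp only [hu]
            fun_prop
          have hq' : Measurable fun q : ((Fin n → ℝ) × ℝ) × (Fin n → ℝ) => ENNReal.ofReal |u q.1.2 q.1.1 - u q.1.2 q.2| := by
            refine ENNReal.measurable_ofReal.comp (Continuous.measurable ?_)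
            have := hcons' (fun q : ((Fin n → ℝ) × ℝ) × (Fin n → ℝ) => q.1.2) (fun q => q.1.1) (by fun_prop) (by fun_prop)
            have := hcons' (fun q : ((Fin n → ℝ) × ℝ) × (Fin n → ℝ) => q.1.2) (fun q => q.2) (by fun_prop) (by fun_prop)
            simp only [hu]
            fun_prop
          have hq2 := hq.lintegral_prod_right' (ν := nu ε)
          have hq2' := hq'.lintegral_prod_right' (ν := mun ε n)
          rw [lintegral_lintegral_swap (μ := nu ε) (ν := mun ε n) (f := fun b x => ∫⁻ y, ENNReal.ofReal |u b x - u b y| ∂(mun ε n)) (hq2'.comp measurable_swap).aemeasurable]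
          have h3 : Measurable fun x => ∫⁻ b, ∫⁻ y, ENNReal.ofReal |u b x - u b y| ∂(mun ε n) ∂(nu ε) :=
            hq2'.lintegral_prod_right'
          have h4 : ∀ a, Measurable fun x => ∫⁻ b, ENNReal.ofReal |u a x - u b x| ∂(nu ε) := fun a =>
            hq2.comp measurable_prodMk_left
          simp_rw [lintegral_add_left (h4 _)]
          rw [lintegral_add_right _ measurable_const]
          simp
      _ ≤ kap ε * mun ε (n+1) G + n * kap ε * mun ε (n+1) G := add_le_add A1 A2
      _ = _ := by push_cast; ring

end GEq

namespace GEq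
open scoped NNReal ENNReal

/-- weight on `ℝ^d` -/
def psi {d : ℕ} (ε : ℝ) (x : Euc d) : ℝ := ∏ i, qq ε (x i)

variable {d : ℕ} {ε : ℝ}

lemma psi_pos (hε : 0 < ε) (x : Euc d) : 0 < psi ε x := Finset.prod_pos fun i _ => qq_pos hε _

lemma psi_cont : Continuous (psi (d := d) ε) := by
  unfold psi
  have := qq_cont ε
  fun_prop

lemma mun_eq (hε : 0 < ε) : mun ε d =
    (volume : Measure (Fin d → ℝ)).withDensity fun x => ENNReal.ofReal (∏ i, qq ε (x i)) := by
  have := nu_prob hε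
  unfold mun
  refine Measure.pi_eq (μ := fun _ => nu ε) fun s hs => ?_
  rw [withDensity_apply _ (MeasurableSet.univ_pi hs), ← lintegral_indicator (MeasurableSet.univ_pi hs)]
  have e : ∀ x : Fin d → ℝ, (Set.univ.pi s).indicator (fun x => ENNReal.ofReal (∏ i, qq ε (x i))) x
     = ENNReal.ofReal (∏ i, (s i).indicator (qq ε) (x i)) := by
    intro x
    by_cases hx : x ∈ Set.univ.pi s
    · rw [Set.indicator_of_mem hx]
      congr 1
      refine Finset.prod_congr rfl fun i _ => ?_
      rw [Set.indicator_of_mem (hx i trivial)]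
    · rw [Set.indicator_of_notMem hx]
      simp only [Set.mem_pi, not_forall] at hx
      obtain ⟨i, _, hi⟩ := hx
      rw [Finset.prod_eq_zero (Finset.mem_univ i) (by rw [Set.indicator_of_notMem hi])]
      simp
  simp_rw [e]
  have hint : ∀ i, Integrable ((s i).indicator (qq ε)) := fun i => (qq_integrable hε).indicator (hs i)
  have hnn : ∀ i x, 0 ≤ (s i).indicator (qq ε) x := fun i x =>
    Set.indicator_nonneg (fun x _ => (qq_pos hε x).le) x
  rw [volume_pi, ← ofReal_integral_eq_lintegral_ofReal (Integrable.fintype_prod (f := fun i => (s i).indicator (qq ε)) hint)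
    (ae_of_all _ fun x => Finset.prod_nonneg fun i _ => hnn i _)]
  rw [integral_fintype_prod_eq_prod, ENNReal.ofReal_prod_of_nonneg (fun i _ => integral_nonneg (hnn i))]
  refine Finset.prod_congr rfl fun i _ => ?_
  rw [ofReal_integral_eq_lintegral_ofReal (hint i) (ae_of_all _ (hnn i)), nu, withDensity_apply _ (hs i),
    ← lintegral_indicator (hs i)]
  congr 1
  ext x
  by_cases hx : x ∈ s i <;> simp [hx]

def mu (ε : ℝ) (d : ℕ) : Measure (Euc d) := volume.withDensity fun x => ENNReal.ofReal (psi ε x)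

lemma mp_ofLp (hε : 0 < ε) : MeasurePreserving (WithLp.ofLp : Euc d → Fin d → ℝ) (mu ε d) (mun ε d) := by
  have h := PiLp.volume_preserving_ofLp (Fin d)
  refine ⟨h.measurable, ?_⟩
  ext s hs
  rw [Measure.map_apply h.measurable hs, mun_eq hε, withDensity_apply _ hs, mu,
    withDensity_apply _ (h.measurable hs), ← h.setLIntegral_comp_preimage hs]
  · rfl
  · have := qq_cont ε
    apply Measurable.ennreal_ofReal
    apply Continuous.measurable
    fun_prop

lemma mu_prob (hε : 0 < ε) : IsProbabilityMeasure (mu ε d) := by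
  have := mun_prob hε d
  constructor
  have h := (mp_ofLp (d := d) hε).measure_preimage MeasurableSet.univ.nullMeasurableSet
  simpa using h

lemma cheeger_mu (hε : 0 < ε) {r : ℝ} (hr : 0 < r) (A : Set (Euc d)) (hA : A.Nonempty) :
    ENNReal.ofReal r * (mu ε d A * mu ε d (thickening r A)ᶜ) ≤ 
      d * kap ε * mu ε d (thickening r A \ A) := by
  have := mu_prob (d := d) hε
  have := mun_prob hε d
  have hmp := mp_ofLp (d := d) hε
  set G : (Fin d → ℝ) → ℝ := fun x => infDist (WithLp.toLp 2 x : Euc d) A with hG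
  have hGc : Continuous G := by
    refine (continuous_infDist_pt A).comp ?_
    exact PiLp.continuous_toLp 2 _
  have h := cheeger_n hε r d G hGc ?_
  swap
  · intro i x
    refine LipschitzWith.of_dist_le_mul fun s t => ?_
    refine ((lipschitz_infDist_pt A).dist_le_mul _ _).trans ?_
    simp only [NNReal.coe_one, one_mul]
    rw [EuclideanSpace.dist_eq]
    have : ∑ j, dist ((WithLp.toLp 2 (Function.update x i s) : Euc d) j) ((WithLp.toLp 2 (Function.update x i t) : Euc d) j) ^ 2 = dist s t ^ 2 := by
      rw [Finset.sum_eq_single i]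
      · simp
      · intro j _ hj
        simp [hj]
      · simp
    rw [this, Real.sqrt_sq dist_nonneg]
  have hcl := cl_cont r
  have hGm : MeasurableSet {x | 0 < G x ∧ G x < r} :=
      (measurableSet_lt measurable_const hGc.measurable).inter
        (measurableSet_lt hGc.measurable measurable_const)
  have hth : thickening r A = {x | infDist x A < r} := by
    ext x; exact (mem_thickening_iff_infDist_lt hA)
  rw [← hmp.measure_preimage hGm.nullMeasurableSet] at h
  have hsub : (WithLp.ofLp : Euc d → Fin d → ℝ) ⁻¹' {x | 0 < G x ∧ G x < r} ⊆ thickening r A \ A := by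
    intro x hx
    simp only [Set.mem_preimage, Set.mem_setOf_eq, hG] at hx
    rw [hth]
    refine ⟨hx.2, fun hxA => ?_⟩
    have := infDist_zero_of_mem hxA
    exact absurd hx.1 (by rw [this]; simp)
  refine le_trans ?_ (h.trans (by gcongr))
  have hmeas : Measurable fun q : (Fin d → ℝ) × (Fin d → ℝ) => ENNReal.ofReal |cl r (G q.1) - cl r (G q.2)| := by
    refine ENNReal.measurable_ofReal.comp (Continuous.measurable ?_)
    fun_prop
  rw [← hmp.lintegral_comp (hmeas.lintegral_prod_right')]
  have e : ∀ x : Fin d → ℝ, ∫⁻ y, ENNReal.ofReal |cl r (G x) - cl r (G y)| ∂(mun ε d) =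
    ∫⁻ y : Euc d, ENNReal.ofReal |cl r (G x) - cl r (infDist y A)| ∂(mu ε d) := by
    intro x
    exact (hmp.lintegral_comp (hmeas.comp (measurable_prodMk_left (x := x)))).symm
  simp_rw [e]
  have hB : MeasurableSet (thickening r A)ᶜ := isOpen_thickening.measurableSet.compl
  calc ENNReal.ofReal r * (mu ε d A * mu ε d (thickening r A)ᶜ) 
      ≤ ENNReal.ofReal r * (mu ε d (closure A) * mu ε d (thickening r A)ᶜ) := by
        gcongr; exact subset_closure
    _ = ∫⁻ x : Euc d, (closure A).indicator 1 x * (∫⁻ y : Euc d, ENNReal.ofReal r * (thickening r A)ᶜ.indicator 1 y ∂(mu ε d)) ∂(mu ε d) := by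
        rw [lintegral_mul_const, lintegral_const_mul, lintegral_indicator_one hB, 
          lintegral_indicator_one measurableSet_closure, mul_left_comm]
        · exact measurable_one.indicator hB
        · exact measurable_one.indicator measurableSet_closure
    _ ≤ _ := by
        refine lintegral_mono fun x => ?_
        by_cases hx : x ∈ closure A
        · rw [Set.indicator_of_mem hx, Pi.one_apply, one_mul]
          refine lintegral_mono fun y => ?_
          by_cases hy : y ∈ (thickening r A)ᶜ
          · simp only [Set.indicator_of_mem hy, Pi.one_apply, mul_one]
            rw [hth] at hy
            simp only [Set.mem_compl_iff, Set.mem_setOf_eq, not_lt] at hy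
            apply ENNReal.ofReal_le_ofReal
            have hx0 : infDist x A = 0 := (mem_closure_iff_infDist_zero hA).mp hx
            simp [hG, cl, hx0, hr.le, hy]
            exact le_abs_self r
          · simp [hy]
        · simp [hx]

end GEq

namespace GEq
open scoped NNReal ENNReal

def ss (ε a : ℝ) : ℝ := √(1 + ε ^ 2 * a ^ 2)
def gg (ε a : ℝ) : ℝ := ε ^ 2 * a / ss ε a

lemma ss_sq (ε a : ℝ) : ss ε a ^ 2 = 1 + ε ^ 2 * a ^ 2 := Real.sq_sqrt (by positivity)
lemma one_le_ss (ε a : ℝ) : 1 ≤ ss ε a := by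
  unfold ss; apply Real.le_sqrt_of_sq_le; nlinarith [mul_nonneg (sq_nonneg ε) (sq_nonneg a)]
lemma ss_pos (ε a : ℝ) : 0 < ss ε a := lt_of_lt_of_le one_pos (one_le_ss ε a)
lemma ss_cont (ε : ℝ) : Continuous (ss ε) := by unfold ss; fun_prop
lemma gg_cont (ε : ℝ) : Continuous (gg ε) := by
  unfold gg
  exact (by fun_prop : Continuous fun a : ℝ => ε ^ 2 * a).div (ss_cont ε) fun a => (ss_pos ε a).ne'

lemma abs_le_ss {ε : ℝ} (hε : 0 < ε) (a : ℝ) : ε * |a| ≤ ss ε a := by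
  unfold ss
  apply Real.le_sqrt_of_sq_le
  rw [mul_pow, sq_abs]; linarith

lemma gg_le {ε : ℝ} (hε : 0 < ε) (a : ℝ) : |gg ε a| ≤ ε := by
  unfold gg
  rw [abs_div, abs_of_pos (ss_pos ε a), div_le_iff₀ (ss_pos ε a), abs_mul, abs_of_nonneg (sq_nonneg ε)]
  nlinarith [abs_le_ss hε a]

lemma ss_add_le {ε : ℝ} (a y : ℝ) : ss ε (a + y) ≤ ss ε a + gg ε a * y + ε ^ 2 * y ^ 2 / 2 := by
  have h1 := one_le_ss ε a
  have h0 := ss_pos ε a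
  have h0' := ss_pos ε (a + y)
  have e1 := ss_sq ε a
  have e2 := ss_sq ε (a + y)
  have hg : gg ε a * ss ε a = ε ^ 2 * a := by unfold gg; field_simp
  have key : ss ε (a + y) * ss ε a ≤ (ss ε a + gg ε a * y + ε ^ 2 * y ^ 2 / 2) * ss ε a := by
    have : (ss ε a + gg ε a * y + ε ^ 2 * y ^ 2 / 2) * ss ε a =
      ss ε a ^ 2 + (gg ε a * ss ε a) * y + ε ^ 2 * y ^ 2 / 2 * ss ε a := by ring
    rw [this, hg]
    have h3 : 0 ≤ ε ^ 2 * y ^ 2 / 2 * (ss ε a - 1) := by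
      apply mul_nonneg (by positivity); linarith
    nlinarith [sq_nonneg (ss ε (a + y) - ss ε a)]
  exact le_of_mul_le_mul_right key h0

lemma ss_lip {ε : ℝ} (hε : 0 < ε) (a b : ℝ) : |ss ε a - ss ε b| ≤ ε * |a - b| := by
  have h1 := ss_pos ε a
  have h2 := ss_pos ε b
  have e : (ss ε a - ss ε b) * (ss ε a + ss ε b) = ε ^ 2 * ((a - b) * (a + b)) := by
    nlinarith [ss_sq ε a, ss_sq ε b]
  have e' := congrArg abs e
  rw [abs_mul, abs_of_pos (add_pos h1 h2), abs_mul, abs_mul, abs_of_nonneg (sq_nonneg ε)] at e'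
  have h3 : ε * |a + b| ≤ ss ε a + ss ε b := by
    have := abs_add_le a b
    nlinarith [abs_le_ss hε a, abs_le_ss hε b]
  have : |ss ε a - ss ε b| * (ss ε a + ss ε b) ≤ ε * |a - b| * (ss ε a + ss ε b) := by
    rw [e']
    have := mul_le_mul_of_nonneg_left h3 (show 0 ≤ ε * |a - b| by positivity)
    nlinarith
  exact le_of_mul_le_mul_right this (by positivity)

lemma gg_lip {ε : ℝ} (hε : 0 < ε) (a b : ℝ) : |gg ε a - gg ε b| ≤ 2 * ε ^ 2 * |a - b| := by
  have h1 := ss_pos ε a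
  have h2 := ss_pos ε b
  have e : gg ε a - gg ε b = ε ^ 2 * (a - b) / ss ε a + gg ε b * (ss ε b - ss ε a) / ss ε a := by
    unfold gg; field_simp; ring
  rw [e]
  refine (abs_add_le _ _).trans ?_
  rw [abs_div, abs_div, abs_of_pos h1, abs_mul, abs_mul, abs_of_nonneg (sq_nonneg ε)]
  have A : ε ^ 2 * |a - b| / ss ε a ≤ ε ^ 2 * |a - b| := div_le_self (by positivity) (one_le_ss ε a)
  have B : |gg ε b| * |ss ε b - ss ε a| / ss ε a ≤ ε ^ 2 * |a - b| := by
    refine (div_le_self (by positivity) (one_le_ss ε a)).trans ?_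
    have h := ss_lip hε b a
    rw [abs_sub_comm b a] at h
    calc _ ≤ ε * (ε * |a - b|) := mul_le_mul (gg_le hε b) h (abs_nonneg _) hε.le
      _ = _ := by ring
  linarith

variable {d : ℕ} {ε : ℝ}

lemma psi_eq (x : Euc d) : psi ε x = (zz ε ^ d)⁻¹ * Real.exp (-∑ i, ss ε (x i)) := by
  unfold psi qq rho
  rw [Finset.prod_div_distrib, ← Real.exp_sum, Finset.sum_neg_distrib]
  simp [ss, div_eq_inv_mul]

lemma coord_le (y : Euc d) (i : Fin d) : |y i| ≤ ‖y‖ := by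
  have := PiLp.norm_apply_le y i
  simpa using this

lemma sum_abs_le (y : Euc d) : ∑ i, |y i| ≤ d * ‖y‖ := by
  calc ∑ i, |y i| ≤ ∑ _i : Fin d, ‖y‖ := Finset.sum_le_sum fun i _ => coord_le y i
    _ = _ := by simp

lemma psi_ratio (hε : 0 < ε) (x y : Euc d) : psi ε y ≤ Real.exp (ε * (d * ‖y - x‖)) * psi ε x := by
  rw [psi_eq, psi_eq, mul_left_comm, ← Real.exp_add]
  have hz := zz_pos hε
  gcongr
  have : ∑ i, ss ε (x i) - ∑ i, ss ε (y i) ≤ ε * (d * ‖y - x‖) := by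
    rw [← Finset.sum_sub_distrib]
    calc _ ≤ ∑ i, ε * |(y - x) i| := by
          refine Finset.sum_le_sum fun i _ => ?_
          have := ss_lip hε (x i) (y i)
          rw [abs_sub_comm (x i)] at this
          exact (le_abs_self _).trans this
      _ = ε * ∑ i, |(y - x) i| := by rw [Finset.mul_sum]
      _ ≤ _ := by gcongr; exact sum_abs_le _
  linarith

lemma psi_taylor (hε : 0 < ε) (x y : Euc d) :
    psi ε x * (1 - ∑ i, gg ε (x i) * y i - ε ^ 2 * ‖y‖ ^ 2 / 2) ≤ psi ε (x + y) := by
  rw [psi_eq, psi_eq, mul_assoc]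
  have hz := zz_pos hε
  gcongr
  have h1 : ∑ i, ss ε ((x + y) i) ≤ ∑ i, ss ε (x i) + (∑ i, gg ε (x i) * y i + ε ^ 2 * ‖y‖ ^ 2 / 2) := by
    have : ‖y‖ ^ 2 = ∑ i, y i ^ 2 := by
      rw [EuclideanSpace.norm_sq_eq]; simp
    rw [this, Finset.mul_sum, Finset.sum_div, ← Finset.sum_add_distrib, ← Finset.sum_add_distrib]
    refine Finset.sum_le_sum fun i _ => ?_
    have := ss_add_le (ε := ε) (x i) (y i)
    simp only [PiLp.add_apply]
    linarith
  calc _ ≤ Real.exp (-∑ i, ss ε (x i)) * Real.exp (-(∑ i, gg ε (x i) * y i + ε ^ 2 * ‖y‖ ^ 2 / 2)) := by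
        gcongr
        have := Real.add_one_le_exp (-(∑ i, gg ε (x i) * y i + ε ^ 2 * ‖y‖ ^ 2 / 2))
        linarith
    _ ≤ _ := by
        rw [← Real.exp_add]
        gcongr
        linarith

lemma psig_diff (hε : 0 < ε) (hε1 : ε ≤ 1) {R : ℝ} (x y : Euc d) (hR : ‖y‖ ≤ R) (i : Fin d) :
    |psi ε x * gg ε (x i) - psi ε (x - y) * gg ε ((x - y) i)| ≤
      ε ^ 2 * (R * (d * Real.exp (d * R) + 2)) * psi ε (x - y) := by
  have hR0 : 0 ≤ R := (norm_nonneg y).trans hR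
  have h1 := psi_ratio hε (x - y) x
  have h2 := psi_ratio hε x (x - y)
  rw [sub_sub_cancel] at h1
  rw [show x - y - x = -y by abel, norm_neg] at h2
  set u := ε * (d * ‖y‖) with hu
  have hu0 : 0 ≤ u := by positivity
  have hu1 : u ≤ ε * (d * R) := by rw [hu]; gcongr
  have hu2 : u ≤ d * R := hu1.trans (by nlinarith [mul_nonneg (Nat.cast_nonneg (α := ℝ) d) hR0])
  have p0 := psi_pos hε x
  have p1 := psi_pos hε (x - y)
  have hexp : Real.exp u - 1 ≤ u * Real.exp u := by
    have h5 : 1 - u ≤ Real.exp (-u) := by linarith [Real.add_one_le_exp (-u)]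
    have := mul_le_mul_of_nonneg_right h5 (Real.exp_pos u).le
    rw [← Real.exp_add] at this
    simp at this; linarith
  have hE : Real.exp u ≤ Real.exp (d * R) := Real.exp_le_exp.mpr hu2
  have hb : |psi ε x - psi ε (x - y)| ≤ ε * (d * R) * Real.exp (d * R) * psi ε (x - y) := by
    have e3 : u * Real.exp u ≤ ε * (d * R) * Real.exp (d * R) := by gcongr
    rw [abs_le]
    constructor
    · have : (1 - u) * psi ε (x - y) ≤ psi ε x := by
        have h6 : psi ε (x - y) * Real.exp (-u) ≤ psi ε x := by
          have := mul_le_mul_of_nonneg_right h2 (Real.exp_pos (-u)).le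
          rwa [mul_right_comm, ← Real.exp_add, add_neg_cancel, Real.exp_zero, one_mul] at this
        nlinarith [Real.add_one_le_exp (-u)]
      have : u ≤ ε * (d * R) * Real.exp (d * R) := 
        hu1.trans (le_mul_of_one_le_right (by positivity) (Real.one_le_exp (by positivity)))
      nlinarith
    · nlinarith
  have hg : |gg ε (x i) - gg ε ((x - y) i)| ≤ 2 * ε ^ 2 * R := by
    refine (gg_lip hε _ _).trans ?_
    have : x i - (x - y) i = y i := by simp
    rw [this]
    gcongr
    exact (coord_le y i).trans hR
  have e : psi ε x * gg ε (x i) - psi ε (x - y) * gg ε ((x - y) i) = 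
    (psi ε x - psi ε (x - y)) * gg ε (x i) + psi ε (x - y) * (gg ε (x i) - gg ε ((x - y) i)) := by ring
  rw [e]
  refine (abs_add_le _ _).trans ?_
  rw [abs_mul, abs_mul, abs_of_pos p1]
  have t1 := mul_le_mul hb (gg_le hε (x i)) (abs_nonneg _) (by positivity)
  have t2 := mul_le_mul_of_nonneg_left hg p1.le
  nlinarith

lemma psi_integrable (hε : 0 < ε) : Integrable (psi (d := d) ε) := by
  have := mu_prob (d := d) hε
  refine ⟨psi_cont.aestronglyMeasurable, ?_⟩
  rw [hasFiniteIntegral_iff_ofReal (ae_of_all _ fun s => (psi_pos hε s).le)]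
  have h : mu ε d Set.univ = 1 := measure_univ
  rw [mu, withDensity_apply _ MeasurableSet.univ, Measure.restrict_univ] at h
  rw [h]; simp

lemma mu_toReal (hε : 0 < ε) {A : Set (Euc d)} (hA : MeasurableSet A) :
    (mu ε d).real A = ∫ x in A, psi ε x := by
  rw [integral_eq_lintegral_of_nonneg_ae (ae_of_all _ fun s => (psi_pos hε s).le)
    psi_cont.aestronglyMeasurable, Measure.real, mu, withDensity_apply _ hA]

end GEq

namespace GEq
open scoped NNReal ENNReal
variable {d : ℕ} {ε : ℝ}

lemma line_est (hε : 0 < ε) (hε1 : ε ≤ 1) {r R : ℝ} (A : Set (Euc d)) (hA : A.Nonempty)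
    (y : Euc d) (hR : ‖y‖ ≤ R) :
    ∫⁻ x, ENNReal.ofReal |cl r (infDist x A) - cl r (infDist (x - y) A)| * ENNReal.ofReal (psi ε x) ≤
      ENNReal.ofReal (R * Real.exp (d * R)) * mu ε d (thickening r A \ A) := by
  have hR0 : 0 ≤ R := (norm_nonneg y).trans hR
  set D : Set (Euc d) := {x | 0 < infDist x A ∧ infDist x A < r} with hD
  have hcA := continuous_infDist_pt A
  have hDm : MeasurableSet D := (measurableSet_lt measurable_const hcA.measurable).inter
        (measurableSet_lt hcA.measurable measurable_const)
  have hDsub : D ⊆ thickening r A \ A := by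
    intro x hx
    refine ⟨(mem_thickening_iff_infDist_lt hA).mpr hx.2, fun hxA => ?_⟩
    exact absurd hx.1 (by rw [infDist_zero_of_mem hxA]; simp)
  set I : Euc d → ℝ → ℝ≥0∞ := fun x s => D.indicator 1 (x - s • y) with hI
  have hIm : Measurable fun q : Euc d × ℝ => I q.1 q.2 := by
    refine (measurable_one.indicator hDm).comp ?_
    fun_prop
  have hIs : ∀ x, Measurable fun s => I x s := by
    intro x
    refine (measurable_one.indicator hDm).comp ?_
    fun_prop
  clear_value I
  have hψ : Measurable fun x : Euc d => ENNReal.ofReal (psi ε x) := psi_cont.measurable.ennreal_ofReal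
  calc ∫⁻ x, ENNReal.ofReal |cl r (infDist x A) - cl r (infDist (x - y) A)| * ENNReal.ofReal (psi ε x)
      ≤ ∫⁻ x : Euc d, ∫⁻ s in Set.Icc (0:ℝ) 1, (ENNReal.ofReal R * ENNReal.ofReal (psi ε x)) * I x s := by
        refine lintegral_mono fun x => ?_
        have hL : LipschitzWith ‖y‖₊ fun s : ℝ => infDist (x - s • y) A := by
          refine LipschitzWith.of_dist_le_mul fun s t => ?_
          refine ((lipschitz_infDist_pt A).dist_le_mul _ _).trans ?_
          simp only [NNReal.coe_one, one_mul, coe_nnnorm]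
          rw [dist_eq_norm, show x - s • y - (x - t • y) = (t - s) • y by module, norm_smul,
            ← dist_eq_norm, dist_comm, mul_comm]
        have h := cl_oneD hL r 0 1
        have hms : MeasurableSet {s : ℝ | 0 < infDist (x - s • y) A ∧ infDist (x - s • y) A < r} :=
          (measurableSet_lt measurable_const hL.continuous.measurable).inter
                (measurableSet_lt hL.continuous.measurable measurable_const)
        simp only [zero_smul, sub_zero, one_smul] at h
        rw [lintegral_const_mul, mul_right_comm]
        · refine mul_le_mul' ?_ le_rfl
          refine h.trans ?_
          refine mul_le_mul' ?_ ?_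
          · rw [← ENNReal.ofReal_coe_nnreal]
            exact ENNReal.ofReal_le_ofReal hR
          · rw [Set.uIcc_of_le zero_le_one, Set.inter_comm, ← Measure.restrict_apply hms, ← lintegral_indicator_one hms]
            · refine lintegral_mono fun s => le_of_eq ?_
              simp only [hI, Set.indicator]
              rfl
        · exact hIs x
    _ = ∫⁻ s in Set.Icc (0:ℝ) 1, ∫⁻ x, (ENNReal.ofReal R * ENNReal.ofReal (psi ε x)) * I x s := by
        rw [lintegral_lintegral_swap]
        exact (((measurable_const.mul hψ).comp measurable_fst).mul hIm).aemeasurable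
    _ ≤ ∫⁻ s in Set.Icc (0:ℝ) 1, ENNReal.ofReal (R * Real.exp (d * R)) * mu ε d D := by
        refine setLIntegral_mono measurable_const fun s hs => ?_
        rw [← lintegral_add_right_eq_self (fun x => ENNReal.ofReal R * ENNReal.ofReal (psi ε x) * I x s) (s • y)]
        rw [mu, withDensity_apply _ hDm, ← lintegral_indicator hDm, ← lintegral_const_mul _ (hψ.indicator hDm)]
        refine lintegral_mono fun x => ?_
        simp only [hI, add_sub_cancel_right]
        by_cases hx : x ∈ D
        · simp only [Set.indicator_of_mem hx, Pi.one_apply, mul_one]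
          rw [← ENNReal.ofReal_mul hR0, ← ENNReal.ofReal_mul (by positivity)]
          apply ENNReal.ofReal_le_ofReal
          rw [mul_assoc]
          gcongr
          refine (psi_ratio hε x (x + s • y)).trans ?_
          refine mul_le_mul_of_nonneg_right (Real.exp_le_exp.mpr ?_) (psi_pos hε x).le
          rw [add_sub_cancel_left, norm_smul, Real.norm_of_nonneg hs.1]
          calc ε * (d * (s * ‖y‖)) ≤ 1 * (d * (1 * R)) := by
                have := hs.1
                have := hs.2
                gcongr
            _ = _ := by ring
        · simp [hx]
    _ ≤ _ := by
        simp only [lintegral_const, MeasurableSet.univ, Measure.restrict_apply, Set.univ_inter, Real.volume_Icc, sub_zero, ENNReal.ofReal_one, mul_one]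
        gcongr

/-- cutoff -/
def Fr (A : Set (Euc d)) (r : ℝ) (x : Euc d) : ℝ := 1 - cl r (infDist x A) / r

lemma Fr_cont (A : Set (Euc d)) (r : ℝ) : Continuous (Fr A r) := by
  have := cl_cont r
  have := continuous_infDist_pt A
  unfold Fr; fun_prop

lemma Fr_mem {r : ℝ} (hr : 0 < r) (A : Set (Euc d)) (x : Euc d) : 0 ≤ Fr A r x ∧ Fr A r x ≤ 1 := by
  have h1 : 0 ≤ cl r (infDist x A) := le_max_left _ _
  have h2 : cl r (infDist x A) ≤ r := max_le hr.le (min_le_right _ _)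
  unfold Fr
  constructor
  · rw [sub_nonneg, div_le_one hr]; exact h2
  · have := div_nonneg h1 hr.le; linarith

lemma Fr_mem_A {r : ℝ} (hr : 0 < r) (A : Set (Euc d)) {x : Euc d} (hx : x ∈ A) : Fr A r x = 1 := by
  simp [Fr, cl, infDist_zero_of_mem hx, hr.le]

lemma Fr_notMem {r : ℝ} (hr : 0 < r) {A : Set (Euc d)} (hA : A.Nonempty) {x : Euc d} (hx : x ∉ thickening r A) :
    Fr A r x = 0 := by
  have : r ≤ infDist x A := by
    by_contra h
    exact hx ((mem_thickening_iff_infDist_lt hA).mpr (not_le.mp h))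
  simp [Fr, cl, this, hr.le, hr.ne']

lemma T1 (hε : 0 < ε) (hε1 : ε ≤ 1) {r R : ℝ} (hr : 0 < r) (A : Set (Euc d)) (hA : A.Nonempty)
    (y : Euc d) (hR : ‖y‖ ≤ R) (i : Fin d) :
    ∫ x, |Fr A r x * (psi ε x * gg ε (x i)) - Fr A r (x - y) * (psi ε (x - y) * gg ε ((x - y) i))| ≤
      ε * (R * Real.exp (d * R) / r) * (mu ε d).real (thickening r A \ A) +
        ε ^ 2 * (R * (d * Real.exp (d * R) + 2)) * (mu ε d).real (thickening r A) := by
  have := mu_prob (d := d) hε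
  have hR0 : 0 ≤ R := (norm_nonneg y).trans hR
  have hcF := Fr_cont A r
  have hψi := psi_integrable (d := d) hε
  have hψc := psi_cont (d := d) (ε := ε)
  have hI1 : Integrable fun x => ε * (|Fr A r x - Fr A r (x - y)| * psi ε x) := by
    refine Integrable.const_mul (hψi.bdd_mul (c := 1) ?_ (ae_of_all _ fun x => ?_)) _
    · apply Continuous.aestronglyMeasurable; fun_prop
    · rw [Real.norm_eq_abs, abs_abs, abs_le]
      have := Fr_mem hr A x
      have := Fr_mem hr A (x - y)
      constructor <;> linarith
  have hI2' : Integrable fun x => Fr A r x * psi ε x := by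
    refine hψi.bdd_mul (c := 1) ?_ (ae_of_all _ fun x => ?_)
    · apply Continuous.aestronglyMeasurable; fun_prop
    · rw [Real.norm_eq_abs, abs_le]
      have := Fr_mem hr A x
      constructor <;> linarith
  have hI2 : Integrable fun x => ε ^ 2 * (R * (d * Real.exp (d * R) + 2)) * (Fr A r (x - y) * psi ε (x - y)) :=
    (hI2'.comp_sub_right y).const_mul _
  have hB : MeasurableSet (thickening r A) := isOpen_thickening.measurableSet
  have step1 : ∫ x, |Fr A r x * (psi ε x * gg ε (x i)) - Fr A r (x - y) * (psi ε (x - y) * gg ε ((x - y) i))| ≤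
     ∫ x, (ε * (|Fr A r x - Fr A r (x - y)| * psi ε x) + ε ^ 2 * (R * (d * Real.exp (d * R) + 2)) * (Fr A r (x - y) * psi ε (x - y))) := by
    refine integral_mono_of_nonneg (ae_of_all _ fun x => abs_nonneg _) (hI1.add hI2) (ae_of_all _ fun x => ?_)
    simp only
    have e : Fr A r x * (psi ε x * gg ε (x i)) - Fr A r (x - y) * (psi ε (x - y) * gg ε ((x - y) i)) =
      (Fr A r x - Fr A r (x - y)) * (psi ε x * gg ε (x i)) + 
       Fr A r (x - y) * (psi ε x * gg ε (x i) - psi ε (x - y) * gg ε ((x - y) i)) := by ring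
    rw [e]
    refine (abs_add_le _ _).trans ?_
    rw [abs_mul, abs_mul, abs_mul, abs_of_pos (psi_pos hε x), abs_of_nonneg (Fr_mem hr A (x - y)).1]
    refine add_le_add ?_ ?_
    · have h1 := gg_le hε (x i)
      have h2 : 0 ≤ |Fr A r x - Fr A r (x - y)| * psi ε x := mul_nonneg (abs_nonneg _) (psi_pos hε x).le
      nlinarith
    · have h1 := psig_diff hε hε1 x y hR i
      have := mul_le_mul_of_nonneg_left h1 (Fr_mem hr A (x - y)).1
      linarith
  refine step1.trans ?_
  rw [integral_add hI1 hI2, integral_const_mul, integral_const_mul]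
  refine add_le_add ?_ ?_
  · rw [mul_assoc]
    refine mul_le_mul_of_nonneg_left ?_ hε.le
    rw [integral_eq_lintegral_of_nonneg_ae (ae_of_all _ fun x => mul_nonneg (abs_nonneg _) (psi_pos hε x).le)
      (by apply Continuous.aestronglyMeasurable; fun_prop)]
    have h := line_est hε hε1 (r := r) A hA y hR
    have e : ∀ x, ENNReal.ofReal (|Fr A r x - Fr A r (x - y)| * psi ε x) = 
      ENNReal.ofReal r⁻¹ * (ENNReal.ofReal |cl r (infDist x A) - cl r (infDist (x - y) A)| * ENNReal.ofReal (psi ε x)) := by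
      intro x
      rw [← ENNReal.ofReal_mul (abs_nonneg _), ← ENNReal.ofReal_mul (by positivity), ← mul_assoc]
      congr 2
      have : Fr A r x - Fr A r (x - y) = r⁻¹ * (cl r (infDist (x - y) A) - cl r (infDist x A)) := by
        unfold Fr; ring
      rw [this, abs_mul, abs_of_pos (by positivity), abs_sub_comm]
    simp_rw [e]
    rw [lintegral_const_mul' _ _ ENNReal.ofReal_ne_top]
    have h2 := mul_le_mul' (le_refl (ENNReal.ofReal r⁻¹)) h
    have h3 := ENNReal.toReal_mono (by 
      refine ENNReal.mul_ne_top ENNReal.ofReal_ne_top (ENNReal.mul_ne_top ENNReal.ofReal_ne_top (measure_ne_top _ _))) h2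
    refine h3.trans (le_of_eq ?_)
    rw [ENNReal.toReal_mul, ENNReal.toReal_mul, ENNReal.toReal_ofReal (by positivity), ENNReal.toReal_ofReal (by positivity), Measure.real]
    field_simp
  · refine mul_le_mul_of_nonneg_left ?_ (by positivity)
    rw [integral_sub_right_eq_self (fun x => Fr A r x * psi ε x) y, mu_toReal hε hB, ← integral_indicator hB]
    refine integral_mono hI2' (hψi.indicator hB) fun x => ?_
    by_cases hx : x ∈ thickening r A
    · simp only [Set.indicator_of_mem hx]
      nlinarith [(Fr_mem hr A x).2, psi_pos hε x]
    · simp [hx, Fr_notMem hr hA hx]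

end GEq

namespace GEq
open scoped NNReal ENNReal
variable {d : ℕ} {ε : ℝ}

lemma box_meas (L : ℝ) : MeasurableSet (box d L) := by
  have : box d L = ⋂ i, {y : Euc d | y i ∈ Set.Icc (0:ℝ) L} := by ext y; simp [box]
  rw [this]
  refine MeasurableSet.iInter fun i => ?_
  have : Measurable fun y : Euc d => y i := by fun_prop
  exact this measurableSet_Icc

lemma box_vol {L : ℝ} (hL : 0 < L) : volume (box d L) = ENNReal.ofReal (L ^ d) := by
  have h := PiLp.volume_preserving_ofLp (Fin d)
  have e : box d L = (WithLp.ofLp : Euc d → Fin d → ℝ) ⁻¹' (Set.univ.pi fun _ => Set.Icc 0 L) := by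
    ext y
    simp only [box, Set.mem_preimage, Set.mem_univ_pi]
    rfl
  rw [e, h.measure_preimage (MeasurableSet.univ_pi fun _ => measurableSet_Icc).nullMeasurableSet, volume_pi_pi]
  simp [ENNReal.ofReal_pow hL.le]

lemma box_real {L : ℝ} (hL : 0 < L) : volume.real (box d L) = L ^ d := by
  rw [Measure.real, box_vol hL, ENNReal.toReal_ofReal (by positivity)]

lemma box_norm {L : ℝ} {y : Euc d} (hy : y ∈ box d L) : ‖y‖ ≤ √d * L := by
  rcases Nat.eq_zero_or_pos d with rfl | hd
  · have : y = 0 := Subsingleton.elim _ _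
    simp [this]
  have hL : 0 ≤ L := (hy ⟨0, hd⟩).1.trans (hy ⟨0, hd⟩).2
  rw [EuclideanSpace.norm_eq, ← Real.sqrt_sq hL, ← Real.sqrt_mul (by positivity)]
  apply Real.sqrt_le_sqrt
  calc ∑ i, ‖y i‖ ^ 2 ≤ ∑ _i : Fin d, L ^ 2 := by
        refine Finset.sum_le_sum fun i _ => ?_
        rw [Real.norm_of_nonneg (hy i).1]
        have := (hy i).1
        have := (hy i).2
        gcongr
    _ = _ := by simp

/-- frozen time field -/
structure Fld (p : Par) (v : Euc d → Euc d) : Prop where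
  vK : ∀ x, ‖v x‖ ≤ p.K
  vL : ∀ x x', ‖v x - v x'‖ ≤ p.Lp * ‖x - x'‖
  div0 : ∀ᵐ x ∂(volume : Measure (Euc d)), LinearMap.trace ℝ (Euc d) (fderiv ℝ v x).toLinearMap = 0

variable {p : Par} {v : Euc d → Euc d}

lemma Fld.lip (h : Fld p v) : LipschitzWith ⟨p.Lp, p.Lp_nonneg⟩ v := by
  refine LipschitzWith.of_dist_le_mul fun x y => ?_
  rw [dist_eq_norm, dist_eq_norm]
  exact h.vL x y

def bavg (L : ℝ) (v : Euc d → Euc d) (x : Euc d) : Euc d := (L ^ d)⁻¹ • ∫ y in box d L, v (x + y)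

lemma Fld.intOn (h : Fld p v) (x : Euc d) : IntegrableOn (fun y => v (x + y)) (box d p.L0) := by
  have := h.lip.continuous
  refine Measure.integrableOn_of_bounded (M := p.K) ?_ ?_ (ae_of_all _ fun y => h.vK _)
  · rw [box_vol p.L0_pos]; exact ENNReal.ofReal_ne_top
  · apply Continuous.aestronglyMeasurable; fun_prop

lemma avg_le {E : Type*} [NormedAddCommGroup E] [NormedSpace ℝ E] {L C : ℝ} (hL : 0 < L) {f : Euc d → E}
    (hf : ∀ y ∈ box d L, ‖f y‖ ≤ C) : ‖(L ^ d)⁻¹ • ∫ y in box d L, f y‖ ≤ C := by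
  have h := norm_setIntegral_le_of_norm_le_const (μ := volume) (s := box d L) (f := f) (C := C)
    (by rw [box_vol hL]; exact ENNReal.ofReal_lt_top) hf
  rw [box_real hL] at h
  rw [norm_smul, norm_inv, Real.norm_of_nonneg (by positivity), inv_mul_le_iff₀ (by positivity)]
  linarith

lemma Fld.bavg_lip (h : Fld p v) (x x' : Euc d) : ‖bavg p.L0 v x - bavg p.L0 v x'‖ ≤ p.Lp * ‖x - x'‖ := by
  unfold bavg
  rw [← smul_sub, ← integral_sub (h.intOn x) (h.intOn x')]
  refine avg_le p.L0_pos fun y _ => ?_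
  simpa using h.vL (x + y) (x' + y)

lemma Fld.bavg_le (h : Fld p v) (x : Euc d) : ‖bavg p.L0 v x‖ ≤ p.K :=
  avg_le p.L0_pos fun y _ => h.vK _

lemma trace_integral {α : Type*} [MeasurableSpace α] {m : Measure α} {F : α → (Euc d →L[ℝ] Euc d)}
    (hF : Integrable F m) (h0 : ∀ᵐ a ∂m, LinearMap.trace ℝ (Euc d) (F a).toLinearMap = 0) :
    LinearMap.trace ℝ (Euc d) (∫ a, F a ∂m).toLinearMap = 0 := by
  let T : (Euc d →L[ℝ] Euc d) →ₗ[ℝ] ℝ :=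
    (LinearMap.trace ℝ (Euc d)).comp (ContinuousLinearMap.coeLM ℝ)
  let T' : (Euc d →L[ℝ] Euc d) →L[ℝ] ℝ := LinearMap.toContinuousLinearMap T
  have h1 : T' (∫ a, F a ∂m) = ∫ a, T' (F a) ∂m := (ContinuousLinearMap.integral_comp_comm T' hF).symm
  have h2 : ∫ a, T' (F a) ∂m = 0 := by
    apply integral_eq_zero_of_ae
    filter_upwards [h0] with a ha
    exact ha
  rw [h2] at h1
  exact h1

lemma Fld.bavg_deriv (h : Fld p v) (x : Euc d) : ∃ D : Euc d →L[ℝ] Euc d,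
    HasFDerivAt (bavg p.L0 v) D x ∧ LinearMap.trace ℝ (Euc d) D.toLinearMap = 0 := by
  have hc := h.lip.continuous
  have hfin : volume (box d p.L0) ≠ ⊤ := by rw [box_vol p.L0_pos]; exact ENNReal.ofReal_ne_top
  have : IsFiniteMeasure (volume.restrict (box d p.L0)) := ⟨by simpa using hfin.lt_top⟩
  have hqmp := (measurePreserving_add_left volume x).quasiMeasurePreserving
  have hd1 : ∀ᵐ y ∂(volume : Measure (Euc d)), DifferentiableAt ℝ v (x + y) :=
    hqmp.ae h.lip.ae_differentiableAt
  have ht1 := hqmp.ae h.div0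
  have hm : AEStronglyMeasurable (fun y => fderiv ℝ v (x + y)) (volume.restrict (box d p.L0)) := by
    apply Measurable.aestronglyMeasurable
    exact (measurable_fderiv ℝ v).comp (measurable_const_add x)
  have key := hasFDerivAt_integral_of_dominated_loc_of_lip (𝕜 := ℝ) (μ := volume.restrict (box d p.L0))
    (F := fun z y => v (z + y)) (F' := fun y => fderiv ℝ v (x + y)) (x₀ := x) (s := Set.univ)
    (bound := fun _ => p.Lp) univ_mem (Eventually.of_forall fun z => by
      apply Continuous.aestronglyMeasurable; fun_prop) (h.intOn x) hm
    (ae_of_all _ fun y => by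
      refine LipschitzOnWith.of_dist_le_mul fun z _ z' _ => ?_
      rw [dist_eq_norm, dist_eq_norm]
      have := h.vL (z + y) (z' + y)
      rw [add_sub_add_right_eq_sub] at this
      rw [Real.coe_nnabs, abs_of_nonneg p.Lp_nonneg]
      exact this) (integrable_const _) (by
      refine ae_restrict_of_ae ?_
      filter_upwards [hd1] with y hy
      have := hy.hasFDerivAt
      have h2 := HasFDerivAt.comp x this ((hasFDerivAt_id x).add_const y)
      simp only [id_eq, ContinuousLinearMap.comp_id] at h2
      exact h2)
  refine ⟨(p.L0 ^ d)⁻¹ • ∫ y in box d p.L0, fderiv ℝ v (x + y), key.2.fun_const_smul _, ?_⟩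
  have := trace_integral key.1 (ae_restrict_of_ae ht1)
  simp [this]

lemma Fld.bavg_coord (h : Fld p v) (x : Euc d) (i : Fin d) :
    (bavg p.L0 v x) i = (p.L0 ^ d)⁻¹ * ∫ y in box d p.L0, (v (x + y)) i := by
  have h1 := ContinuousLinearMap.integral_comp_comm (EuclideanSpace.proj i : Euc d →L[ℝ] ℝ) (h.intOn x)
  have h2 : ∫ y in box d p.L0, (v (x + y)) i = (∫ y in box d p.L0, v (x + y)) i := h1
  rw [h2]
  rfl

lemma Fld.bavg_cont (h : Fld p v) : Continuous (bavg p.L0 v) := by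
  have h0 : LipschitzWith ⟨p.Lp, p.Lp_nonneg⟩ (bavg p.L0 v) := by
    refine LipschitzWith.of_dist_le_mul fun x y => ?_
    rw [dist_eq_norm, dist_eq_norm]
    exact h.bavg_lip x y
  exact h0.continuous

/-- scalar flux estimate -/
lemma flux_sc (hε : 0 < ε) (hε1 : ε ≤ 1) {r : ℝ} (hr : 0 < r) (A : Set (Euc d))
    (hA : A.Nonempty) (hAm : MeasurableSet A) (i : Fin d) {R : ℝ} (hR : R = √d * p.L0)
    (u Vi : Euc d → ℝ) (huc : Continuous u) (hVc : Continuous Vi) (huK : ∀ x, |u x| ≤ p.K) (hVK : ∀ x, |Vi x| ≤ p.K)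
    (hVi : ∀ x, Vi x = (p.L0 ^ d)⁻¹ * ∫ y in box d p.L0, u (x + y)) :
    |∫ x in thickening r A, psi ε x * (gg ε (x i) * (u x - Vi x))| ≤
      2 * p.K * ε * (mu ε d).real (thickening r A \ A) +
      p.K * (ε * (R * Real.exp (d * R) / r) * (mu ε d).real (thickening r A \ A) +
        ε ^ 2 * (R * (d * Real.exp (d * R) + 2)) * (mu ε d).real (thickening r A)) := by
  have hfin : volume (box d p.L0) ≠ ⊤ := by rw [box_vol p.L0_pos]; exact ENNReal.ofReal_ne_top
  have : IsFiniteMeasure (volume.restrict (box d p.L0)) := ⟨by simpa using hfin.lt_top⟩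
  have hψi := psi_integrable (d := d) hε
  have hψc := psi_cont (d := d) (ε := ε)
  have hgc := gg_cont ε
  have hFc := Fr_cont A r
  have hB : MeasurableSet (thickening r A) := isOpen_thickening.measurableSet
  have hK := p.K_pos
  set B := thickening r A with hBdef
  set G : Euc d → ℝ := fun x => Fr A r x * (psi ε x * gg ε (x i)) with hG
  have hGc : Continuous G := by fun_prop
  have hGi : Integrable G := by
    have : G = fun x => (Fr A r x * gg ε (x i)) * psi ε x := by ext x; simp [hG]; ring
    rw [this]
    refine hψi.bdd_mul (c := ε) (by apply Continuous.aestronglyMeasurable; fun_prop) (ae_of_all _ fun x => ?_)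
    rw [norm_mul, Real.norm_of_nonneg (Fr_mem hr A x).1, Real.norm_eq_abs]
    calc _ ≤ 1 * ε := mul_le_mul (Fr_mem hr A x).2 (gg_le hε _) (abs_nonneg _) zero_le_one
      _ = ε := one_mul _
  have main : |∫ x, G x * (u x - Vi x)| ≤ p.K * (ε * (R * Real.exp (d * R) / r) * (mu ε d).real (B \ A) +
        ε ^ 2 * (R * (d * Real.exp (d * R) + 2)) * (mu ε d).real B) := by
    have e1 : ∀ x, G x * (u x - Vi x) = (p.L0 ^ d)⁻¹ * ∫ y in box d p.L0, G x * (u x - u (x + y)) := by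
      intro x
      have hi : Integrable (fun y => u (x + y)) (volume.restrict (box d p.L0)) := by
        refine Integrable.of_bound (by apply Continuous.aestronglyMeasurable; fun_prop) p.K (ae_of_all _ fun y => ?_)
        rw [Real.norm_eq_abs]; exact huK _
      rw [integral_const_mul, integral_sub (integrable_const _) hi]
      simp only [integral_const, MeasurableSet.univ, measureReal_restrict_apply, Set.univ_inter, box_real p.L0_pos, smul_eq_mul, hVi]
      have : p.L0 ^ d ≠ 0 := (pow_pos p.L0_pos d).ne'
      field_simp
    simp_rw [e1]
    rw [integral_const_mul, integral_integral_swap]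
    swap
    · have hp : Integrable (fun q : Euc d × Euc d => G q.1 * 1) (volume.prod (volume.restrict (box d p.L0))) :=
        hGi.mul_prod (integrable_const (1:ℝ))
      have := hp.bdd_mul (f := fun q : Euc d × Euc d => u q.1 - u (q.1 + q.2)) (c := 2 * p.K)
        (by apply Continuous.aestronglyMeasurable; fun_prop) (ae_of_all _ fun q => by
          rw [Real.norm_eq_abs]
          have := abs_sub (u q.1) (u (q.1 + q.2))
          linarith [huK q.1, huK (q.1 + q.2)])
      refine this.congr (ae_of_all _ fun q => ?_)
      simp only [Function.uncurry, mul_one]; ring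
    rw [← smul_eq_mul, ← Real.norm_eq_abs]
    refine avg_le p.L0_pos fun y hy => ?_
    have hyR : ‖y‖ ≤ R := by rw [hR]; exact box_norm hy
    have hIa : Integrable fun x => G x * u x := by
      have := hGi.bdd_mul (f := u) (c := p.K) huc.aestronglyMeasurable (ae_of_all _ fun x => by
        rw [Real.norm_eq_abs]; exact huK x)
      simpa [mul_comm] using this
    have hIb : Integrable fun x => G x * u (x + y) := by
      have := hGi.bdd_mul (f := fun x => u (x + y)) (c := p.K) (by apply Continuous.aestronglyMeasurable; fun_prop)
        (ae_of_all _ fun x => by rw [Real.norm_eq_abs]; exact huK _)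
      simpa [mul_comm] using this
    have hIc : Integrable fun x => G (x - y) * u x := by
      have := hIb.comp_sub_right y
      simpa using this
    have e2 : ∫ x, G x * (u x - u (x + y)) = ∫ x, (G x - G (x - y)) * u x := by
      simp_rw [mul_sub, sub_mul]
      rw [integral_sub hIa hIb, integral_sub hIa hIc]
      congr 1
      rw [← integral_sub_right_eq_self (fun x => G x * u (x + y)) y]
      simp
    rw [e2]
    refine (norm_integral_le_integral_norm _).trans ?_
    refine le_trans ?_ (mul_le_mul_of_nonneg_left (T1 hε hε1 hr A hA y hyR i) hK.le)
    rw [← integral_const_mul]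
    refine integral_mono_of_nonneg (ae_of_all _ fun x => norm_nonneg _) 
      (((hGi.sub (hGi.comp_sub_right y)).abs).const_mul _) (ae_of_all _ fun x => ?_)
    simp only [norm_mul, Real.norm_eq_abs]
    rw [mul_comm]
    exact mul_le_mul_of_nonneg_right (huK x) (abs_nonneg _)
  have hw : ∀ x, |u x - Vi x| ≤ 2 * p.K := fun x => by
    have := abs_sub (u x) (Vi x)
    linarith [huK x, hVK x]
  set H : Euc d → ℝ := fun x => psi ε x * (gg ε (x i) * (u x - Vi x)) with hH
  have hHc : Continuous H := by fun_prop
  have hHb : ∀ x, |H x| ≤ 2 * p.K * ε * psi ε x := fun x => by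
    simp only [hH]
    rw [abs_mul, abs_mul, abs_of_pos (psi_pos hε x)]
    have := mul_le_mul (gg_le hε (x i)) (hw x) (abs_nonneg _) hε.le
    nlinarith [psi_pos hε x]
  have hHi : Integrable H := 
    (hψi.const_mul (2 * p.K * ε)).mono' hHc.aestronglyMeasurable (ae_of_all _ fun x => hHb x)
  change |∫ x in B, H x| ≤ _
  have hGu : Integrable fun x => G x * (u x - Vi x) := by
    have := hGi.bdd_mul (f := fun x => u x - Vi x) (c := 2 * p.K) (by apply Continuous.aestronglyMeasurable; fun_prop)
        (ae_of_all _ fun x => by rw [Real.norm_eq_abs]; exact hw x)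
    simpa [mul_comm] using this
  have e3 : ∫ x in B, H x = (∫ x, (B.indicator H x - G x * (u x - Vi x))) + ∫ x, G x * (u x - Vi x) := by
    rw [integral_sub (hHi.indicator hB) hGu, integral_indicator hB]; ring
  rw [e3]
  refine (abs_add_le _ _).trans (add_le_add ?_ main)
  have hBA := hB.diff hAm
  rw [mu_toReal hε hBA, ← integral_const_mul, ← integral_indicator hBA]
  refine (abs_integral_le_integral_abs).trans ?_
  refine integral_mono_of_nonneg (ae_of_all _ fun x => abs_nonneg _) ((hψi.const_mul _).indicator hBA) (ae_of_all _ fun x => ?_)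
  beta_reduce
  have eG : G x * (u x - Vi x) = Fr A r x * H x := by simp only [hG, hH]; ring
  rw [eG]
  by_cases hx : x ∈ B
  · by_cases hxA : x ∈ A
    · simp [hx, hxA, Fr_mem_A hr A hxA]
    · rw [Set.indicator_of_mem hx, Set.indicator_of_mem (show x ∈ B \ A from ⟨hx, hxA⟩)]
      rw [← one_sub_mul, abs_mul, abs_of_nonneg (by linarith [(Fr_mem hr A x).2])]
      have := mul_le_mul (show 1 - Fr A r x ≤ 1 by linarith [(Fr_mem hr A x).1]) (hHb x) (abs_nonneg _) zero_le_one
      linarith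
  · simp [hx, Fr_notMem hr hA hx]

lemma Fld.flux (h : Fld p v) (hε : 0 < ε) (hε1 : ε ≤ 1) {r : ℝ} (hr : 0 < r) (A : Set (Euc d))
    (hA : A.Nonempty) (hAm : MeasurableSet A) (i : Fin d) {R : ℝ} (hR : R = √d * p.L0) :
    |∫ x in thickening r A, psi ε x * (gg ε (x i) * (v x i - bavg p.L0 v x i))| ≤
      2 * p.K * ε * (mu ε d).real (thickening r A \ A) +
      p.K * (ε * (R * Real.exp (d * R) / r) * (mu ε d).real (thickening r A \ A) +
        ε ^ 2 * (R * (d * Real.exp (d * R) + 2)) * (mu ε d).real (thickening r A)) := by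
  have hc := h.lip.continuous
  have hb := h.bavg_cont
  have h1 : Continuous fun x => v x i := (EuclideanSpace.proj (𝕜 := ℝ) (ι := Fin d) i).continuous.comp hc
  have h2 : Continuous fun x => bavg p.L0 v x i := (EuclideanSpace.proj (𝕜 := ℝ) (ι := Fin d) i).continuous.comp hb
  exact flux_sc hε hε1 hr A hA hAm i hR (fun x => v x i) (fun x => bavg p.L0 v x i) h1 h2
    (fun x => (coord_le _ i).trans (h.vK x)) (fun x => (coord_le _ i).trans (h.bavg_le x))
    (fun x => h.bavg_coord x i)

end GEq

namespace GEq
open scoped NNReal ENNReal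
variable {d : ℕ} {ε : ℝ} {p : Par} {v : Euc d → Euc d}

lemma det_diff {n : ℕ} : Differentiable ℝ (fun M : Fin n → Fin n → ℝ => Matrix.det (Matrix.of M)) := by
  simp only [Matrix.det_apply]
  simp only [Matrix.of_apply]
  fun_prop

lemma det_expand {n : ℕ} (M : Fin n → Fin n → ℝ) :
    HasDerivAt (fun r : ℝ => Matrix.det (1 + r • Matrix.of M)) (Matrix.trace (Matrix.of M)) 0 := by
  have h1 : ∀ r : ℝ, Matrix.det (1 + r • Matrix.of M) = 1 + Matrix.trace (Matrix.of M) * r + 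
      ((Matrix.det (1 + (Polynomial.X : Polynomial ℝ) • (Matrix.of M).map Polynomial.C)).divX.divX).eval r * r ^ 2 :=
    fun r => Matrix.det_one_add_smul r _
  simp_rw [h1]
  generalize (Matrix.det (1 + (Polynomial.X : Polynomial ℝ) • (Matrix.of M).map Polynomial.C)).divX.divX = q
  have h2 := (((hasDerivAt_id (0:ℝ)).const_mul (Matrix.trace (Matrix.of M))).const_add 1).add
    ((q.hasDerivAt 0).mul (hasDerivAt_pow 2 (0:ℝ)))
  convert! h2 using 1
  simp

lemma det_lemma_mat {n : ℕ} {C η : ℝ} (hC : 0 ≤ C) (hη : 0 < η) : ∃ h0 : ℝ, 0 < h0 ∧ ∀ h : ℝ, 0 < h → h ≤ h0 →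
    ∀ M : Fin n → Fin n → ℝ, ‖M‖ ≤ C → Matrix.trace (Matrix.of M) = 0 → 1 - η * h ≤ Matrix.det (1 + h • Matrix.of M) := by
  set I : Fin n → Fin n → ℝ := fun i j => (1 : Matrix (Fin n) (Fin n) ℝ) i j with hI
  set f := (fun M : Fin n → Fin n → ℝ => Matrix.det (Matrix.of M)) with hf
  have e : ∀ (r : ℝ) M, f (I + r • M) = Matrix.det (1 + r • Matrix.of M) := fun r M => rfl
  have hd : HasFDerivAt f (fderiv ℝ f I) I := (det_diff I).hasFDerivAt
  have ht : ∀ M, fderiv ℝ f I M = Matrix.trace (Matrix.of M) := by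
    intro M
    have h1 := det_expand M
    have h2 : HasDerivAt (fun r : ℝ => I + r • M) M 0 := by
      simpa using ((hasDerivAt_id (0:ℝ)).smul_const M).const_add I
    have h3 : HasDerivAt (fun r : ℝ => f (I + r • M)) (fderiv ℝ f I M) 0 := by
      have : HasFDerivAt f (fderiv ℝ f I) (I + (0:ℝ) • M) := by simpa using hd
      exact this.comp_hasDerivAt (0:ℝ) h2
    exact h3.unique h1
  have h4 := hd.isLittleO.def (show 0 < η / (C + 1) by positivity)
  rw [Metric.eventually_nhds_iff] at h4
  obtain ⟨δ, hδ, h5⟩ := h4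
  refine ⟨δ / (2 * (C + 1)), by positivity, fun h hh hh0 M hM hM0 => ?_⟩
  have hn : ‖h • M‖ ≤ h * C := by
    rw [norm_smul, Real.norm_of_nonneg hh.le]; gcongr
  have h6 : h * (2 * (C + 1)) ≤ δ := (le_div_iff₀ (by positivity)).1 hh0
  have h7 := @h5 (I + h • M) (by
    rw [dist_eq_norm, add_sub_cancel_left]
    refine lt_of_le_of_lt hn ?_
    nlinarith)
  rw [add_sub_cancel_left, map_smul, ht M, hM0, e] at h7
  have h8 : f I = 1 := by
    have := e 0 M
    simpa using this
  rw [h8, smul_zero, sub_zero, Real.norm_eq_abs] at h7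
  have h9 : η / (C + 1) * ‖h • M‖ ≤ η * h := by
    rw [div_mul_eq_mul_div, div_le_iff₀ (by positivity)]
    nlinarith
  linarith [(abs_le.1 (h7.trans h9)).1]

lemma det_lemma {C η : ℝ} (hC : 0 ≤ C) (hη : 0 < η) : ∃ h0 : ℝ, 0 < h0 ∧ ∀ h : ℝ, 0 < h → h ≤ h0 →
    ∀ B : Euc d →L[ℝ] Euc d, ‖B‖ ≤ C → LinearMap.trace ℝ (Euc d) B.toLinearMap = 0 →
      1 - η * h ≤ (ContinuousLinearMap.id ℝ (Euc d) + h • B).det := by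
  obtain ⟨h0, hh0, H⟩ := det_lemma_mat (n := d) hC hη
  refine ⟨h0, hh0, fun h hh hhh B hB hB0 => ?_⟩
  let bs := (EuclideanSpace.basisFun (Fin d) ℝ).toBasis
  have h1 := H h hh hhh (fun i j => LinearMap.toMatrix bs bs B.toLinearMap i j) ?_ ?_
  · refine h1.trans_eq ?_
    rw [ContinuousLinearMap.det, ← LinearMap.det_toMatrix bs]
    congr 1
    ext i j
    simp [Matrix.one_apply, LinearMap.toMatrix_apply, bs, Finsupp.single_apply, eq_comm]
  · refine (pi_norm_le_iff_of_nonneg hC).2 fun i => (pi_norm_le_iff_of_nonneg hC).2 fun j => ?_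
    simp only [LinearMap.toMatrix_apply, bs]
    have : ‖B (EuclideanSpace.single j 1)‖ ≤ C := by
      refine (B.le_opNorm _).trans ?_
      simpa using hB
    refine le_trans ?_ this
    simpa using coord_le (B (EuclideanSpace.single j 1)) i
  · rw [← hB0, LinearMap.trace_eq_matrix_trace ℝ bs]
    rfl

def Eh (p : Par) (h : ℝ) (v : Euc d → Euc d) (x : Euc d) : Euc d := x + h • (v x - bavg p.L0 v x)

lemma Fld.w_le (hf : Fld p v) (x : Euc d) : ‖v x - bavg p.L0 v x‖ ≤ 2 * p.K := by
  have := norm_sub_le (v x) (bavg p.L0 v x)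
  linarith [hf.vK x, hf.bavg_le x]

lemma Fld.w_lip (hf : Fld p v) (x y : Euc d) : 
    ‖(v x - bavg p.L0 v x) - (v y - bavg p.L0 v y)‖ ≤ 2 * p.Lp * ‖x - y‖ := by
  rw [sub_sub_sub_comm]
  have := norm_sub_le (v x - v y) (bavg p.L0 v x - bavg p.L0 v y)
  linarith [hf.vL x y, hf.bavg_lip x y]

lemma Fld.w_cont (hf : Fld p v) : Continuous fun x => v x - bavg p.L0 v x :=
  hf.lip.continuous.sub hf.bavg_cont

lemma Fld.Eh_cont (hf : Fld p v) (h : ℝ) : Continuous (Eh p h v) :=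
  continuous_id.add (hf.w_cont.const_smul h)

lemma Fld.Eh_inj (hf : Fld p v) {h : ℝ} (hh : 0 < h) (hs : 2 * p.Lp * h < 1) : Function.Injective (Eh p h v) := by
  intro x y hxy
  have h1 : x - y = -(h • ((v x - bavg p.L0 v x) - (v y - bavg p.L0 v y))) := by
    unfold Eh at hxy
    rw [smul_sub, neg_sub, sub_eq_sub_iff_add_eq_add, hxy, add_comm]
  have h2 : ‖x - y‖ ≤ h * (2 * p.Lp * ‖x - y‖) := by
    conv_lhs => rw [h1]
    rw [norm_neg, norm_smul, Real.norm_of_nonneg hh.le]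
    exact mul_le_mul_of_nonneg_left (hf.w_lip x y) hh.le
  have h3 : ‖x - y‖ = 0 := by nlinarith [norm_nonneg (x - y)]
  exact sub_eq_zero.1 (norm_eq_zero.1 h3)

lemma Fld.Eh_meas (hf : Fld p v) {h : ℝ} (hh : 0 < h) (hs : 2 * p.Lp * h < 1) {B : Set (Euc d)} (hB : MeasurableSet B) :
    MeasurableSet (Eh p h v '' B) :=
  hB.image_of_continuousOn_injOn (hf.Eh_cont h).continuousOn (hf.Eh_inj hh hs).injOn

lemma Fld.psiE_int (hf : Fld p v) (hε : 0 < ε) (h : ℝ) : Integrable fun x => psi ε (Eh p h v x) := by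
  refine ((psi_integrable (d := d) hε).const_mul (Real.exp (ε * (d * (|h| * (2 * p.K)))))).mono'
    (psi_cont.comp (hf.Eh_cont h)).aestronglyMeasurable (ae_of_all _ fun x => ?_)
  rw [Real.norm_of_nonneg (psi_pos hε _).le]
  refine (psi_ratio hε x _).trans ?_
  refine mul_le_mul_of_nonneg_right (Real.exp_le_exp.2 ?_) (psi_pos hε x).le
  have : ‖Eh p h v x - x‖ ≤ |h| * (2 * p.K) := by
    unfold Eh
    rw [add_sub_cancel_left, norm_smul, Real.norm_eq_abs]
    exact mul_le_mul_of_nonneg_left (hf.w_le x) (abs_nonneg _)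
  gcongr

lemma Fld.push (hf : Fld p v) (hε : 0 < ε) {h : ℝ} (hh : 0 < h) (hs : 2 * p.Lp * h < 1) {η : ℝ} (hη1 : η * h ≤ 1)
    (hdet : ∀ B : Euc d →L[ℝ] Euc d, ‖B‖ ≤ 2 * p.Lp → LinearMap.trace ℝ (Euc d) B.toLinearMap = 0 →
      1 - η * h ≤ (ContinuousLinearMap.id ℝ (Euc d) + h • B).det) {B : Set (Euc d)} (hB : MeasurableSet B) :
    (1 - η * h) * ∫ x in B, psi ε (Eh p h v x) ≤ (mu ε d).real (Eh p h v '' B) := by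
  have hmp := mu_prob (d := d) hε
  have hae : ∀ᵐ x ∂(volume : Measure (Euc d)), DifferentiableAt ℝ v x ∧ 
      LinearMap.trace ℝ (Euc d) (fderiv ℝ v x).toLinearMap = 0 := hf.lip.ae_differentiableAt.and hf.div0
  choose D hD hDt using hf.bavg_deriv
  set N := toMeasurable volume {x | ¬ (DifferentiableAt ℝ v x ∧ 
      LinearMap.trace ℝ (Euc d) (fderiv ℝ v x).toLinearMap = 0)} with hN
  have hN0 : volume N = 0 := by rw [hN, measure_toMeasurable]; exact hae
  have hNm : MeasurableSet N := measurableSet_toMeasurable _ _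
  have hgood : ∀ x, x ∉ N → DifferentiableAt ℝ v x ∧ LinearMap.trace ℝ (Euc d) (fderiv ℝ v x).toLinearMap = 0 := by
    intro x hx
    by_contra hcon
    exact hx (subset_toMeasurable _ _ hcon)
  set s := B \ N with hsdef
  have hsm : MeasurableSet s := hB.diff hNm
  have hder : ∀ x ∈ s, HasFDerivAt (Eh p h v) (ContinuousLinearMap.id ℝ (Euc d) + h • (fderiv ℝ v x - D x)) x := by
    intro x hx
    have h1 := (hgood x hx.2).1.hasFDerivAt
    exact (hasFDerivAt_id x).add ((h1.sub (hD x)).const_smul h)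
  have hdet' : ∀ x ∈ s, 1 - η * h ≤ |(ContinuousLinearMap.id ℝ (Euc d) + h • (fderiv ℝ v x - D x)).det| := by
    intro x hx
    refine le_trans (hdet _ ?_ ?_) (le_abs_self _)
    · have h1 : ‖fderiv ℝ v x‖ ≤ p.Lp := norm_fderiv_le_of_lipschitz ℝ hf.lip
      have hl : LipschitzWith ⟨p.Lp, p.Lp_nonneg⟩ (bavg p.L0 v) := by
        refine LipschitzWith.of_dist_le_mul fun x y => ?_
        rw [dist_eq_norm, dist_eq_norm]
        exact hf.bavg_lip x y
      have h2 : ‖D x‖ ≤ p.Lp := by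
        rw [← (hD x).fderiv]; exact norm_fderiv_le_of_lipschitz ℝ hl
      linarith [norm_sub_le (fderiv ℝ v x) (D x)]
    · have := (hgood x hx.2).2
      simp [this, hDt]
  have hch := lintegral_image_eq_lintegral_abs_det_fderiv_mul volume hsm (fun x hx => (hder x hx).hasFDerivWithinAt)
    (hf.Eh_inj hh hs).injOn (fun x => ENNReal.ofReal (psi ε x))
  have hsB : (s : Set (Euc d)) =ᵐ[volume] B := diff_null_ae_eq_self hN0
  have hEi := hf.psiE_int hε h
  have key : ENNReal.ofReal ((1 - η * h) * ∫ x in B, psi ε (Eh p h v x)) ≤ mu ε d (Eh p h v '' B) := by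
    calc ENNReal.ofReal ((1 - η * h) * ∫ x in B, psi ε (Eh p h v x)) 
        = ENNReal.ofReal (1 - η * h) * ∫⁻ x in B, ENNReal.ofReal (psi ε (Eh p h v x)) := by
          rw [ENNReal.ofReal_mul (by linarith), ofReal_integral_eq_lintegral_ofReal hEi.integrableOn
            (ae_of_all _ fun x => (psi_pos hε _).le)]
      _ = ∫⁻ x in s, ENNReal.ofReal (1 - η * h) * ENNReal.ofReal (psi ε (Eh p h v x)) := by
          rw [lintegral_const_mul' _ _ ENNReal.ofReal_ne_top, setLIntegral_congr hsB]
      _ ≤ ∫⁻ x in s, ENNReal.ofReal |(ContinuousLinearMap.id ℝ (Euc d) + h • (fderiv ℝ v x - D x)).det| *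
            ENNReal.ofReal (psi ε (Eh p h v x)) := by
          refine setLIntegral_mono' hsm fun x hx => ?_
          gcongr
          exact hdet' x hx
      _ = ∫⁻ x in Eh p h v '' s, ENNReal.ofReal (psi ε x) := hch.symm
      _ = mu ε d (Eh p h v '' s) := by
          rw [mu, withDensity_apply _ (hf.Eh_meas hh hs hsm)]
      _ ≤ _ := measure_mono (Set.image_mono Set.diff_subset)
  exact (ENNReal.ofReal_le_iff_le_toReal (measure_ne_top _ _)).1 key

end GEq

namespace GEq
open scoped NNReal ENNReal
variable {d : ℕ} {ε : ℝ} {p : Par} {v : Euc d → Euc d}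

def CC (d : ℕ) (p : Par) : ℝ := d * (2 * p.K + p.K * (√d * p.L0 * Real.exp (d * (√d * p.L0))) +
  p.K * (√d * p.L0 * (d * Real.exp (d * (√d * p.L0)) + 2))) + 2 * p.K ^ 2

lemma CC_nonneg : 0 ≤ CC d p := by
  have := p.K_pos
  have := p.L0_pos
  unfold CC; positivity

def cp (p : Par) : ℝ := (p.b - p.a) / 2
lemma cp_pos : 0 < cp p := by unfold cp; linarith [p.a_lt_b]

lemma Fld.psi_push (hf : Fld p v) (hε : 0 < ε) (hε1 : ε ≤ 1) {h : ℝ} (hh : 0 < h) (hh1 : h ≤ 1) (A : Set (Euc d))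
    (hA : A.Nonempty) (hAm : MeasurableSet A) :
    (1 - CC d p * ε ^ 2 * h) * (mu ε d).real (thickening (cp p * h) A) -
      CC d p * ε * (h + 1 / cp p) * (mu ε d).real (thickening (cp p * h) A \ A) ≤
      ∫ x in thickening (cp p * h) A, psi ε (Eh p h v x) := by
  have hcp := cp_pos (p := p)
  have hr : 0 < cp p * h := by positivity
  set r := cp p * h with hrdef
  set B := thickening r A with hBdef
  have hB : MeasurableSet B := isOpen_thickening.measurableSet
  set mB := (mu ε d).real B with hmB
  set mq := (mu ε d).real (B \ A) with hmq
  have hmB0 : 0 ≤ mB := measureReal_nonneg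
  have hmq0 : 0 ≤ mq := measureReal_nonneg
  have hK := p.K_pos
  have hL := p.L0_pos
  set R := √d * p.L0 with hR
  have hR0 : 0 ≤ R := by positivity
  have hflux := fun i => hf.flux hε hε1 hr A hA hAm i hR
  have hψi := psi_integrable (d := d) hε
  set w : Euc d → Euc d := fun x => v x - bavg p.L0 v x with hw
  have hwc : Continuous w := hf.w_cont
  have hwi : ∀ i, Continuous fun x => w x i := fun i => 
    (EuclideanSpace.proj (𝕜 := ℝ) (ι := Fin d) i).continuous.comp hwc
  have hgi : ∀ i, Integrable (fun x => psi ε x * (gg ε (x i) * w x i)) := by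
    intro i
    have hgc : Continuous fun x : Euc d => gg ε (x i) := (gg_cont ε).comp (by fun_prop)
    refine (hψi.const_mul (ε * (2 * p.K))).mono' (psi_cont.mul (hgc.mul (hwi i))).aestronglyMeasurable 
      (ae_of_all _ fun x => ?_)
    rw [norm_mul, norm_mul, Real.norm_of_nonneg (psi_pos hε x).le, mul_comm]
    refine mul_le_mul_of_nonneg_right ?_ (psi_pos hε x).le
    exact mul_le_mul (gg_le hε _) ((coord_le _ i).trans (hf.w_le x)) (norm_nonneg _) hε.le
  have h1 : ∀ x, psi ε x - h * ∑ i, psi ε x * (gg ε (x i) * w x i) - 2 * p.K ^ 2 * ε ^ 2 * h * psi ε x ≤ psi ε (Eh p h v x) := by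
    intro x
    refine le_trans ?_ (psi_taylor hε x (h • w x))
    have e1 : ∑ i, gg ε (x i) * (h • w x) i = h * ∑ i, gg ε (x i) * w x i := by
      rw [Finset.mul_sum]; refine Finset.sum_congr rfl fun i _ => ?_
      simp; ring
    rw [e1, ← Finset.mul_sum, norm_smul, Real.norm_of_nonneg hh.le]
    have h2 : ‖w x‖ ≤ 2 * p.K := hf.w_le x
    have h3 : (h * ‖w x‖) ^ 2 ≤ 4 * p.K ^ 2 * h := by
      have : ‖w x‖ ^ 2 ≤ (2 * p.K) ^ 2 := pow_le_pow_left₀ (norm_nonneg _) h2 2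
      rw [mul_pow]
      have h4 : h ^ 2 ≤ h := by nlinarith
      calc h ^ 2 * ‖w x‖ ^ 2 ≤ h * (2 * p.K) ^ 2 := by gcongr
        _ = _ := by ring
    have h5 : ε ^ 2 * (h * ‖w x‖) ^ 2 / 2 ≤ 2 * p.K ^ 2 * ε ^ 2 * h := by nlinarith [sq_nonneg ε]
    have h6 := mul_le_mul_of_nonneg_left h5 (psi_pos hε x).le
    nlinarith
  have h2 : ∫ x in B, (psi ε x - h * ∑ i, psi ε x * (gg ε (x i) * w x i) - 2 * p.K ^ 2 * ε ^ 2 * h * psi ε x) ≤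
      ∫ x in B, psi ε (Eh p h v x) := by
    refine setIntegral_mono ?_ (hf.psiE_int hε h).integrableOn h1
    exact ((hψi.sub ((integrable_finsetSum _ fun i _ => hgi i).const_mul h)).sub (hψi.const_mul _)).integrableOn
  refine le_trans ?_ h2
  have hsum : Integrable (fun x => h * ∑ i, psi ε x * (gg ε (x i) * w x i)) (volume.restrict B) :=
    ((integrable_finsetSum _ fun i _ => hgi i).const_mul h).integrableOn
  have hdf : Integrable (fun x => psi ε x - h * ∑ i, psi ε x * (gg ε (x i) * w x i)) (volume.restrict B) :=
    hψi.integrableOn.integrable.sub hsum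
  rw [integral_sub hdf (hψi.const_mul _).integrableOn,
    integral_sub hψi.integrableOn hsum, integral_const_mul, integral_const_mul,
    integral_finsetSum _ fun i _ => (hgi i).integrableOn, ← mu_toReal hε hB]
  have h3 : ∑ i, ∫ x in B, psi ε x * (gg ε (x i) * w x i) ≤ d * (2 * p.K * ε * mq +
      p.K * (ε * (R * Real.exp (d * R) / r) * mq + ε ^ 2 * (R * (d * Real.exp (d * R) + 2)) * mB)) := by
    refine (Finset.sum_le_card_nsmul _ _ _ fun i _ => (le_abs_self _).trans (hflux i)).trans ?_
    simp only [Finset.card_univ, Fintype.card_fin, nsmul_eq_mul]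
    exact le_rfl
  have h4 := mul_le_mul_of_nonneg_left h3 hh.le
  have e5 : h * (d * (2 * p.K * ε * mq +
      p.K * (ε * (R * Real.exp (d * R) / r) * mq + ε ^ 2 * (R * (d * Real.exp (d * R) + 2)) * mB))) =
      (d * (2 * p.K)) * (ε * h * mq) + (d * (p.K * (R * Real.exp (d * R)))) * (ε * (1 / cp p) * mq) + 
      (d * (p.K * (R * (d * Real.exp (d * R) + 2)))) * (ε ^ 2 * h * mB) := by
    clear_value mq mB R; rw [hrdef]; field_simp; ring
  rw [e5] at h4
  have hX : 0 ≤ ε * h * mq := by positivity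
  have hY : 0 ≤ ε * (1 / cp p) * mq := by positivity
  have hZ : 0 ≤ ε ^ 2 * h * mB := by positivity
  have c1 : 0 ≤ (d:ℝ) * (2 * p.K) := by positivity
  have c2 : 0 ≤ (d:ℝ) * (p.K * (R * Real.exp (d * R))) := by positivity
  have c3 : 0 ≤ (d:ℝ) * (p.K * (R * (d * Real.exp (d * R) + 2))) := by positivity
  have hCC : CC d p = d * (2 * p.K) + d * (p.K * (R * Real.exp (d * R))) + d * (p.K * (R * (d * Real.exp (d * R) + 2)))
    + 2 * p.K ^ 2 := by unfold CC; rw [hR]; ring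
  have hK2 : 0 ≤ 2 * p.K ^ 2 := by positivity
  set X1 := (d:ℝ) * (2 * p.K)
  set X2 := (d:ℝ) * (p.K * (R * Real.exp (d * R)))
  set X3 := (d:ℝ) * (p.K * (R * (d * Real.exp (d * R) + 2)))
  rw [hCC]
  have i1 : X1 * (ε * h * mq) ≤ (X1 + X2 + X3 + 2 * p.K ^ 2) * (ε * h * mq) := 
    mul_le_mul_of_nonneg_right (by linarith) hX
  have i2 : X2 * (ε * (1 / cp p) * mq) ≤ (X1 + X2 + X3 + 2 * p.K ^ 2) * (ε * (1 / cp p) * mq) := 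
    mul_le_mul_of_nonneg_right (by linarith) hY
  have i3 : (X3 + 2 * p.K ^ 2) * (ε ^ 2 * h * mB) ≤ (X1 + X2 + X3 + 2 * p.K ^ 2) * (ε ^ 2 * h * mB) := 
    mul_le_mul_of_nonneg_right (by linarith) hZ
  linarith

/-- Cheeger in real form -/
lemma cheeger_real (hε : 0 < ε) {r : ℝ} (hr : 0 < r) (A : Set (Euc d)) (hA : A.Nonempty)
    (h34 : (mu ε d).real (thickening r A) ≤ 3 / 4) :
    r * ε * (1 / (8 * Real.exp 1 * (d + 1))) * (mu ε d).real A ≤ (mu ε d).real (thickening r A \ A) := by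
  have hmp := mu_prob (d := d) hε
  have h := cheeger_mu hε hr A hA
  have h2 := ENNReal.toReal_mono (by
    refine ENNReal.mul_ne_top (ENNReal.mul_ne_top (by simp) ?_) (measure_ne_top _ _)
    unfold kap; exact ENNReal.mul_ne_top (by simp) ENNReal.ofReal_ne_top) h
  simp only [ENNReal.toReal_mul, kap, ENNReal.toReal_ofReal hr.le, ENNReal.toReal_natCast, ENNReal.toReal_ofNat,
    ENNReal.toReal_ofReal (show 0 ≤ Real.exp 1 / ε by positivity)] at h2
  have h3 : (mu ε d (thickening r A)ᶜ).toReal = 1 - (mu ε d).real (thickening r A) := 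
    probReal_compl_eq_one_sub isOpen_thickening.measurableSet
  rw [h3] at h2
  change r * ((mu ε d).real A * _) ≤ _ * (mu ε d).real _ at h2
  set a := (mu ε d).real A
  set q := (mu ε d).real (thickening r A \ A)
  have ha : 0 ≤ a := measureReal_nonneg
  have hq : 0 ≤ q := measureReal_nonneg
  have he := Real.exp_pos 1
  have h4 : r * (a * (1 / 4)) ≤ d * (2 * (Real.exp 1 / ε)) * q := by
    refine le_trans ?_ h2
    gcongr
    linarith
  have h5 : r * ε * a ≤ 8 * Real.exp 1 * d * q := by
    have := mul_le_mul_of_nonneg_right h4 hε.le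
    have e : d * (2 * (Real.exp 1 / ε)) * q * ε = d * 2 * Real.exp 1 * q := by field_simp
    rw [e] at this
    linarith
  rw [mul_one_div, div_mul_eq_mul_div, div_le_iff₀ (by positivity)]
  nlinarith [mul_nonneg he.le hq]

lemma step_arith (x y z mB a q I m' : ℝ) {w : ℝ} (hx : 0 < x) (hx1 : x ≤ 1 / 2) (f1 : y ≤ 1 / 16) (f3 : y ≤ x / 8) (f2 : z ≤ 1 / 16)
    (ha : 0 ≤ a) (hq : 0 ≤ q) (hs : mB = a + q) (g1 : (1 - y) * mB - z * q ≤ I) (hp : (1 - x / 8) * I ≤ m')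
    (hch : mB ≤ 3 / 4 → x * a ≤ q) (hw : w = 1 + x / 2) :
    (4 / 5) * mB ≤ m' ∧ (mB ≤ 3 / 4 → w * a ≤ m') := by
  have i1 := mul_le_mul_of_nonneg_right f1 (show 0 ≤ mB by linarith)
  have i2 := mul_le_mul_of_nonneg_right f2 hq
  have hI1 : (7 / 8) * mB ≤ I := by linarith
  constructor
  · have : (15 / 16) * I ≤ (1 - x / 8) * I := mul_le_mul_of_nonneg_right (by linarith) (by linarith)
    linarith
  · intro h34
    have hq2 := hch h34
    subst hw
    have i0 := mul_le_mul_of_nonneg_right f3 ha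
    have i3 := mul_le_mul_of_nonneg_right f1 hq
    have hI2 : (1 + 3 / 4 * x) * a ≤ I := by subst hs; linarith
    refine le_trans ?_ (le_trans (mul_le_mul_of_nonneg_left hI2 (by linarith)) hp)
    rw [← mul_assoc]
    refine mul_le_mul_of_nonneg_right ?_ ha
    nlinarith

lemma step_exists (d : ℕ) (p : Par) : ∃ ε κ h0 : ℝ, 0 < ε ∧ 0 < κ ∧ 0 < h0 ∧ 2 * p.Lp * h0 < 1 ∧
    ∀ h : ℝ, 0 < h → h ≤ h0 → ∀ v : Euc d → Euc d, Fld p v → ∀ A : Set (Euc d), A.Nonempty → MeasurableSet A →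
      (4 / 5) * (mu ε d).real (thickening (cp p * h) A) ≤ (mu ε d).real (Eh p h v '' thickening (cp p * h) A) ∧
      ((mu ε d).real (thickening (cp p * h) A) ≤ 3 / 4 → 
        (1 + κ * h) * (mu ε d).real A ≤ (mu ε d).real (Eh p h v '' thickening (cp p * h) A)) := by
  have hcp := cp_pos (p := p)
  have hC := CC_nonneg (d := d) (p := p)
  have hLp := p.Lp_nonneg
  have hcd : 0 < 1 / (8 * Real.exp 1 * (d + 1)) := by positivity
  set C := CC d p with hCdef
  set cd := 1 / (8 * Real.exp 1 * (d + 1)) with hcddef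
  obtain ⟨ε, hε, he1, he2, he3⟩ : ∃ ε : ℝ, 0 < ε ∧ ε ≤ 1 ∧ C * ε ≤ cp p * cd / 8 ∧ C * ε * (1 + 1 / cp p) ≤ 1 / 16 := by
    refine ⟨min 1 (min (cp p * cd / 8 / (C + 1)) (1 / 16 / ((C + 1) * (1 + 1 / cp p)))), by positivity, min_le_left _ _, ?_, ?_⟩
    · have h1 : min 1 (min (cp p * cd / 8 / (C + 1)) (1 / 16 / ((C + 1) * (1 + 1 / cp p)))) ≤ cp p * cd / 8 / (C + 1) :=
        (min_le_right _ _).trans (min_le_left _ _)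
      have h2 := mul_le_mul_of_nonneg_left h1 hC
      refine h2.trans ?_
      rw [mul_div_assoc', div_le_iff₀ (by positivity)]
      nlinarith [mul_pos hcp hcd]
    · have h1 : min 1 (min (cp p * cd / 8 / (C + 1)) (1 / 16 / ((C + 1) * (1 + 1 / cp p)))) ≤ 1 / 16 / ((C + 1) * (1 + 1 / cp p)) :=
        (min_le_right _ _).trans (min_le_right _ _)
      have h3 : 0 ≤ 1 + 1 / cp p := by positivity
      have h2 := mul_le_mul_of_nonneg_right (mul_le_mul_of_nonneg_left h1 hC) h3
      refine h2.trans ?_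
      rw [mul_div_assoc', div_mul_eq_mul_div, div_le_iff₀ (by positivity)]
      nlinarith
  set k := cp p * cd * ε with hk
  have hk0 : 0 < k := by positivity
  obtain ⟨h1, hh1, hdet⟩ := det_lemma (d := d) (C := 2 * p.Lp) (η := k / 8) (by positivity) (by positivity)
  refine ⟨ε, k / 2, min (min 1 h1) (min (1 / (2 * k)) (min (1 / (4 * (p.Lp + 1))) (1 / 2))), hε, by positivity, by positivity, ?_, ?_⟩
  · have : min (min 1 h1) (min (1 / (2 * k)) (min (1 / (4 * (p.Lp + 1))) (1 / 2))) ≤ 1 / (4 * (p.Lp + 1)) :=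
      (min_le_right _ _).trans ((min_le_right _ _).trans (min_le_left _ _))
    have h2 := mul_le_mul_of_nonneg_left this (show 0 ≤ 2 * p.Lp by positivity)
    refine lt_of_le_of_lt h2 ?_
    rw [mul_one_div, div_lt_one (by positivity)]
    linarith
  intro h hh hhm v hf A hA hAm
  simp only [le_min_iff] at hhm
  obtain ⟨⟨hle1, hleh1⟩, hlek, hleL, hle2⟩ := hhm
  have hmp := mu_prob (d := d) hε
  have hkh : k * h ≤ 1 / 2 := by
    rw [le_div_iff₀ (by positivity)] at hlek; linarith
  have hs : 2 * p.Lp * h < 1 := by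
    rw [le_div_iff₀ (by positivity)] at hleL
    nlinarith
  have hpush := hf.push hε hh hs (η := k / 8) (by linarith) (hdet h hh hleh1)
    (isOpen_thickening.measurableSet : MeasurableSet (thickening (cp p * h) A))
  have hpsi := hf.psi_push hε he1 hh hle1 A hA hAm
  have hr : 0 < cp p * h := by positivity
  have hch := cheeger_real hε hr A hA
  have hAB : A ⊆ thickening (cp p * h) A := self_subset_thickening hr A
  have hsplit : (mu ε d).real (thickening (cp p * h) A) = (mu ε d).real A + (mu ε d).real (thickening (cp p * h) A \ A) := by
    rw [measureReal_sdiff hAB hAm]; ring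
  have f1 : C * ε ^ 2 * h ≤ 1 / 16 := by
    have : 0 ≤ 1 / cp p := by positivity
    have h2 : C * ε ≤ 1 / 16 := by nlinarith [mul_nonneg hC hε.le]
    have h3 : C * ε * (ε * h) ≤ (1 / 16) * 1 := mul_le_mul h2 (by nlinarith) (by positivity) (by norm_num)
    nlinarith
  have f2 : C * ε * (h + 1 / cp p) ≤ 1 / 16 := by
    refine le_trans ?_ he3
    gcongr
  have f3 : C * ε ^ 2 * h ≤ k * h / 8 := by
    have := mul_le_mul_of_nonneg_right he2 (show 0 ≤ ε * h by positivity)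
    rw [hk]; nlinarith
  refine step_arith (k * h) (C * ε ^ 2 * h) (C * ε * (h + 1 / cp p)) _ _ _ _ _ (by positivity) hkh f1 f3 f2
    measureReal_nonneg measureReal_nonneg hsplit hpsi ?_ ?_ ?_ 
  · refine le_trans (le_of_eq ?_) hpush
    ring
  · intro h34
    refine le_trans (le_of_eq ?_) (hch h34)
    rw [hk]; ring
  · ring

end GEq

namespace GEq
open scoped NNReal ENNReal
variable {d : ℕ} {ε : ℝ} {p : Par} {c : ℝ → Euc d → ℝ} {v : ℝ → Euc d → Euc d}

lemma Env.fld (he : Env p c v) (t : ℝ) : Fld p (v t) := ⟨he.vK t, he.vL t, he.div0 t⟩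

lemma Env.step_reach (he : Env p c v) {h : ℝ} (hh : 0 < h) 
    (hsm : p.Lp * h * (2 * p.K + 2 * cp p) + p.M h ≤ cp p) (t : ℝ) (A : Set (Euc d)) {y : Euc d}
    (hy : y ∈ Eh p h (v t) '' thickening (cp p * h) A) : ∃ x ∈ A, Reachable c v t x (t + h) y := by
  obtain ⟨b, hb, rfl⟩ := hy
  obtain ⟨x, hx, hxb⟩ := mem_thickening_iff.1 hb
  refine ⟨x, hx, ?_⟩
  set w := v t b - bavg p.L0 (v t) b with hw
  set z := h⁻¹ • (b - x) with hz
  have hzn : ‖z‖ ≤ cp p := by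
    rw [hz, norm_smul, norm_inv, Real.norm_of_nonneg hh.le, ← dist_eq_norm, inv_mul_le_iff₀ hh]
    linarith
  have hwn : ‖w‖ ≤ 2 * p.K := (he.fld t).w_le b
  have hl := reach_line (c := c) (v := v) (show t ≤ t + h by linarith) x (w + z) ?_
  · convert hl using 1
    simp only [Eh, ← hw, hz, add_sub_cancel_left, smul_add]
    rw [smul_inv_smul₀ hh.ne']
    abel
  intro s hs
  set q := x + (s - t) • (w + z) with hq
  have hbq : ‖b - q‖ ≤ h * (2 * p.K + 2 * cp p) := by
    have e : b - q = h • z - (s - t) • (w + z) := by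
      rw [hq, hz, smul_inv_smul₀ hh.ne']; abel
    rw [e]
    refine (norm_sub_le _ _).trans ?_
    rw [norm_smul h z, norm_smul (s - t) (w + z), Real.norm_of_nonneg hh.le, Real.norm_of_nonneg (by linarith [hs.1])]
    have h1 : ‖w + z‖ ≤ 2 * p.K + cp p := (norm_add_le _ _).trans (by linarith)
    have h2 : (s - t) * ‖w + z‖ ≤ h * (2 * p.K + cp p) :=
      mul_le_mul (by linarith [hs.2]) h1 (norm_nonneg _) hh.le
    nlinarith
  have e : w + z - v s q = -bavg p.L0 (v t) b + z + (v t b - v t q) + (v t q - v s q) := by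
    rw [hw]; abel
  have h1 : ‖v t b - v t q‖ ≤ p.Lp * (h * (2 * p.K + 2 * cp p)) :=
    (he.vL t b q).trans (mul_le_mul_of_nonneg_left hbq p.Lp_nonneg)
  have h2 : ‖v t q - v s q‖ ≤ p.M h := by
    refine (he.vM t s q).trans (p.M_mono ?_)
    rw [abs_sub_comm, abs_of_nonneg (by linarith [hs.1])]
    linarith [hs.2]
  have h3 : ‖bavg p.L0 (v t) b‖ ≤ p.a := he.avg t b
  have h4 := he.cb s q
  rw [e]
  refine (norm_add_le _ _).trans ?_
  have h5 := norm_add_le (-bavg p.L0 (v t) b + z) (v t b - v t q)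
  have h6 := norm_add_le (-bavg p.L0 (v t) b) z
  rw [norm_neg] at h6
  have : p.b = p.a + 2 * cp p := by unfold cp; ring
  linarith

def Aseq (p : Par) (v : ℝ → Euc d → Euc d) (t h : ℝ) (x : Euc d) : ℕ → Set (Euc d)
  | 0 => {x}
  | n + 1 => Eh p h (v (t + n * h)) '' thickening (cp p * h) (Aseq p v t h x n)

lemma ball_lower (hε : 0 < ε) {r : ℝ} (hr : 0 < r) (hr1 : r ≤ 1) (x : Euc d) (hx : ‖x‖ ≤ 1) :
    Real.exp (-(ε * (d * 2))) * psi ε (0 : Euc d) * volume.real (ball (0 : Euc d) r) ≤ (mu ε d).real (ball x r) := by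
  rw [mu_toReal hε measurableSet_ball]
  have h1 : ∫ _y in ball x r, Real.exp (-(ε * (d * 2))) * psi ε (0 : Euc d) ≤ ∫ y in ball x r, psi ε y := by
    refine setIntegral_mono_on ?_ (psi_integrable hε).integrableOn measurableSet_ball fun y hy => ?_
    · exact integrableOn_const (measure_ball_lt_top.ne)
    · have h2 := psi_ratio hε y (0 : Euc d)
      have h3 : ‖(0 : Euc d) - y‖ ≤ 2 := by
        rw [zero_sub, norm_neg]
        have : ‖y - x‖ < r := by simpa [dist_eq_norm] using hy
        linarith [norm_le_norm_add_norm_sub' y x]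
      have h4 : psi ε (0 : Euc d) ≤ Real.exp (ε * (d * 2)) * psi ε y := by
        refine h2.trans (mul_le_mul_of_nonneg_right (Real.exp_le_exp.2 ?_) (psi_pos hε y).le)
        gcongr
      rw [Real.exp_neg, inv_mul_le_iff₀ (Real.exp_pos _)]
      exact h4
  refine le_trans (le_of_eq ?_) h1
  rw [setIntegral_const, smul_eq_mul, mul_comm]
  congr 1
  simp [Measure.real, Measure.addHaar_ball_center]

lemma growth (d : ℕ) (p : Par) : ∃ (ε h0 : ℝ) (N : ℕ), 0 < ε ∧ 0 < h0 ∧ 1 ≤ N ∧ 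
    ∀ (c : ℝ → Euc d → ℝ) (v : ℝ → Euc d → Euc d), Env p c v → ∀ (t : ℝ) (x : Euc d), ‖x‖ ≤ 1 → 
    ∀ h : ℝ, h0 / 2 ≤ h → h ≤ h0 → ∃ A : Set (Euc d), MeasurableSet A ∧ 3 / 5 ≤ (mu ε d).real A ∧
      ∀ y ∈ A, Reachable c v t x (t + N * h) y := by
  obtain ⟨ε, κ, h1, hε, hκ, hh1, hL, hstep⟩ := step_exists d p
  have hcp := cp_pos (p := p)
  have hK := p.K_pos
  have hLp := p.Lp_nonneg
  obtain ⟨δ, hδ, hM⟩ := p.M_small (cp p / 2) (by positivity)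
  set Q := p.Lp * (2 * p.K + 2 * cp p) + 1 with hQ
  have hQ0 : 0 < Q := by positivity
  set h0 := min h1 (min δ (cp p / 2 / Q)) with hh0
  have h0pos : 0 < h0 := by positivity
  set r0 := min 1 (cp p * (h0 / 2)) with hr0
  have hr0pos : 0 < r0 := by positivity
  set m0 := 4 / 5 * (Real.exp (-(ε * (d * 2))) * psi ε (0 : Euc d) * volume.real (ball (0 : Euc d) r0)) with hm0
  have hvol : 0 < volume.real (ball (0 : Euc d) r0) := 
    ENNReal.toReal_pos (measure_ball_pos _ _ hr0pos).ne' measure_ball_lt_top.ne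
  have hm0pos : 0 < m0 := by have := psi_pos hε (0 : Euc d); positivity
  obtain ⟨n, hn⟩ := pow_unbounded_of_one_lt (1 / m0) (show 1 < 1 + κ * (h0 / 2) by nlinarith)
  have hn' : 1 ≤ (1 + κ * (h0 / 2)) ^ n * m0 := by
    rw [div_lt_iff₀ hm0pos] at hn; exact hn.le
  refine ⟨ε, h0, n + 1, hε, h0pos, by omega, ?_⟩
  intro c v he t x hx h hlo hhi
  have hmp := mu_prob (d := d) hε
  have hh : 0 < h := by linarith
  have hle1 : h ≤ h1 := hhi.trans (min_le_left _ _)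
  have hsm : p.Lp * h * (2 * p.K + 2 * cp p) + p.M h ≤ cp p := by
    have i1 : p.M h ≤ cp p / 2 := hM h (hhi.trans ((min_le_right _ _).trans (min_le_left _ _)))
    have i2 : h ≤ cp p / 2 / Q := hhi.trans ((min_le_right _ _).trans (min_le_right _ _))
    rw [le_div_iff₀ hQ0, hQ] at i2
    nlinarith
  have hsL : 2 * p.Lp * h < 1 := by nlinarith
  have hprop : ∀ n : ℕ, (Aseq p v t h x n).Nonempty ∧ MeasurableSet (Aseq p v t h x n) ∧ 
      ∀ y ∈ Aseq p v t h x n, Reachable c v t x (t + n * h) y := by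
    intro n
    induction n with
    | zero => 
      refine ⟨⟨x, rfl⟩, measurableSet_singleton x, ?_⟩
      intro y hy
      obtain rfl : y = x := hy
      simpa using reach_refl t y
    | succ n ih =>
      obtain ⟨i1, i2, i3⟩ := ih
      refine ⟨(i1.mono (self_subset_thickening (by positivity) _)).image _, 
        (he.fld _).Eh_meas hh hsL isOpen_thickening.measurableSet, ?_⟩
      intro y hy
      obtain ⟨z, hz, hzr⟩ := he.step_reach hh hsm (t + n * h) _ hy
      have := reach_trans (i3 z hz) hzr
      convert this using 1
      push_cast; ring
  have hst := fun n : ℕ => hstep h hh hle1 (v (t + n * h)) (he.fld _) _ (hprop n).1 (hprop n).2.1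
  have hmeas : ∀ n : ℕ, min (3 / 5) ((1 + κ * (h0 / 2)) ^ n * m0) ≤ (mu ε d).real (Aseq p v t h x (n + 1)) := by
    intro n
    induction n with
    | zero =>
      refine (min_le_right _ _).trans ?_
      have i1 := (hst 0).1
      have i2 : ball x r0 ⊆ thickening (cp p * h) (Aseq p v t h x 0) := by
        rw [Aseq, thickening_singleton]
        refine ball_subset_ball ((min_le_right _ _).trans ?_)
        gcongr
      have i3 := measureReal_mono (μ := mu ε d) i2
      have i4 := ball_lower hε hr0pos (min_le_left _ _) x hx
      rw [pow_zero, one_mul]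
      refine le_trans ?_ i1
      rw [hm0]
      linarith
    | succ n ih =>
      rcases le_or_gt ((mu ε d).real (thickening (cp p * h) (Aseq p v t h x (n + 1)))) (3 / 4) with h34 | h34
      · have i1 := (hst (n + 1)).2 h34
        refine le_trans ?_ i1
        have i2 : 1 + κ * (h0 / 2) ≤ 1 + κ * h := by gcongr
        have i3 : (1 + κ * (h0 / 2)) * min (3 / 5) ((1 + κ * (h0 / 2)) ^ n * m0) ≤ 
            (1 + κ * h) * (mu ε d).real (Aseq p v t h x (n + 1)) := by
          gcongr
        refine le_trans ?_ i3
        rw [mul_min_of_nonneg _ _ (by positivity)]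
        refine min_le_min ?_ (le_of_eq (by ring))
        nlinarith
      · have i1 := (hst (n + 1)).1
        refine (min_le_left _ _).trans (le_trans ?_ i1)
        linarith
  refine ⟨_, (hprop (n + 1)).2.1, ?_, (hprop (n + 1)).2.2⟩
  refine le_trans (le_min le_rfl ?_) (hmeas n)
  linarith

lemma local_ctrl (d : ℕ) (p : Par) : ∃ T1 : ℝ, 0 < T1 ∧ 
    ∀ (c : ℝ → Euc d → ℝ) (v : ℝ → Euc d → Euc d), Env p c v → ∀ (t0 t1 : ℝ) (x0 x1 : Euc d), ‖x1 - x0‖ ≤ 1 → 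
      T1 ≤ t1 - t0 → t1 - t0 ≤ 2 * T1 → Reachable c v t0 x0 t1 x1 := by
  obtain ⟨ε, h0, N, hε, hh0, hN, H⟩ := growth d p
  have hNR : (1:ℝ) ≤ N := by exact_mod_cast hN
  have hmp := mu_prob (d := d) hε
  refine ⟨N * h0, by positivity, ?_⟩
  -- first for x0 = 0
  have main : ∀ (c : ℝ → Euc d → ℝ) (v : ℝ → Euc d → Euc d), Env p c v → ∀ (t0 t1 : ℝ) (x1 : Euc d), ‖x1‖ ≤ 1 → 
      N * h0 ≤ t1 - t0 → t1 - t0 ≤ 2 * (N * h0) → Reachable c v t0 0 t1 x1 := by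
    intro c v he t0 t1 x1 hx h1 h2
    set h := (t1 - t0) / (2 * N) with hh
    have e : 2 * N * h = t1 - t0 := by rw [hh]; field_simp
    have hlo : h0 / 2 ≤ h := by
      rw [hh, le_div_iff₀ (by positivity)]; linarith
    have hhi : h ≤ h0 := by
      rw [hh, div_le_iff₀ (by positivity)]; linarith
    obtain ⟨A, hA, hmA, hrA⟩ := H c v he t0 0 (by simp) h hlo hhi
    obtain ⟨B, hB, hmB, hrB⟩ := H _ _ he.rev (-t1) x1 hx h hlo hhi
    have hne : (A ∩ B).Nonempty := by
      by_contra hcon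
      rw [Set.not_nonempty_iff_eq_empty] at hcon
      have h3 := measureReal_union (μ := mu ε d) (Set.disjoint_iff_inter_eq_empty.2 hcon) hB
      have h4 : (mu ε d).real (A ∪ B) ≤ 1 := measureReal_le_one
      linarith
    obtain ⟨y, hyA, hyB⟩ := hne
    refine reach_trans (hrA y hyA) (reach_rev ?_)
    have := hrB y hyB
    convert this using 1
    linarith
  intro c v he t0 t1 x0 x1 hx h1 h2
  have h3 := main _ _ (he.shift 0 x0) t0 t1 (x1 - x0) hx h1 h2
  have := reach_shift 0 x0 h3
  simpa using this

/-- global controllability -/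
lemma ctrl (d : ℕ) (p : Par) : ∃ T1 : ℝ, 0 < T1 ∧ 
    ∀ (c : ℝ → Euc d → ℝ) (v : ℝ → Euc d → Euc d), Env p c v → ∀ (t0 t1 : ℝ) (x0 x1 : Euc d), 
      T1 * (1 + ‖x1 - x0‖) ≤ t1 - t0 → Reachable c v t0 x0 t1 x1 := by
  obtain ⟨T1, hT1, H⟩ := local_ctrl d p
  refine ⟨T1, hT1, ?_⟩
  intro c v he t0 t1 x0 x1 hx
  set y := (t1 - t0) / T1 with hy
  have hy1 : 1 + ‖x1 - x0‖ ≤ y := by rw [hy, le_div_iff₀ hT1]; linarith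
  set n := ⌊y⌋₊ with hn
  have hn1 : ‖x1 - x0‖ ≤ n := by linarith [Nat.lt_floor_add_one y]
  have hny : (n:ℝ) ≤ y := Nat.floor_le (by linarith [norm_nonneg (x1 - x0)])
  have hn0 : 1 ≤ n := Nat.le_floor (by push_cast; linarith [norm_nonneg (x1 - x0)])
  have hn0R : (1:ℝ) ≤ n := by exact_mod_cast hn0
  have hyn : y ≤ 2 * n := by linarith [Nat.lt_floor_add_one y]
  set T := (t1 - t0) / n with hT
  have hTn : n * T = t1 - t0 := by rw [hT]; field_simp
  have hyT : y * T1 = t1 - t0 := by rw [hy]; field_simp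
  have hTlo : T1 ≤ T := by rw [hT, le_div_iff₀ (by positivity)]; nlinarith
  have hThi : T ≤ 2 * T1 := by rw [hT, div_le_iff₀ (by positivity)]; nlinarith
  have key : ∀ k : ℕ, Reachable c v t0 x0 (t0 + k * T) (x0 + ((k:ℝ) / n) • (x1 - x0)) := by
    intro k
    induction k with
    | zero => simpa using reach_refl t0 x0
    | succ k ih =>
      refine reach_trans ih (H c v he _ _ _ _ ?_ ?_ ?_)
      · have e : x0 + (((k + 1 : ℕ):ℝ) / n) • (x1 - x0) - (x0 + ((k:ℝ) / n) • (x1 - x0)) = (1 / (n:ℝ)) • (x1 - x0) := by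
          rw [add_sub_add_left_eq_sub, ← sub_smul]
          congr 1
          push_cast; ring
        rw [e, norm_smul, Real.norm_of_nonneg (by positivity), one_div, inv_mul_le_iff₀ (by positivity)]
        linarith
      · push_cast; linarith
      · push_cast; linarith
  have := key n
  rw [hTn, div_self (by positivity), one_smul] at this
  simpa using this

end GEq

namespace GEq
open scoped NNReal ENNReal
variable {d : ℕ} {p : Par} {c : ℝ → Euc d → ℝ} {v : ℝ → Euc d → Euc d}

lemma reach_slope (he : Env p c v) {t0 h : ℝ} {x0 x1 : Euc d} (hh : 0 ≤ h)
    (hr : Reachable c v t0 x0 (t0 + h) x1) :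
    ‖x1 - x0 - h • v t0 x0‖ ≤ h * (c t0 x0 + 2 * (p.M h + p.Lp * (2 * p.K * h))) := by
  obtain ⟨γ', hγ0', hγ1', hpath⟩ := reach_path hr
  obtain ⟨h01, γ, g, hg, hγ, h1, hae⟩ := id hr
  have hγ0 : γ t0 = x0 := by simpa using hγ t0 ⟨le_rfl, h01⟩
  have hsp : ∀ s ∈ Set.Icc t0 (t0 + h), ‖γ s - x0‖ ≤ 2 * p.K * h := by
    intro s hs
    have : Reachable c v t0 x0 s (γ s) := by
      refine ⟨hs.1, γ, g, ?_, fun t ht => hγ t ⟨ht.1, ht.2.trans hs.2⟩, rfl, ?_⟩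
      · refine hg.mono_set ?_
        rw [Set.uIcc_of_le hs.1, Set.uIcc_of_le h01]
        exact Set.Icc_subset_Icc le_rfl hs.2
      · exact ae_restrict_of_ae_restrict_of_subset (Set.Icc_subset_Icc le_rfl hs.2) hae
    refine (reach_speed he this).trans ?_
    have := p.K_pos
    nlinarith [hs.2]
  have e := hγ (t0 + h) ⟨h01, le_rfl⟩
  rw [h1] at e
  have e2 : x1 - x0 - h • v t0 x0 = ∫ s in t0..(t0 + h), (g s - v t0 x0) := by
    rw [intervalIntegral.integral_sub hg (by simp), e]
    simp
  rw [e2]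
  have := intervalIntegral.norm_integral_le_of_norm_le_const_ae (a := t0) (b := t0 + h)
    (f := fun s => g s - v t0 x0) (C := c t0 x0 + 2 * (p.M h + p.Lp * (2 * p.K * h))) ?_
  · rw [add_sub_cancel_left, abs_of_nonneg hh] at this
    linarith
  · rw [ae_restrict_iff' measurableSet_Icc] at hae
    filter_upwards [hae] with s hs hm
    rw [Set.uIoc_of_le h01] at hm
    have hm' : s ∈ Set.Icc t0 (t0 + h) := ⟨hm.1.le, hm.2⟩
    have h2 := hs hm'
    have h3 := hsp s hm'
    have habs : |s - t0| ≤ h := by rw [abs_of_nonneg (by linarith [hm'.1])]; linarith [hm'.2]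
    have h4 := (he.vM s t0 (γ s)).trans (p.M_mono habs)
    have h5 := (he.cM s t0 (γ s)).trans (p.M_mono habs)
    have h6 := (he.vL t0 (γ s) x0).trans (mul_le_mul_of_nonneg_left h3 p.Lp_nonneg)
    have h7 := (he.cL t0 (γ s) x0).trans (mul_le_mul_of_nonneg_left h3 p.Lp_nonneg)
    have e3 : g s - v t0 x0 = (g s - v s (γ s)) + (v s (γ s) - v t0 (γ s)) + (v t0 (γ s) - v t0 x0) := by abel
    have h8 := norm_add₃_le (a := g s - v s (γ s)) (b := v s (γ s) - v t0 (γ s)) (c := v t0 (γ s) - v t0 x0)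
    rw [← e3] at h8
    have h9 := (abs_le.1 h5).2
    have h10 := (abs_le.1 h7).2
    linarith

/-- discretised reachability -/
def Q (c : ℝ → Euc d → ℝ) (v : ℝ → Euc d → Euc d) (h η : ℝ) : ℕ → ℝ → Euc d → Euc d → Prop
  | 0, _, y, x => ‖y - x‖ ≤ 1
  | n + 1, s, y, x => ∃ k : ℕ, ‖TopologicalSpace.denseSeq (Euc d) k - y - h • v s y‖ ≤ h * (c s y - η) ∧
      Q c v h η n (s + h) (TopologicalSpace.denseSeq (Euc d) k) x

lemma Q_reach (he : Env p c v) {h η : ℝ} (hh : 0 < h) (hη : 2 * (p.M h + p.Lp * (2 * p.K * h)) ≤ η) :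
    ∀ n s y x, Q c v h η n s y x → ∃ z, ‖z - x‖ ≤ 1 ∧ Reachable c v s y (s + n * h) z := by
  intro n
  induction n with
  | zero => intro s y x hq; exact ⟨y, hq, by simpa using reach_refl s y⟩
  | succ n ih =>
    rintro s y x ⟨k, hk, hq⟩
    obtain ⟨z, hz, hr⟩ := ih _ _ _ hq
    refine ⟨z, hz, ?_⟩
    have e : s + ((n + 1 : ℕ):ℝ) * h = s + h + n * h := by push_cast; ring
    rw [e]
    refine reach_trans ?_ hr
    set D := TopologicalSpace.denseSeq (Euc d) k
    set u := h⁻¹ • (D - y) with hu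
    have hhu : h • u = D - y := by rw [hu, smul_inv_smul₀ hh.ne']
    have hun : ‖u - v s y‖ ≤ c s y - η := by
      have : h • (u - v s y) = D - y - h • v s y := by rw [smul_sub, hhu]
      rw [← this, norm_smul h (u - v s y), Real.norm_of_nonneg hh.le] at hk
      exact le_of_mul_le_mul_left hk hh
    have hη0 : 0 ≤ η := le_trans (by have := p.M_nonneg h; have := p.Lp_nonneg; have := p.K_pos; positivity) hη
    have hu2 : ‖u‖ ≤ 2 * p.K := by
      have := norm_le_norm_add_norm_sub' u (v s y)
      linarith [he.vK s y, he.cK s y]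
    have hl := reach_line (c := c) (v := v) (show s ≤ s + h by linarith) y u ?_
    · convert hl using 1
      rw [add_sub_cancel_left, hhu]; abel
    intro r hr
    set q := y + (r - s) • u with hq
    have hqy : ‖q - y‖ ≤ 2 * p.K * h := by
      rw [hq, add_sub_cancel_left, norm_smul (r - s) u, Real.norm_of_nonneg (by linarith [hr.1])]
      have := mul_le_mul (show r - s ≤ h by linarith [hr.2]) hu2 (norm_nonneg _) hh.le
      linarith
    have habs : |r - s| ≤ h := by rw [abs_of_nonneg (by linarith [hr.1])]; linarith [hr.2]
    have h4 := (he.vM r s q).trans (p.M_mono habs)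
    have h5 := (he.cM r s q).trans (p.M_mono habs)
    have h6 := (he.vL s q y).trans (mul_le_mul_of_nonneg_left hqy p.Lp_nonneg)
    have h7 := (he.cL s q y).trans (mul_le_mul_of_nonneg_left hqy p.Lp_nonneg)
    have e3 : u - v r q = (u - v s y) - (v s q - v s y) - (v r q - v s q) := by abel
    have h8 : ‖u - v r q‖ ≤ ‖u - v s y‖ + ‖v s q - v s y‖ + ‖v r q - v s q‖ := by
      rw [e3]; exact (norm_sub_le _ _).trans (add_le_add_left (norm_sub_le _ _) _)
    have h9 := (abs_le.1 h5).1
    have h10 := (abs_le.1 h7).1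
    linarith

lemma proj_ball {w : Euc d} {r o : ℝ} (hr : 0 ≤ r) (ho : 0 ≤ o) (hw : ‖w‖ ≤ r + o) :
    ∃ w' : Euc d, ‖w'‖ ≤ r ∧ ‖w' - w‖ ≤ o := by
  rcases le_or_gt ‖w‖ r with h | h
  · exact ⟨w, h, by simpa using ho⟩
  · have hw0 : 0 < ‖w‖ := lt_of_le_of_lt hr h
    refine ⟨(r / ‖w‖) • w, ?_, ?_⟩
    · rw [norm_smul, Real.norm_of_nonneg (by positivity), div_mul_cancel₀ _ hw0.ne']
    · have : (r / ‖w‖) • w - w = ((r - ‖w‖) / ‖w‖) • w := by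
        rw [sub_div, div_self hw0.ne', sub_smul, one_smul]
      rw [this, norm_smul, Real.norm_eq_abs, abs_div, abs_of_pos hw0, div_mul_cancel₀ _ hw0.ne',
        abs_of_neg (by linarith)]
      linarith

lemma reach_Q (he : Env p c v) {h η : ℝ} (hh : 0 < h) (hη0 : 0 < η)
    (hη : 2 * (p.M h + p.Lp * (2 * p.K * h)) ≤ η) (hηb : 2 * η ≤ p.b) :
    ∀ (n : ℕ) s y y' x, Reachable c v s y (s + n * h) x →
      Real.exp (2 * p.Lp * h * n) * (‖y' - y‖ + n * h * (4 * η)) ≤ 1 → Q c v h η n s y' x := by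
  intro n
  induction n with
  | zero =>
    intro s y y' x hr hE
    have h1 := reach_speed he hr
    simp only [Nat.cast_zero, mul_zero, Real.exp_zero, zero_mul, add_zero, one_mul] at hE
    have : x = y := by
      simpa [sub_eq_zero] using h1
    subst this
    exact hE
  | succ n ih =>
    intro s y y' x hr hE
    obtain ⟨γ, hγ0, hγ1, hpath⟩ := reach_path hr
    have e : s + ((n + 1 : ℕ):ℝ) * h = s + h + n * h := by push_cast; ring
    have hnh : 0 ≤ n * h := by positivity
    have hr1 := hpath s (s + h) le_rfl (by linarith) (by rw [e]; linarith)
    have hr2 := hpath (s + h) (s + h + n * h) (by linarith) (by linarith) (by rw [e])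
    rw [← e, hγ1] at hr2
    rw [hγ0] at hr1
    rw [e] at hr2
    set x1 := γ (s + h)
    have hsl := reach_slope he hh.le hr1
    set w := h⁻¹ • (x1 - y - h • v s y) with hw
    have hhw : h • w = x1 - y - h • v s y := by rw [hw, smul_inv_smul₀ hh.ne']
    have hLp := p.Lp_nonneg
    have hcl := (abs_le.1 (he.cL s y y')).2
    rw [norm_sub_rev y y'] at hcl
    have hvl := he.vL s y' y
    set e0 := ‖y' - y‖ with he0
    have he00 : 0 ≤ e0 := norm_nonneg _
    have hwn : ‖w‖ ≤ (c s y' - 2 * η) + (p.Lp * e0 + 3 * η) := by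
      rw [← hhw, norm_smul h w, Real.norm_of_nonneg hh.le] at hsl
      have := le_of_mul_le_mul_left hsl hh
      linarith
    obtain ⟨w', hw'1, hw'2⟩ := proj_ball (r := c s y' - 2 * η) (o := p.Lp * e0 + 3 * η)
      (by linarith [he.cb s y']) (by positivity) hwn
    have hdr := TopologicalSpace.denseRange_denseSeq (Euc d)
    obtain ⟨k, hk⟩ := hdr.exists_dist_lt (y' + h • (v s y' + w')) (show 0 < h * η by positivity)
    rw [dist_comm, dist_eq_norm] at hk
    refine ⟨k, ?_, ih (s + h) x1 _ x hr2 ?_⟩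
    · set D := TopologicalSpace.denseSeq (Euc d) k
      have e1 : D - y' - h • v s y' = (D - (y' + h • (v s y' + w'))) + h • w' := by
        rw [smul_add]; abel
      rw [e1]
      refine (norm_add_le _ _).trans ?_
      rw [norm_smul h w', Real.norm_of_nonneg hh.le]
      have := mul_le_mul_of_nonneg_left hw'1 hh.le
      linarith
    · set D := TopologicalSpace.denseSeq (Euc d) k
      have e1 : D - x1 = (D - (y' + h • (v s y' + w'))) + ((y' - y) + (h • (v s y' - v s y) + h • (w' - w))) := by
        rw [smul_sub h w' w, hhw, smul_add, smul_sub]; abel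
      have hD : ‖D - x1‖ ≤ e0 * (1 + 2 * p.Lp * h) + h * (4 * η) := by
        rw [e1]
        refine (norm_add_le _ _).trans ?_
        have a1 := norm_add_le (y' - y) (h • (v s y' - v s y) + h • (w' - w))
        have a2 := norm_add_le (h • (v s y' - v s y)) (h • (w' - w))
        rw [norm_smul h (v s y' - v s y), norm_smul h (w' - w), Real.norm_of_nonneg hh.le] at a2
        have a3 := mul_le_mul_of_nonneg_left hw'2 hh.le
        have a4 := mul_le_mul_of_nonneg_left hvl hh.le
        nlinarith
      refine le_trans ?_ hE
      have e2 : 2 * p.Lp * h * ((n + 1 : ℕ):ℝ) = 2 * p.Lp * h * n + 2 * p.Lp * h := by push_cast; ring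
      rw [e2, Real.exp_add, mul_assoc (Real.exp _)]
      refine mul_le_mul_of_nonneg_left ?_ (Real.exp_pos _).le
      have hx := Real.add_one_le_exp (2 * p.Lp * h)
      have hx0 : 0 ≤ 2 * p.Lp * h := by positivity
      have b1 : e0 * (1 + 2 * p.Lp * h) ≤ Real.exp (2 * p.Lp * h) * e0 := by nlinarith
      have hne : 0 ≤ ((n + 1 : ℕ):ℝ) * h * (4 * η) := by positivity
      have b2 : ((n + 1 : ℕ):ℝ) * h * (4 * η) ≤ Real.exp (2 * p.Lp * h) * (((n + 1 : ℕ):ℝ) * h * (4 * η)) := by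
        nlinarith
      push_cast at b2 ⊢
      nlinarith

/-- existence of good discretisation parameters for a window of length `t` -/
lemma exists_disc (p : Par) (t : ℝ) (ht : 0 < t) : ∃ (η h : ℝ) (n : ℕ), 0 < η ∧ 0 < h ∧ n * h = t ∧
    2 * (p.M h + p.Lp * (2 * p.K * h)) ≤ η ∧ 2 * η ≤ p.b ∧
    Real.exp (2 * p.Lp * h * n) * (n * h * (4 * η)) ≤ 1 := by
  have hb : 0 < p.b := lt_of_le_of_lt p.a_nonneg p.a_lt_b
  have hLp := p.Lp_nonneg
  have hK := p.K_pos
  set η := min (p.b / 2) (1 / (Real.exp (2 * p.Lp * t) * (4 * t))) with hη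
  have hη0 : 0 < η := by
    refine lt_min (by positivity) ?_
    have := Real.exp_pos (2 * p.Lp * t)
    positivity
  obtain ⟨δ, hδ, hM⟩ := p.M_small (η / 4) (by positivity)
  set h0 := min δ (η / 4 / (p.Lp * (2 * p.K) + 1)) with hh0
  have hh0p : 0 < h0 := lt_min hδ (by positivity)
  set n := ⌈t / h0⌉₊ with hn
  have hn0 : 0 < n := Nat.ceil_pos.2 (by positivity)
  have hnR : (0:ℝ) < n := by exact_mod_cast hn0
  have hle : t / n ≤ h0 := by
    rw [div_le_iff₀ hnR]
    have := Nat.le_ceil (t / h0)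
    rw [div_le_iff₀ hh0p] at this
    linarith
  have hnt : n * (t / n) = t := by field_simp
  refine ⟨η, t / n, n, hη0, by positivity, hnt, ?_, ?_, ?_⟩
  · have h1 := hM (t / n) (hle.trans (min_le_left _ _))
    have h2 : t / n ≤ η / 4 / (p.Lp * (2 * p.K) + 1) := hle.trans (min_le_right _ _)
    rw [le_div_iff₀ (by positivity)] at h2
    have h3 : 0 < t / n := by positivity
    nlinarith
  · have := min_le_left (p.b / 2) (1 / (Real.exp (2 * p.Lp * t) * (4 * t)))
    linarith
  · have h1 : 2 * p.Lp * (t / n) * n = 2 * p.Lp * t := by field_simp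
    rw [h1, hnt]
    have h2 : η ≤ 1 / (Real.exp (2 * p.Lp * t) * (4 * t)) := min_le_right _ _
    have := Real.exp_pos (2 * p.Lp * t)
    rw [le_div_iff₀ (by positivity)] at h2
    linarith

/-- measurable proxy for reachability in time exactly `t` -/
def AEv (p : Par) (c : ℝ → Euc d → ℝ) (v : ℝ → Euc d → Euc d) (t s : ℝ) (y x : Euc d) : Prop :=
  ∃ ht : 0 < t, Q c v (exists_disc p t ht).choose_spec.choose (exists_disc p t ht).choose
    (exists_disc p t ht).choose_spec.choose_spec.choose s y x

lemma AEv_of_reach (he : Env p c v) {t s : ℝ} {y x : Euc d} (ht : 0 < t)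
    (hr : Reachable c v s y (s + t) x) : AEv p c v t s y x := by
  obtain ⟨h1, h2, h3, h4, h5, h6⟩ := (exists_disc p t ht).choose_spec.choose_spec.choose_spec
  refine ⟨ht, reach_Q he h2 h1 h4 h5 _ _ y y x ?_ ?_⟩
  · rw [h3]; exact hr
  · simpa using h6

lemma reach_of_AEv (he : Env p c v) {t s : ℝ} {y x : Euc d}
    (hA : AEv p c v t s y x) : ∃ z, ‖z - x‖ ≤ 1 ∧ Reachable c v s y (s + t) z := by
  obtain ⟨ht, hq⟩ := hA
  obtain ⟨h1, h2, h3, h4, h5, h6⟩ := (exists_disc p t ht).choose_spec.choose_spec.choose_spec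
  obtain ⟨z, hz, hr⟩ := Q_reach he h2 h4 _ _ _ _ hq
  rw [h3] at hr
  exact ⟨z, hz, hr⟩

section meas
variable {Ω : Type*} {c : ℝ → Euc d → Ω → ℝ} {v : ℝ → Euc d → Ω → Euc d}

lemma Q_meas (m : MeasurableSpace Ω) {h η : ℝ} (hh : 0 < h) : ∀ (n : ℕ) s y x,
    (∀ r ∈ Set.Icc s (s + n * h), ∀ z, Measurable[m] (c r z) ∧ Measurable[m] (v r z)) →
    MeasurableSet[m] {ω | Q (fun a b => c a b ω) (fun a b => v a b ω) h η n s y x} := by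
  intro n
  induction n with
  | zero => intro s y x _; simp only [Q]; exact MeasurableSet.const _
  | succ n ih =>
    intro s y x hm
    have e : {ω | Q (fun a b => c a b ω) (fun a b => v a b ω) h η (n + 1) s y x} =
        ⋃ k : ℕ, ({ω | ‖TopologicalSpace.denseSeq (Euc d) k - y - h • v s y ω‖ ≤ h * (c s y ω - η)} ∩
          {ω | Q (fun a b => c a b ω) (fun a b => v a b ω) h η n (s + h) (TopologicalSpace.denseSeq (Euc d) k) x}) := by
      ext ω; simp [Q]
    rw [e]
    have hnh : 0 ≤ n * h := by positivity
    refine MeasurableSet.iUnion fun k => MeasurableSet.inter ?_ (ih _ _ _ fun r hr z => hm r ⟨by linarith [hr.1], ?_⟩ z)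
    · obtain ⟨h1, h2⟩ := hm s ⟨le_rfl, by push_cast; nlinarith⟩ y
      refine measurableSet_le ?_ ?_
      · exact ((h2.const_smul h).const_sub _).norm
      · exact (h1.sub_const _).const_mul _
    · have := hr.2; push_cast; linarith

lemma AEv_meas (m : MeasurableSpace Ω) {t s : ℝ} {y x : Euc d}
    (hm : ∀ r ∈ Set.Icc s (s + t), ∀ z, Measurable[m] (c r z) ∧ Measurable[m] (v r z)) :
    MeasurableSet[m] {ω | AEv p (fun a b => c a b ω) (fun a b => v a b ω) t s y x} := by
  by_cases ht : 0 < t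
  · obtain ⟨h1, h2, h3, h4, h5, h6⟩ := (exists_disc p t ht).choose_spec.choose_spec.choose_spec
    have e : {ω | AEv p (fun a b => c a b ω) (fun a b => v a b ω) t s y x} = 
      {ω | Q (fun a b => c a b ω) (fun a b => v a b ω) (exists_disc p t ht).choose_spec.choose (exists_disc p t ht).choose
        (exists_disc p t ht).choose_spec.choose_spec.choose s y x} := by
      ext ω; simp only [AEv, Set.mem_setOf_eq]
      exact ⟨fun h => h.2, fun h => ⟨ht, h⟩⟩
    rw [e]
    refine Q_meas m h2 _ _ _ _ ?_
    rw [h3]; exact hm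
  · have e : {ω | AEv p (fun a b => c a b ω) (fun a b => v a b ω) t s y x} = ∅ := by
      ext ω; simp only [AEv, Set.mem_setOf_eq, Set.mem_empty_iff_false, iff_false]
      exact fun h => ht h.1
    rw [e]; exact MeasurableSet.empty

variable [mΩ : MeasurableSpace Ω]

lemma meas_sigmaPlus {t r : ℝ} (h : t ≤ r) (z : Euc d) :
    Measurable[sigmaPlus c v t] (c r z) ∧ Measurable[sigmaPlus c v t] (v r z) := by
  have : Measurable[sigmaPlus c v t] (fun ω => (c r z ω, v r z ω)) := by
    refine Measurable.of_comap_le ?_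
    unfold sigmaPlus
    exact le_iSup₂_of_le r h (le_iSup (fun x => MeasurableSpace.comap (fun ω => (c r x ω, v r x ω)) inferInstance) z)
  exact ⟨measurable_fst.comp this, measurable_snd.comp this⟩

lemma meas_sigmaMinus {t r : ℝ} (h : r ≤ t) (z : Euc d) :
    Measurable[sigmaMinus c v t] (c r z) ∧ Measurable[sigmaMinus c v t] (v r z) := by
  have : Measurable[sigmaMinus c v t] (fun ω => (c r z ω, v r z ω)) := by
    refine Measurable.of_comap_le ?_
    unfold sigmaMinus
    exact le_iSup₂_of_le r h (le_iSup (fun x => MeasurableSpace.comap (fun ω => (c r x ω, v r x ω)) inferInstance) z)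
  exact ⟨measurable_fst.comp this, measurable_snd.comp this⟩

lemma sigmaMinus_mono {t t' : ℝ} (h : t ≤ t') : sigmaMinus c v t ≤ sigmaMinus c v t' := by
  unfold sigmaMinus
  refine iSup₂_le fun r hr => ?_
  exact le_iSup₂_of_le r (hr.trans h) le_rfl

lemma AEv_plus {t s : ℝ} {y x : Euc d} : MeasurableSet[sigmaPlus c v s]
    {ω | AEv p (fun a b => c a b ω) (fun a b => v a b ω) t s y x} :=
  AEv_meas _ fun _ hr z => meas_sigmaPlus hr.1 z

lemma AEv_minus {t s u : ℝ} {y x : Euc d} (hu : s + t ≤ u) : MeasurableSet[sigmaMinus c v u]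
    {ω | AEv p (fun a b => c a b ω) (fun a b => v a b ω) t s y x} :=
  AEv_meas _ fun _ hr z => meas_sigmaMinus (hr.2.trans hu) z

end meas
end GEq

namespace GEq
open scoped NNReal ENNReal
variable {d : ℕ} {p : Par}

section pattern
variable {Ω : Type*} [MeasurableSpace Ω] {P : Measure Ω} [IsProbabilityMeasure P]
  {c : ℝ → Euc d → Ω → ℝ} {v : ℝ → Euc d → Ω → Euc d} {J : Type} 

def lsum {E : Type*} [AddCommMonoid E] (f : J → E) : List J → E
  | [] => 0
  | j :: l => f j + lsum f l

def AL (B : J → ℝ → Euc d → Set Ω) (D : J → ℝ) (e : J → Euc d) (s0 : ℝ) (y0 : Euc d) : List J → Set Ω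
  | [] => Set.univ
  | j :: l => B j (s0 + lsum D l) (y0 + lsum e l) ∩ AL B D e s0 y0 l

def Ls (J : Type) [Fintype J] [DecidableEq J] : ℕ → Finset (List J)
  | 0 => {[]}
  | n + 1 => ((Finset.univ : Finset J) ×ˢ Ls J n).image (fun q => q.1 :: q.2)

lemma mem_Ls [Fintype J] [DecidableEq J] : ∀ (n : ℕ) (l : List J), l.length = n → l ∈ Ls J n := by
  intro n
  induction n with
  | zero => intro l hl; simp [Ls, List.length_eq_zero_iff.1 hl]
  | succ n ih =>
    intro l hl
    match l, hl with
    | j :: l, hl =>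
      simp only [Ls, Finset.mem_image, Finset.mem_product, Finset.mem_univ, true_and]
      exact ⟨(j, l), ih l (by simpa using hl), rfl⟩

lemma sum_Ls [Fintype J] [DecidableEq J] (n : ℕ) (F : List J → ℝ) :
    ∑ l ∈ Ls J (n + 1), F l = ∑ l ∈ Ls J n, ∑ j, F (j :: l) := by
  rw [Ls, Finset.sum_image, Finset.sum_product_right]
  rintro ⟨a, b⟩ _ ⟨a', b'⟩ _ h
  simpa using h

def MixG (P : Measure Ω) (c : ℝ → Euc d → Ω → ℝ) (v : ℝ → Euc d → Ω → Euc d) (g ε : ℝ) : Prop :=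
  ∀ t E F, MeasurableSet[sigmaMinus c v t] E → MeasurableSet[sigmaPlus c v (t + g)] F →
    P.real (F ∩ E) ≤ P.real E * (P.real F + ε)

lemma pattern [Fintype J] {g φ : ℝ} (hφ : 0 ≤ φ) (hmix : MixG P c v g φ)
    (B : J → ℝ → Euc d → Set Ω) (D : J → ℝ) (e : J → Euc d) (f π : J → ℝ)
    (hD : ∀ j, 0 ≤ D j)
    (hBp : ∀ j s y, MeasurableSet[sigmaPlus c v s] (B j s y))
    (hBm : ∀ j s y, MeasurableSet[sigmaMinus c v (s + D j - g)] (B j s y))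
    (hπ : ∀ j s y, P.real (B j s y) ≤ π j) (s0 : ℝ) (y0 : Euc d) (n : ℕ) :
    P.real {ω | ∃ l : List J, l.length = n ∧ 0 ≤ lsum f l ∧ ω ∈ AL B D e s0 y0 l} ≤
      (∑ j, (π j + φ) * Real.exp (f j)) ^ n := by
  classical
  have hALm : ∀ l, MeasurableSet[sigmaMinus c v (s0 + lsum D l - g)] (AL B D e s0 y0 l) := by
    intro l
    induction l with
    | nil => exact MeasurableSet.univ
    | cons j l ih =>
      refine MeasurableSet.inter ?_ ?_
      · have := hBm j (s0 + lsum D l) (y0 + lsum e l)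
        convert this using 2
        simp only [lsum]; ring
      · refine sigmaMinus_mono ?_ _ ih
        simp only [lsum]; linarith [hD j]
  have hstep : ∀ j l, P.real (AL B D e s0 y0 (j :: l)) ≤ P.real (AL B D e s0 y0 l) * (π j + φ) := by
    intro j l
    refine (hmix _ _ _ (hALm l) ?_).trans ?_
    · have := hBp j (s0 + lsum D l) (y0 + lsum e l)
      convert this using 2
      ring
    · exact mul_le_mul_of_nonneg_left (by linarith [hπ j (s0 + lsum D l) (y0 + lsum e l)]) measureReal_nonneg
  have hsum : ∀ n, ∑ l ∈ Ls J n, P.real (AL B D e s0 y0 l) * Real.exp (lsum f l) ≤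
      (∑ j, (π j + φ) * Real.exp (f j)) ^ n := by
    intro n
    induction n with
    | zero => simp [Ls, AL, lsum]
    | succ n ih =>
      rw [sum_Ls]
      have hπ0 : ∀ j, 0 ≤ π j := fun j => measureReal_nonneg.trans (hπ j 0 0)
      calc _ ≤ ∑ l ∈ Ls J n, ∑ j, (P.real (AL B D e s0 y0 l) * (π j + φ)) * (Real.exp (f j) * Real.exp (lsum f l)) := by
            refine Finset.sum_le_sum fun l _ => Finset.sum_le_sum fun j _ => ?_
            rw [lsum, Real.exp_add]
            exact mul_le_mul_of_nonneg_right (hstep j l) (by positivity)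
        _ = (∑ l ∈ Ls J n, P.real (AL B D e s0 y0 l) * Real.exp (lsum f l)) * ∑ j, (π j + φ) * Real.exp (f j) := by
            rw [Finset.sum_mul_sum]
            refine Finset.sum_congr rfl fun l _ => Finset.sum_congr rfl fun j _ => by ring
        _ ≤ _ := by
            rw [pow_succ]
            refine mul_le_mul_of_nonneg_right ih (Finset.sum_nonneg fun j _ => ?_)
            have := hπ0 j
            positivity
  refine le_trans ?_ (hsum n)
  have hsub : {ω | ∃ l : List J, l.length = n ∧ 0 ≤ lsum f l ∧ ω ∈ AL B D e s0 y0 l} ⊆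
      ⋃ l ∈ (Ls J n).filter (fun l => 0 ≤ lsum f l), AL B D e s0 y0 l := by
    rintro ω ⟨l, hl, hf, hω⟩
    simp only [Set.mem_iUnion, Finset.mem_filter, exists_prop]
    exact ⟨l, ⟨mem_Ls n l hl, hf⟩, hω⟩
  refine (measureReal_mono hsub (measure_ne_top _ _)).trans ((measureReal_biUnion_finset_le _ _).trans ?_)
  refine (Finset.sum_le_sum (g := fun l => P.real (AL B D e s0 y0 l) * Real.exp (lsum f l)) ?_).trans
    (Finset.sum_le_sum_of_subset_of_nonneg (Finset.filter_subset _ _) ?_)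
  · intro l hl
    have := Real.one_le_exp (Finset.mem_filter.1 hl).2
    nlinarith [measureReal_nonneg (μ := P) (s := AL B D e s0 y0 l)]
  · intro l _ _
    positivity

end pattern

/-- travel-time facts -/
lemma tt_lt_of_reach {c : ℝ → Euc d → ℝ} {v : ℝ → Euc d → Euc d} {s t t' : ℝ} {y x : Euc d}
    (hr : Reachable c v s y (s + t) x) (h : t < t') : travelTime c v s y x < t' := by
  refine lt_of_le_of_lt (csInf_le ⟨0, fun r hr => hr.1⟩ ⟨?_, hr⟩) h
  linarith [hr.1]

structure RE {Ω : Type*} [MeasurableSpace Ω] (p : Par) (T1 : ℝ) (P : Measure Ω)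
    (c : ℝ → Euc d → Ω → ℝ) (v : ℝ → Euc d → Ω → Euc d) : Prop where
  prob : IsProbabilityMeasure P
  env : ∀ ω, Env p (fun a b => c a b ω) (fun a b => v a b ω)
  T1_pos : 0 < T1
  ctrl : ∀ ω t0 t1 x0 x1, T1 * (1 + ‖x1 - x0‖) ≤ t1 - t0 →
    Reachable (fun a b => c a b ω) (fun a b => v a b ω) t0 x0 t1 x1
  meas : ∀ s y x, Measurable fun ω => travelTime (fun a b => c a b ω) (fun a b => v a b ω) s y x
  stat : ∀ s t y z, P.real {ω | t ≤ travelTime (fun a b => c a b ω) (fun a b => v a b ω) s y (y + z)} = 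
     P.real {ω | t ≤ travelTime (fun a b => c a b ω) (fun a b => v a b ω) 0 0 z}
  mix : ∀ ε : ℝ, 0 < ε → ∃ g, 0 ≤ g ∧ MixG P c v g ε

section re
variable {Ω : Type*} [MeasurableSpace Ω] {P : Measure Ω} {T1 : ℝ}
  {c : ℝ → Euc d → Ω → ℝ} {v : ℝ → Euc d → Ω → Euc d}

/-- shorthand for reachability in environment ω -/
abbrev Rch (c : ℝ → Euc d → Ω → ℝ) (v : ℝ → Euc d → Ω → Euc d) (ω : Ω) (s : ℝ) (y : Euc d) (t : ℝ) (x : Euc d) : Prop :=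
  Reachable (fun a b => c a b ω) (fun a b => v a b ω) s y t x

abbrev tau (c : ℝ → Euc d → Ω → ℝ) (v : ℝ → Euc d → Ω → Euc d) (ω : Ω) (s : ℝ) (y x : Euc d) : ℝ :=
  travelTime (fun a b => c a b ω) (fun a b => v a b ω) s y x

/-- tail probability -/
def tq (P : Measure Ω) (c : ℝ → Euc d → Ω → ℝ) (v : ℝ → Euc d → Ω → Euc d) (t : ℝ) (z : Euc d) : ℝ :=
  P.real {ω | t ≤ tau c v ω 0 0 z}

lemma RE.loop (h : RE p T1 P c v) {ω : Ω} {s t t' : ℝ} {y x x' : Euc d} (hr : Rch c v ω s y t x)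
    (ht : t + T1 * (1 + ‖x' - x‖) ≤ t') : Rch c v ω s y t' x' :=
  reach_trans hr (h.ctrl ω _ _ _ _ (by linarith))

lemma RE.reach_of_tau (h : RE p T1 P c v) {ω : Ω} {s t t' : ℝ} {y x : Euc d} (hτ : tau c v ω s y x < t)
    (ht : t + T1 ≤ t') : Rch c v ω s y (s + t') x := by
  have hne : {t | 0 ≤ t ∧ x ∈ reachSet (fun a b => c a b ω) (fun a b => v a b ω) t s y}.Nonempty := by
    have hT := h.T1_pos
    refine ⟨T1 * (1 + ‖x - y‖), by positivity, h.ctrl ω _ _ _ _ (by linarith)⟩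
  obtain ⟨r, ⟨hr0, hr⟩, hrt⟩ := exists_lt_of_csInf_lt hne hτ
  refine h.loop hr ?_
  simp only [sub_self, norm_zero]
  linarith

abbrev AA (p : Par) (c : ℝ → Euc d → Ω → ℝ) (v : ℝ → Euc d → Ω → Euc d) (t s : ℝ) (y x : Euc d) : Set Ω :=
  {ω | AEv p (fun a b => c a b ω) (fun a b => v a b ω) t s y x}

lemma RE.reach_of_AA (h : RE p T1 P c v) {ω : Ω} {s t t' : ℝ} {y x : Euc d} (hA : ω ∈ AA p c v t s y x)
    (ht : t + 2 * T1 ≤ t') : Rch c v ω s y (s + t') x := by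
  obtain ⟨z, hz, hr⟩ := reach_of_AEv (h.env ω) hA
  refine h.loop hr ?_
  rw [norm_sub_rev]
  nlinarith [h.T1_pos]

lemma RE.tau_of_not_AA (h : RE p T1 P c v) {ω : Ω} {s t u : ℝ} {y x : Euc d} (hA : ω ∉ AA p c v t s y x)
    (hu : u + T1 ≤ t) (ht : 0 < t) : u ≤ tau c v ω s y x := by
  by_contra hlt
  push Not at hlt
  exact hA (AEv_of_reach (h.env ω) ht (h.reach_of_tau hlt hu))

lemma RE.tau_of_AA (h : RE p T1 P c v) {ω : Ω} {s t u : ℝ} {y x : Euc d} (hA : ω ∈ AA p c v t s y x)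
    (hu : t + 2 * T1 < u) : tau c v ω s y x < u :=
  tt_lt_of_reach (h.reach_of_AA hA le_rfl) hu

lemma RE.prob_not_AA (h : RE p T1 P c v) {s t u : ℝ} {y z : Euc d} (hu : u + T1 ≤ t) (ht : 0 < t) :
    P.real (AA p c v t s y (y + z))ᶜ ≤ tq P c v u z := by
  haveI := h.prob
  rw [tq, ← h.stat s u y z]
  exact measureReal_mono (fun ω hω => h.tau_of_not_AA hω hu ht) (measure_ne_top _ _)

lemma RE.prob_tau_lt (h : RE p T1 P c v) (s u : ℝ) (y z : Euc d) :
    P.real {ω | tau c v ω s y (y + z) < u} = 1 - tq P c v u z := by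
  haveI := h.prob
  rw [tq, ← h.stat s u y z]
  have hm : MeasurableSet {ω | u ≤ tau c v ω s y (y + z)} := measurableSet_le measurable_const (h.meas s y _)
  rw [← probReal_compl_eq_one_sub hm]
  congr 1
  ext ω; simp

lemma RE.prob_AA (h : RE p T1 P c v) {s t u : ℝ} {y z : Euc d} (hu : t + 2 * T1 < u) :
    P.real (AA p c v t s y (y + z)) ≤ 1 - tq P c v u z := by
  haveI := h.prob
  rw [← h.prob_tau_lt s u y z]
  exact measureReal_mono (fun ω hω => h.tau_of_AA hω hu) (measure_ne_top _ _)

lemma tq_nonneg (t : ℝ) (z : Euc d) : 0 ≤ tq P c v t z := measureReal_nonneg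

lemma RE.tq_le_one (h : RE p T1 P c v) (t : ℝ) (z : Euc d) : tq P c v t z ≤ 1 := by
  haveI := h.prob
  exact measureReal_le_one

lemma RE.tq_anti (h : RE p T1 P c v) {t t' : ℝ} (ht : t ≤ t') (z : Euc d) : tq P c v t' z ≤ tq P c v t z := by
  haveI := h.prob
  exact measureReal_mono (fun ω hω => ht.trans hω) (measure_ne_top _ _)

lemma RE.tq_add (h : RE p T1 P c v) (t1 t2 : ℝ) (z1 z2 : Euc d) :
    tq P c v (t1 + t2 + 3 * T1) (z1 + z2) ≤ tq P c v t1 z1 + tq P c v t2 z2 := by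
  haveI := h.prob
  have e2 : tq P c v t2 z2 = P.real {ω | t2 ≤ tau c v ω (0 + (t1 + T1)) z1 (z1 + z2)} := (h.stat _ _ _ _).symm
  rw [e2, tq, tq]
  refine (measureReal_mono ?_ (measure_ne_top _ _)).trans (measureReal_union_le _ _)
  intro ω hω
  by_contra hcon
  simp only [Set.mem_union, Set.mem_setOf_eq, not_or, not_le] at hcon hω
  have r1 := h.reach_of_tau hcon.1 le_rfl
  have r2 := h.reach_of_tau hcon.2 le_rfl
  have r := reach_trans r1 r2
  have e : 0 + (t1 + T1) + (t2 + T1) = 0 + (t1 + t2 + 2 * T1) := by ring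
  rw [e] at r
  have := tt_lt_of_reach r (show t1 + t2 + 2 * T1 < t1 + t2 + 3 * T1 by linarith [h.T1_pos])
  exact absurd hω (not_le.2 this)

lemma RE.tq_zero (h : RE p T1 P c v) {t : ℝ} {z : Euc d} (ht : T1 * (1 + ‖z‖) < t) : tq P c v t z = 0 := by
  have : {ω | t ≤ tau c v ω 0 0 z} = ∅ := by
    ext ω
    simp only [Set.mem_setOf_eq, Set.mem_empty_iff_false, iff_false, not_le]
    refine tt_lt_of_reach (t := T1 * (1 + ‖z‖)) (h.ctrl ω _ _ _ _ ?_) ht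
    simp
  rw [tq, this, measureReal_empty]

lemma RE.tq_one (h : RE p T1 P c v) {t : ℝ} {z : Euc d} (ht : 2 * p.K * t ≤ ‖z‖) : tq P c v t z = 1 := by
  haveI := h.prob
  have : {ω | t ≤ tau c v ω 0 0 z} = Set.univ := by
    ext ω
    simp only [Set.mem_setOf_eq, Set.mem_univ, iff_true]
    have hT := h.T1_pos
    refine le_csInf ⟨T1 * (1 + ‖z - 0‖), by positivity, h.ctrl ω _ _ _ _ (by linarith)⟩ ?_
    rintro r ⟨hr0, hr⟩
    have := reach_speed (h.env ω) hr
    rw [zero_add, sub_zero, sub_zero] at this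
    exact le_of_mul_le_mul_left (ht.trans this) (by linarith [p.K_pos])
  rw [tq, this, probReal_univ]

end re
end GEq

namespace GEq
open scoped NNReal ENNReal
variable {d : ℕ} {p : Par}
variable {Ω : Type*} [MeasurableSpace Ω] {P : Measure Ω} {T1 : ℝ}
  {c : ℝ → Euc d → Ω → ℝ} {v : ℝ → Euc d → Ω → Euc d}

def G0 (P : Measure Ω) (c : ℝ → Euc d → Ω → ℝ) (v : ℝ → Euc d → Ω → Euc d) (s : ℝ) (z : Euc d) : Prop :=
  Tendsto (fun t : ℝ => tq P c v (s * t) (t • z)) atTop (nhds 0)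

def Good (P : Measure Ω) (c : ℝ → Euc d → Ω → ℝ) (v : ℝ → Euc d → Ω → Euc d) (s : ℝ) (z : Euc d) : Prop :=
  ∃ C κ : ℝ, 0 < C ∧ 0 < κ ∧ ∀ t : ℝ, 0 ≤ t → tq P c v (s * t) (t • z) ≤ C * Real.exp (-(κ * t))

lemma good_of_pow (h : RE p T1 P c v) {k s3 θ η : ℝ} {z : Euc d} (hk : 0 < k) (hs3 : 0 ≤ s3)
    (hθ0 : 0 ≤ θ) (hθ1 : θ < 1) (hη : 0 < η)
    (hp : ∀ n : ℕ, tq P c v (s3 * (n * k)) ((n * k) • z) ≤ θ ^ n) : Good P c v (s3 + η) z := by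
  obtain ⟨θ', hθ'0, hθ'θ, hθ'1⟩ : ∃ θ', 0 < θ' ∧ θ ≤ θ' ∧ θ' < 1 :=
    ⟨max θ (1/2), lt_max_of_lt_right (by norm_num), le_max_left _ _, max_lt hθ1 (by norm_num)⟩
  set C0 := T1 * (1 + k * ‖z‖) + 1 + 3 * T1 with hC0
  have hT := h.T1_pos
  have hC0p : 0 < C0 := by positivity
  set κ := -Real.log θ' / k with hκ
  have hlog : Real.log θ' < 0 := Real.log_neg hθ'0 hθ'1
  have hκp : 0 < κ := div_pos (by linarith) hk
  refine ⟨max θ'⁻¹ (Real.exp (κ * (C0 / η))), κ, lt_max_of_lt_left (by positivity), hκp, ?_⟩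
  intro t ht
  rcases le_or_gt (C0 / η) t with htC | htC
  · have hηt : C0 ≤ η * t := by rw [div_le_iff₀ hη] at htC; linarith
    set n := ⌊t / k⌋₊ with hn
    have hn1 : n * k ≤ t := by
      have := Nat.floor_le (show 0 ≤ t / k by positivity)
      rwa [le_div_iff₀ hk] at this
    have hn2 : t / k < n + 1 := Nat.lt_floor_add_one _
    have hn2' : t < n * k + k := by
      rw [div_lt_iff₀ hk] at hn2; linarith
    have e : t • z = (n * k) • z + (t - n * k) • z := by rw [← add_smul]; congr 1; ring
    have h0 : tq P c v (T1 * (1 + k * ‖z‖) + 1) ((t - n * k) • z) = 0 := by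
      refine h.tq_zero ?_
      rw [norm_smul, Real.norm_of_nonneg (by linarith)]
      have : (t - n * k) * ‖z‖ ≤ k * ‖z‖ := mul_le_mul_of_nonneg_right (by linarith) (norm_nonneg _)
      nlinarith
    have h1 := h.tq_add (s3 * (n * k)) (T1 * (1 + k * ‖z‖) + 1) ((n * k) • z) ((t - n * k) • z)
    rw [h0, add_zero, ← e] at h1
    have h2 : tq P c v ((s3 + η) * t) (t • z) ≤ θ ^ n := by
      refine (h.tq_anti ?_ _).trans (h1.trans (hp n))
      have := mul_le_mul_of_nonneg_left hn1 hs3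
      linarith
    refine h2.trans ((pow_le_pow_left₀ hθ0 hθ'θ n).trans ?_)
    have h3 : θ' ^ n ≤ θ'⁻¹ * Real.exp (-(κ * t)) := by
      rw [inv_mul_eq_div, le_div_iff₀ hθ'0, ← pow_succ, ← Real.exp_log (pow_pos hθ'0 _), Real.log_pow]
      refine Real.exp_le_exp.2 ?_
      have : κ * t = -Real.log θ' * (t / k) := by rw [hκ]; field_simp
      push_cast
      nlinarith
    exact h3.trans (mul_le_mul_of_nonneg_right (le_max_left _ _) (Real.exp_pos _).le)
  · refine (h.tq_le_one _ _).trans ?_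
    have : 1 ≤ Real.exp (κ * (C0 / η)) * Real.exp (-(κ * t)) := by
      rw [← Real.exp_add]
      refine Real.one_le_exp ?_
      nlinarith
    exact this.trans (mul_le_mul_of_nonneg_right (le_max_right _ _) (Real.exp_pos _).le)

section three

lemma three_params {T e1 e2 e3 π0 : ℝ} (hs : Real.exp e1 + π0 * Real.exp e2 < 1) :
    ∃ φ, 0 < φ ∧ ∀ g : ℝ, ∀ r : ℝ → ℝ, Tendsto r atTop (nhds 0) → ∀ᶠ k : ℝ in atTop,
      (1 + φ) * Real.exp (e1 + (T + g) / k) + (π0 + φ) * Real.exp (e2 + (T + g) / k) +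
        (r k + φ) * Real.exp (e3 + (T + g) / k) < 1 := by
  have h1 : Tendsto (fun φ : ℝ => (1 + φ) * Real.exp e1 + (π0 + φ) * Real.exp e2 + (0 + φ) * Real.exp e3)
      (nhds 0) (nhds ((1 + 0) * Real.exp e1 + (π0 + 0) * Real.exp e2 + (0 + 0) * Real.exp e3)) := by
    apply Continuous.tendsto (f := fun φ : ℝ => (1 + φ) * Real.exp e1 + (π0 + φ) * Real.exp e2 + (0 + φ) * Real.exp e3)
    fun_prop
  have h2 := (h1.eventually (gt_mem_nhds (show _ < (1:ℝ) by simpa using hs)))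
  obtain ⟨φ, hφ, hφ0⟩ := ((h2.filter_mono nhdsWithin_le_nhds).and self_mem_nhdsWithin : ∀ᶠ φ in nhdsWithin (0:ℝ) (Set.Ioi 0), _ ∧ φ ∈ Set.Ioi (0:ℝ)).exists
  refine ⟨φ, hφ0, ?_⟩
  intro g r hr
  have h3 : Tendsto (fun k : ℝ => (T + g) / k) atTop (nhds 0) := tendsto_const_nhds.div_atTop tendsto_id
  have h4 : ∀ e : ℝ, Tendsto (fun k : ℝ => Real.exp (e + (T + g) / k)) atTop (nhds (Real.exp e)) := by
    intro e
    have := (Real.continuous_exp.tendsto (e + 0)).comp (tendsto_const_nhds.add h3)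
    rwa [add_zero] at this
  have h5 := (((h4 e1).const_mul (1 + φ)).add ((h4 e2).const_mul (π0 + φ))).add ((hr.add_const φ).mul (h4 e3))
  exact h5.eventually (gt_mem_nhds hφ)

lemma three (h : RE p T1 P c v) {z : Euc d} {s1 s2 s3 π0 l : ℝ} (hs1 : 0 ≤ s1) (hs12 : s1 ≤ s2)
    (hs3 : 0 ≤ s3) (hl : 0 < l) (hG : G0 P c v s2 z)
    (hfr : ∃ᶠ k : ℝ in atTop, tq P c v (s1 * k) (k • z) ≤ π0)
    (hsum : Real.exp (l * (s1 - s3)) + π0 * Real.exp (l * (s2 - s3)) < 1) {η : ℝ} (hη : 0 < η) :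
    Good P c v (s3 + η) z := by
  haveI := h.prob
  have hT := h.T1_pos
  obtain ⟨φ, hφ, H⟩ := three_params (T := l * (4 * T1)) (e3 := l * (s2 - s3 + T1 * ‖z‖)) hsum
  obtain ⟨g, hg, hmix⟩ := h.mix φ hφ
  obtain ⟨k, hk1, hk2, hk0⟩ := (hfr.and_eventually ((H (l * g) _ hG).and (eventually_gt_atTop 0))).exists
  set D : Fin 3 → ℝ := ![s1 * k + 4 * T1 + g, s2 * k + 4 * T1 + g, s2 * k + T1 * ‖k • z‖ + 4 * T1 + g] with hD
  set B : Fin 3 → ℝ → Euc d → Set Ω := fun j s y =>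
    ![AA p c v (s1 * k + T1) s y (y + k • z), 
      (AA p c v (s1 * k + T1) s y (y + k • z))ᶜ ∩ AA p c v (s2 * k + T1) s y (y + k • z),
      (AA p c v (s2 * k + T1) s y (y + k • z))ᶜ] j with hB
  set π : Fin 3 → ℝ := ![1, π0, tq P c v (s2 * k) (k • z)] with hπ
  set f : Fin 3 → ℝ := fun j => (l / k) * (D j - s3 * k) with hf
  have hs2 : 0 ≤ s2 := hs1.trans hs12
  have hs1k : 0 ≤ s1 * k := by positivity
  have hs2k : 0 ≤ s2 * k := by positivity
  have hs12k : s1 * k ≤ s2 * k := mul_le_mul_of_nonneg_right hs12 hk0.le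
  have hTz : 0 ≤ T1 * ‖k • z‖ := by positivity
  have hpat := pattern (P := P) hφ.le hmix B D (fun _ => k • z) f π ?_ ?_ ?_ ?_ 0 0
  rotate_left
  · intro j; fin_cases j <;> simp [hD] <;> linarith
  · intro j s y
    fin_cases j
    · exact AEv_plus
    · exact (AEv_plus.compl).inter AEv_plus
    · exact AEv_plus.compl
  · intro j s y
    fin_cases j
    · exact AEv_minus (by simp [hD]; linarith)
    · exact ((AEv_minus (by simp [hD]; linarith)).compl).inter (AEv_minus (by simp [hD]; linarith))
    · exact (AEv_minus (by simp [hD]; linarith)).compl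
  · intro j s y
    fin_cases j
    · exact measureReal_le_one
    · exact (measureReal_mono Set.inter_subset_left (measure_ne_top _ _)).trans
        ((h.prob_not_AA le_rfl (by linarith)).trans hk1)
    · exact h.prob_not_AA le_rfl (by linarith)
  set θ := ∑ j, (π j + φ) * Real.exp (f j) with hθ
  have hθ1 : θ < 1 := by
    refine lt_of_le_of_lt ?_ hk2
    rw [hθ, Fin.sum_univ_three]
    have hlk : 0 < l / k := by positivity
    refine le_of_eq ?_
    have e1 : f 0 = l * (s1 - s3) + (l * (4 * T1) + l * g) / k := by
      simp [hf, hD]; field_simp; ring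
    have e2 : f 1 = l * (s2 - s3) + (l * (4 * T1) + l * g) / k := by
      simp [hf, hD]; field_simp; ring
    have e3 : f 2 = l * (s2 - s3 + T1 * ‖z‖) + (l * (4 * T1) + l * g) / k := by
      simp [hf, hD, norm_smul, abs_of_pos hk0]; field_simp; ring
    rw [e1, e2, e3]
    simp [hπ]
  have hπ0 : ∀ j, 0 ≤ π j := by
    intro j
    fin_cases j
    · simp [hπ]
    · exact (tq_nonneg _ _).trans hk1
    · exact tq_nonneg _ _
  have hθ0 : 0 ≤ θ := Finset.sum_nonneg fun j _ => by have := hπ0 j; positivity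
  refine good_of_pow h hk0 hs3 hθ0 hθ1 hη ?_
  intro n
  refine le_trans (measureReal_mono ?_ (measure_ne_top _ _)) (hpat n)
  intro ω hω
  have hcov : ∀ s y, ∃ j, ω ∈ B j s y ∧ Rch c v ω s y (s + D j) (y + k • z) := by
    intro s y
    by_cases h1 : ω ∈ AA p c v (s1 * k + T1) s y (y + k • z)
    · exact ⟨0, h1, h.reach_of_AA h1 (by simp [hD]; linarith)⟩
    by_cases h2 : ω ∈ AA p c v (s2 * k + T1) s y (y + k • z)
    · exact ⟨1, ⟨h1, h2⟩, h.reach_of_AA h2 (by simp [hD]; linarith)⟩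
    · refine ⟨2, h2, h.ctrl ω _ _ _ _ ?_⟩
      rw [add_sub_cancel_left]
      simp only [hD, Matrix.cons_val, add_sub_cancel_left]
      linarith
  have key : ∀ n : ℕ, ∃ L : List (Fin 3), L.length = n ∧ ω ∈ AL B D (fun _ => k • z) 0 0 L ∧
      lsum (fun _ => k • z) L = (n * k) • z ∧ lsum f L = (l / k) * (lsum D L - s3 * (n * k)) ∧
      Rch c v ω 0 0 (0 + lsum D L) (0 + (n * k) • z) := by
    intro n
    induction n with
    | zero => exact ⟨[], rfl, Set.mem_univ _, by simp [lsum], by simp [lsum], by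
        simpa [lsum] using reach_refl (c := fun a b => c a b ω) (v := fun a b => v a b ω) 0 0⟩
    | succ n ih =>
      obtain ⟨L, h1, h2, h3, h4, h5⟩ := ih
      obtain ⟨j, hj1, hj2⟩ := hcov (0 + lsum D L) (0 + (n * k) • z)
      have e : ((n + 1 : ℕ) * k) • z = k • z + (n * k) • z := by
        rw [← add_smul]; congr 1; push_cast; ring
      refine ⟨j :: L, by simp [h1], ⟨by rw [h3]; exact hj1, h2⟩, ?_, ?_, ?_⟩
      · rw [lsum, h3, e]
      · rw [lsum, h4, lsum, hf]; push_cast; ring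
      · have := reach_trans h5 hj2
        rw [e, lsum]
        convert this using 1
        · ring
        · abel
  obtain ⟨L, h1, h2, h3, h4, h5⟩ := key n
  refine ⟨L, h1, ?_, h2⟩
  rw [h4]
  by_contra hcon
  have hlt : lsum D L < s3 * (n * k) := by
    by_contra hge
    push Not at hge
    exact hcon (mul_nonneg (by positivity) (by linarith))
  rw [zero_add ((n * k) • z)] at h5
  exact absurd hω (not_le.2 (tt_lt_of_reach h5 hlt))

end three
end GEq

namespace GEq
open scoped NNReal ENNReal
variable {d : ℕ} {p : Par}
variable {Ω : Type*} [MeasurableSpace Ω] {P : Measure Ω} {T1 : ℝ}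
  {c : ℝ → Euc d → Ω → ℝ} {v : ℝ → Euc d → Ω → Euc d}

lemma G0_of_ev {s : ℝ} {z : Euc d} (r : ℝ → ℝ) (hr : Tendsto r atTop (nhds 0))
    (h : ∀ᶠ t : ℝ in atTop, tq P c v (s * t) (t • z) ≤ r t) : G0 P c v s z :=
  tendsto_of_tendsto_of_tendsto_of_le_of_le' tendsto_const_nhds hr
    (Eventually.of_forall fun _ => tq_nonneg _ _) h

lemma Good.g0 {s : ℝ} {z : Euc d} (h : Good P c v s z) : G0 P c v s z := by
  obtain ⟨C, κ, hC, hκ, H⟩ := h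
  refine G0_of_ev (fun t => C * Real.exp (-(κ * t))) ?_ ((eventually_ge_atTop 0).mono H)
  have : Tendsto (fun t : ℝ => Real.exp (-(κ * t))) atTop (nhds 0) :=
    Real.tendsto_exp_neg_atTop_nhds_zero.comp (tendsto_id.const_mul_atTop hκ)
  simpa using this.const_mul C

lemma RE.G0_mono (h : RE p T1 P c v) {s s' : ℝ} {z : Euc d} (hs : s ≤ s') (hG : G0 P c v s z) : G0 P c v s' z := by
  refine G0_of_ev _ hG ?_
  filter_upwards [eventually_ge_atTop 0] with t ht
  exact h.tq_anti (mul_le_mul_of_nonneg_right hs ht) _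

lemma RE.G0_big (h : RE p T1 P c v) {s : ℝ} {z : Euc d} (hs : T1 * ‖z‖ < s) : G0 P c v s z := by
  refine G0_of_ev (fun _ => 0) tendsto_const_nhds ?_
  filter_upwards [eventually_gt_atTop (T1 / (s - T1 * ‖z‖)), eventually_ge_atTop 0] with t ht ht0
  refine (h.tq_zero ?_).le
  rw [norm_smul, Real.norm_of_nonneg ht0]
  rw [div_lt_iff₀ (by linarith)] at ht
  linarith

lemma RE.G0_low (h : RE p T1 P c v) {s : ℝ} {z : Euc d} (hG : G0 P c v s z) : ‖z‖ ≤ 2 * p.K * s := by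
  by_contra hcon
  push Not at hcon
  have h1 : Tendsto (fun t : ℝ => tq P c v (s * t) (t • z)) atTop (nhds 1) := by
    refine tendsto_const_nhds.congr' ?_
    filter_upwards [eventually_ge_atTop 0] with t ht
    refine (h.tq_one ?_).symm
    rw [norm_smul, Real.norm_of_nonneg ht]
    nlinarith
  exact zero_ne_one (tendsto_nhds_unique hG h1)

lemma RE.G0_add (h : RE p T1 P c v) {s1 s2 s : ℝ} {z1 z2 : Euc d} (h1 : G0 P c v s1 z1) (h2 : G0 P c v s2 z2)
    (hs : s1 + s2 < s) : G0 P c v s (z1 + z2) := by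
  refine G0_of_ev _ (by simpa using h1.add h2) ?_
  filter_upwards [eventually_gt_atTop (3 * T1 / (s - (s1 + s2)))] with t ht
  rw [smul_add]
  refine le_trans (h.tq_anti ?_ _) (h.tq_add _ _ _ _)
  rw [div_lt_iff₀ (by linarith)] at ht
  linarith

lemma G0_smul {s a : ℝ} {z : Euc d} (ha : 0 < a) (h : G0 P c v s z) : G0 P c v (a * s) (a • z) := by
  have := h.comp (tendsto_id.const_mul_atTop ha)
  refine this.congr fun t => ?_
  simp only [Function.comp, id]
  congr 1
  · ring
  · rw [smul_smul]; congr 1; ring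

def wu (P : Measure Ω) (c : ℝ → Euc d → Ω → ℝ) (v : ℝ → Euc d → Ω → Euc d) (z : Euc d) : ℝ :=
  sInf {s | 0 ≤ s ∧ G0 P c v s z}

lemma wu_nonneg (z : Euc d) : 0 ≤ wu P c v z := Real.sInf_nonneg fun _ hs => hs.1

lemma wu_le_of {s : ℝ} {z : Euc d} (hs : 0 ≤ s) (h : G0 P c v s z) : wu P c v z ≤ s :=
  csInf_le ⟨0, fun _ h => h.1⟩ ⟨hs, h⟩

lemma RE.ne (h : RE p T1 P c v) (z : Euc d) : {s | 0 ≤ s ∧ G0 P c v s z}.Nonempty := by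
  have := h.T1_pos
  exact ⟨T1 * ‖z‖ + 1, by positivity, h.G0_big (by linarith)⟩

lemma RE.wu_le (h : RE p T1 P c v) (z : Euc d) : wu P c v z ≤ T1 * ‖z‖ := by
  have := h.T1_pos
  refine le_of_forall_pos_le_add fun ε hε => wu_le_of (by positivity) (h.G0_big (by linarith))

lemma RE.le_wu (h : RE p T1 P c v) (z : Euc d) : ‖z‖ ≤ 2 * p.K * wu P c v z := by
  have hK := p.K_pos
  have : ‖z‖ / (2 * p.K) ≤ wu P c v z := by
    refine le_csInf (h.ne z) ?_
    rintro s ⟨_, hs⟩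
    rw [div_le_iff₀ (by positivity)]
    linarith [h.G0_low hs]
  rw [div_le_iff₀ (by positivity)] at this
  linarith

lemma RE.G0_of_wu (h : RE p T1 P c v) {s : ℝ} {z : Euc d} (hs : wu P c v z < s) : G0 P c v s z := by
  obtain ⟨r, hr, hrs⟩ := exists_lt_of_csInf_lt (h.ne z) hs
  exact h.G0_mono hrs.le hr.2

lemma RE.wu_add (h : RE p T1 P c v) (z1 z2 : Euc d) : wu P c v (z1 + z2) ≤ wu P c v z1 + wu P c v z2 := by
  refine le_of_forall_pos_le_add fun ε hε => ?_
  have h1 := h.G0_of_wu (show wu P c v z1 < wu P c v z1 + ε / 3 by linarith)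
  have h2 := h.G0_of_wu (show wu P c v z2 < wu P c v z2 + ε / 3 by linarith)
  have := wu_nonneg (P := P) (c := c) (v := v) z1
  have := wu_nonneg (P := P) (c := c) (v := v) z2
  exact wu_le_of (by linarith) (h.G0_add h1 h2 (by linarith))

lemma RE.wu_smul_le (h : RE p T1 P c v) {a : ℝ} (ha : 0 < a) (z : Euc d) :
    wu P c v (a • z) ≤ a * wu P c v z := by
  have h0 := wu_nonneg (P := P) (c := c) (v := v) z
  refine le_of_forall_pos_le_add fun ε hε => ?_
  have h1 := h.G0_of_wu (show wu P c v z < wu P c v z + ε / a from lt_add_of_pos_right _ (by positivity))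
  have := wu_le_of (by positivity) (G0_smul ha h1)
  rw [mul_add, mul_div_cancel₀ _ ha.ne'] at this
  exact this

lemma RE.wu_smul (h : RE p T1 P c v) {a : ℝ} (ha : 0 < a) (z : Euc d) :
    wu P c v (a • z) = a * wu P c v z := by
  refine le_antisymm (h.wu_smul_le ha z) ?_
  have := h.wu_smul_le (inv_pos.2 ha) (a • z)
  rw [smul_smul, inv_mul_cancel₀ ha.ne', one_smul, inv_mul_eq_div, le_div_iff₀ ha] at this
  linarith

lemma RE.wu_zero (h : RE p T1 P c v) : wu P c v (0 : Euc d) = 0 :=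
  le_antisymm (by simpa using h.wu_le 0) (wu_nonneg _)

lemma RE.wu_sub (h : RE p T1 P c v) (z z' : Euc d) : wu P c v z ≤ wu P c v z' + T1 * ‖z - z'‖ := by
  have := h.wu_add z' (z - z')
  rw [add_sub_cancel] at this
  linarith [h.wu_le (z - z')]

lemma RE.good_of_wu (h : RE p T1 P c v) {s : ℝ} {z : Euc d} (hs : wu P c v z < s) : Good P c v s z := by
  obtain ⟨s', hs1, hs2⟩ := exists_between hs
  have h0 := wu_nonneg (P := P) (c := c) (v := v) z
  have hG := h.G0_of_wu hs1
  set δ := (s - s') / 2 with hδ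
  have hδp : 0 < δ := by rw [hδ]; linarith
  have e : s = s' + δ + δ := by rw [hδ]; ring
  rw [e]
  refine three h (s1 := s') (s2 := s') (s3 := s' + δ) (π0 := 1 / 2) (l := 1 / δ) (h0.trans hs1.le) le_rfl
    (by linarith) (by positivity) hG ?_ ?_ hδp
  · have : ∀ᶠ t : ℝ in atTop, tq P c v (s' * t) (t • z) < 1 / 2 := hG.eventually (gt_mem_nhds (by norm_num))
    exact this.frequently.mono fun _ h => h.le
  · have e1 : 1 / δ * (s' - (s' + δ)) = -1 := by field_simp; ring
    rw [e1]
    have := Real.exp_neg_one_lt_d9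
    linarith

lemma RE.tq_lower (h : RE p T1 P c v) {s : ℝ} {z : Euc d} (hs0 : 0 ≤ s) (hs : s < wu P c v z) :
    Tendsto (fun t : ℝ => tq P c v (s * t) (t • z)) atTop (nhds 1) := by
  by_contra hcon
  obtain ⟨π0, hπ1, hfr⟩ : ∃ π0 : ℝ, π0 < 1 ∧ ∃ᶠ k : ℝ in atTop, tq P c v (s * k) (k • z) ≤ π0 := by
    by_contra hno
    push Not at hno
    refine hcon (tendsto_order.2 ⟨fun a ha => ?_, fun a ha => Eventually.of_forall fun t => lt_of_le_of_lt (h.tq_le_one _ _) ha⟩)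
    have := hno a ha
    exact this
  have hπ0 : 0 ≤ π0 := by
    obtain ⟨k, hk⟩ := hfr.exists
    exact (tq_nonneg _ _).trans hk
  set m := wu P c v z with hm
  set δ := m - s with hδ
  have hδp : 0 < δ := by rw [hδ]; linarith
  have h1 : Tendsto (fun x : ℝ => Real.exp (-x)) atTop (nhds 0) := Real.tendsto_exp_neg_atTop_nhds_zero
  obtain ⟨x, hx, hx0⟩ := ((h1.eventually (gt_mem_nhds (show 0 < (1 - π0) / 4 by linarith))).and (eventually_gt_atTop 0)).exists
  set l := 2 * x / δ with hl
  have hlp : 0 < l := by positivity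
  have h2 : Tendsto (fun η : ℝ => π0 * Real.exp (l * (2 * η))) (nhds 0) (nhds (π0 * Real.exp (l * (2 * 0)))) := by
    apply Continuous.tendsto (f := fun η : ℝ => π0 * Real.exp (l * (2 * η)))
    fun_prop
  have h3 := h2.eventually (gt_mem_nhds (show _ < (1 + π0) / 2 by simp; linarith))
  have h4 := h3.and (gt_mem_nhds (show 0 < δ / 2 by positivity))
  obtain ⟨η, ⟨hη1, hη2⟩, hη0⟩ := ((h4.filter_mono nhdsWithin_le_nhds).and self_mem_nhdsWithin : ∀ᶠ φ in nhdsWithin (0:ℝ) (Set.Ioi 0), _ ∧ φ ∈ Set.Ioi (0:ℝ)).exists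
  have hη0' : 0 < η := hη0
  have := three h (z := z) (s1 := s) (s2 := m + η) (s3 := m - η) (π0 := π0) (l := l) hs0 (by linarith)
    (by linarith) hlp (h.G0_of_wu (by linarith)) hfr ?_ (η := η / 2) (by linarith)
  · have h5 := wu_le_of (by linarith) this.g0
    rw [← hm] at h5
    linarith
  · have e1 : m + η - (m - η) = 2 * η := by ring
    rw [e1]
    have e2 : Real.exp (l * (s - (m - η))) ≤ Real.exp (-x) := by
      refine Real.exp_le_exp.2 ?_
      have : l * (δ / 2) = x := by rw [hl]; field_simp
      have : l * (s - (m - η)) ≤ l * (-(δ / 2)) := mul_le_mul_of_nonneg_left (by linarith) hlp.le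
      linarith
    linarith

end GEq

namespace GEq
open scoped NNReal ENNReal
variable {d : ℕ} {p : Par}
variable {Ω : Type*} [MeasurableSpace Ω] {P : Measure Ω} {T1 : ℝ}
  {c : ℝ → Euc d → Ω → ℝ} {v : ℝ → Euc d → Ω → Euc d}

lemma exists_net (d : ℕ) (R : ℝ) {ε : ℝ} (hε : 0 < ε) :
    ∃ F : Finset (Euc d), (∀ z : Euc d, ‖z‖ ≤ R → ∃ f ∈ F, ‖f - z‖ ≤ ε) ∧ ∀ f ∈ F, ‖f‖ ≤ R := by
  obtain ⟨t, ht, htf, hc⟩ := (isCompact_closedBall (0 : Euc d) R).finite_cover_balls hε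
  refine ⟨htf.toFinset, ?_, ?_⟩
  · intro z hz
    obtain ⟨f, hf, hfz⟩ := Set.mem_iUnion₂.1 (hc (mem_closedBall_zero_iff.2 hz))
    refine ⟨f, by simpa using hf, ?_⟩
    rw [mem_ball, dist_comm, dist_eq_norm] at hfz
    exact hfz.le
  · intro f hf
    exact mem_closedBall_zero_iff.1 (ht (by simpa using hf))

lemma net_scaled {F : Finset (Euc d)} {R ε k : ℝ} (hF : ∀ z : Euc d, ‖z‖ ≤ R → ∃ f ∈ F, ‖f - z‖ ≤ ε) (hk : 0 < k)
    (x : Euc d) (hx : ‖x‖ ≤ k * R) : ∃ f ∈ F, ‖k • f - x‖ ≤ k * ε ∧ k * ‖f‖ ≤ ‖x‖ + k * ε := by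
  obtain ⟨f, hf, hfx⟩ := hF (k⁻¹ • x) (by
    rw [norm_smul, norm_inv, Real.norm_of_nonneg hk.le, inv_mul_le_iff₀ hk]; exact hx)
  have e : k • f - x = k • (f - k⁻¹ • x) := by rw [smul_sub, smul_inv_smul₀ hk.ne']
  have h1 : ‖k • f - x‖ ≤ k * ε := by
    rw [e, norm_smul, Real.norm_of_nonneg hk.le]
    exact mul_le_mul_of_nonneg_left hfx hk.le
  refine ⟨f, hf, h1, ?_⟩
  have h2 := norm_le_norm_add_norm_sub' (k • f) x
  rw [norm_smul, Real.norm_of_nonneg hk.le] at h2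
  linarith

/-- one step of the coarse-graining of a path -/
lemma outer_step (h : RE p T1 P c v) {F : Finset (Euc d)} {R ε k g u s : ℝ} {y a b1 b2 : Euc d} {ω : Ω}
    (hε : 0 < ε) (hε1 : ε ≤ 1) 
    (hR : 2 * p.K + 2 + 2 * p.K * (1 + 2 * T1) ≤ R)
    (hF : ∀ z : Euc d, ‖z‖ ≤ R → ∃ f ∈ F, ‖f - z‖ ≤ ε) (hg : 0 ≤ g) (hu : u = T1 * (1 + k * ε))
    (hk : 0 < k) (huk : 2 * u ≤ k) (hgk : 2 * T1 + g ≤ k * ε) (hya : ‖a - y‖ ≤ k * ε)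
    (h1 : Rch c v ω (s + u) a (s + k - u) b1) (h2 : Rch c v ω (s + k - u) b1 (s + k + g + u) b2) :
    ∃ f ∈ F, ∃ f' ∈ F, ‖f'‖ ≤ (2 + 2 * p.K * (1 + 2 * T1)) * ε ∧ ω ∈ AA p c v k s y (y + k • f) ∧
      ‖b2 - (y + k • (f + f'))‖ ≤ k * ε := by
  have hT := h.T1_pos
  have hK := p.K_pos
  have hu0 : 0 ≤ u := by rw [hu]; positivity
  have hs1 := reach_speed (h.env ω) h1
  have hs2 := reach_speed (h.env ω) h2
  have hkε : k * ε ≤ k := by nlinarith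
  have n1 : ‖b1 - y‖ ≤ k * R := by
    have := norm_add_le (b1 - a) (a - y)
    rw [sub_add_sub_cancel] at this
    have : 2 * p.K * (s + k - u - (s + u)) ≤ 2 * p.K * k := mul_le_mul_of_nonneg_left (by linarith) (by linarith)
    have : 0 ≤ k * (2 * p.K * (1 + 2 * T1)) := by positivity
    nlinarith
  obtain ⟨f, hf, hfb, -⟩ := net_scaled hF hk _ n1
  have n2' : ‖b2 - (y + k • f)‖ ≤ k * ((1 + 2 * p.K * (1 + 2 * T1)) * ε) := by
    have e : b2 - (y + k • f) = (b2 - b1) - (k • f - (b1 - y)) := by abel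
    rw [e]
    refine (norm_sub_le _ _).trans ?_
    have : 2 * p.K * (s + k + g + u - (s + k - u)) ≤ 2 * p.K * (k * ε + 2 * T1 * (k * ε)) := by
      refine mul_le_mul_of_nonneg_left ?_ (by linarith)
      rw [hu]; linarith
    linarith
  have n2 : ‖b2 - (y + k • f)‖ ≤ k * R := by
    refine n2'.trans (mul_le_mul_of_nonneg_left ?_ hk.le)
    have : (1 + 2 * p.K * (1 + 2 * T1)) * ε ≤ 1 + 2 * p.K * (1 + 2 * T1) := mul_le_of_le_one_right (by positivity) hε1
    linarith
  obtain ⟨f', hf', hf'b, hf'n⟩ := net_scaled hF hk _ n2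
  refine ⟨f, hf, f', hf', ?_, ?_, ?_⟩
  · have : k * ‖f'‖ ≤ k * ((2 + 2 * p.K * (1 + 2 * T1)) * ε) := by linarith
    exact le_of_mul_le_mul_left this hk
  · refine AEv_of_reach (h.env ω) hk ?_
    have r0 : Rch c v ω s y (s + u) a := by
      refine h.ctrl ω _ _ _ _ ?_
      rw [add_sub_cancel_left, hu]
      exact mul_le_mul_of_nonneg_left (by linarith) hT.le
    have r3 : Rch c v ω (s + k - u) b1 (s + k) (y + k • f) := by
      refine h.ctrl ω _ _ _ _ ?_
      have e : y + k • f - b1 = k • f - (b1 - y) := by abel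
      rw [e, sub_sub_cancel, hu]
      exact mul_le_mul_of_nonneg_left (by linarith) hT.le
    exact reach_trans (reach_trans r0 h1) r3
  · have e : b2 - (y + k • (f + f')) = -(k • f' - (b2 - (y + k • f))) := by rw [smul_add]; abel
    rw [e, norm_neg]
    exact hf'b

lemma outer_params (h : RE p T1 P c v) {δ : ℝ} (hδ : 0 < δ) : ∃ (ε R l g k φ : ℝ) (F : Finset (Euc d)) (π : Euc d → ℝ),
    0 < ε ∧ ε ≤ 1 ∧ 2 * p.K + 2 + 2 * p.K * (1 + 2 * T1) ≤ R ∧ 0 < l ∧ 0 ≤ g ∧ 0 < k ∧ 0 < φ ∧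
    (∀ z : Euc d, ‖z‖ ≤ R → ∃ f ∈ F, ‖f - z‖ ≤ ε) ∧
    2 * (T1 * (1 + k * ε)) ≤ k ∧ 2 * T1 + g ≤ k * ε ∧ MixG P c v g φ ∧
    (∀ f ∈ F, ∀ s y, P.real (AA p c v k s y (y + k • f)) ≤ π f) ∧
    (∀ f ∈ F, ∀ f' ∈ F, ‖f'‖ ≤ (2 + 2 * p.K * (1 + 2 * T1)) * ε → 
      (π f + φ) * Real.exp (l * (wu P c v f + wu P c v f' - (1 + δ))) ≤ 1 / (2 * (F.card ^ 2 + 1))) := by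
  haveI := h.prob
  have hT := h.T1_pos
  have hK := p.K_pos
  set C2 := 2 + 2 * p.K * (1 + 2 * T1) with hC2
  have hC2p : 0 < C2 := by positivity
  set ε := min 1 (min (1 / (4 * T1)) (δ / (2 * (T1 * C2)))) with hε
  have hεp : 0 < ε := lt_min one_pos (lt_min (by positivity) (by positivity))
  have hε1 : ε ≤ 1 := min_le_left _ _
  have hε2 : ε * (4 * T1) ≤ 1 := by
    have : ε ≤ 1 / (4 * T1) := (min_le_right _ _).trans (min_le_left _ _)
    rwa [le_div_iff₀ (by positivity)] at this
  have hε3 : T1 * (C2 * ε) ≤ δ / 2 := by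
    have : ε ≤ δ / (2 * (T1 * C2)) := (min_le_right _ _).trans (min_le_right _ _)
    rw [le_div_iff₀ (by positivity)] at this
    linarith
  set R := 2 * p.K + C2 with hR
  obtain ⟨F, hF, hFR⟩ := exists_net d R hεp
  set N : ℝ := 2 * (F.card ^ 2 + 1) with hN
  have hNp : 0 < N := by positivity
  have h1 : Tendsto (fun x : ℝ => 2 * Real.exp (-x)) atTop (nhds 0) := by
    simpa using Real.tendsto_exp_neg_atTop_nhds_zero.const_mul 2
  obtain ⟨x, hx, hx0⟩ := ((h1.eventually (gt_mem_nhds (show 0 < 1 / N by positivity))).and (eventually_gt_atTop 0)).exists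
  set l := x / (δ / 2) with hl
  have hlp : 0 < l := by positivity
  have hlx : l * (δ / 2) = x := by rw [hl]; field_simp
  set W := Real.exp (l * (T1 * R)) with hW
  have hWp : 0 < W := Real.exp_pos _
  set φ := min 1 (1 / (2 * N * W)) with hφ
  have hφp : 0 < φ := lt_min one_pos (by positivity)
  have hφ1 : φ ≤ 1 := min_le_left _ _
  have hφW : φ * W ≤ 1 / (2 * N) := by
    have : φ ≤ 1 / (2 * N * W) := min_le_right _ _
    calc φ * W ≤ 1 / (2 * N * W) * W := mul_le_mul_of_nonneg_right this hWp.le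
      _ = _ := by field_simp
  obtain ⟨g, hg, hmix⟩ := h.mix φ hφp
  have hev : ∀ f ∈ F, ∀ᶠ k : ℝ in atTop, 1 < wu P c v f → 
      k + 2 * T1 < (1 + wu P c v f) / 2 * k ∧ (1 - tq P c v ((1 + wu P c v f) / 2 * k) (k • f)) * W ≤ 1 / (2 * N) := by
    intro f hf
    by_cases hw : 1 < wu P c v f
    · have t1 := h.tq_lower (s := (1 + wu P c v f) / 2) (z := f) (by linarith) (by linarith)
      have t2 := (t1.const_sub 1).mul_const W
      rw [sub_self, zero_mul] at t2
      have t3 := t2.eventually (gt_mem_nhds (show 0 < 1 / (2 * N) by positivity))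
      filter_upwards [t3, eventually_gt_atTop (2 * T1 / ((wu P c v f - 1) / 2))] with k hk1 hk2 _
      refine ⟨?_, hk1.le⟩
      rw [div_lt_iff₀ (by linarith)] at hk2
      linarith
    · exact Eventually.of_forall fun k hk => absurd hk hw
  have hev' : ∀ᶠ k : ℝ in atTop, ∀ f ∈ F, 1 < wu P c v f → 
      k + 2 * T1 < (1 + wu P c v f) / 2 * k ∧ (1 - tq P c v ((1 + wu P c v f) / 2 * k) (k • f)) * W ≤ 1 / (2 * N) :=
    (eventually_all_finset F).2 hev
  obtain ⟨k, hk1, hk2, hk3, hk4⟩ := (hev'.and ((eventually_gt_atTop 0).and ((eventually_ge_atTop (4 * T1)).and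
    (eventually_ge_atTop ((2 * T1 + g) / ε))))).exists
  rw [div_le_iff₀ hεp] at hk4
  classical
  set π : Euc d → ℝ := fun f => if 1 < wu P c v f then 1 - tq P c v ((1 + wu P c v f) / 2 * k) (k • f) else 1 with hπ
  refine ⟨ε, R, l, g, k, φ, F, π, hεp, hε1, by rw [hR, hC2]; linarith, hlp, hg, hk2, hφp, hF, by nlinarith, hk4, hmix, ?_, ?_⟩
  · intro f hf s y
    simp only [hπ]
    split_ifs with hw
    · exact h.prob_AA (hk1 f hf hw).1
    · exact measureReal_le_one
  · intro f hf f' hf' hf'n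
    have hwf' : wu P c v f' ≤ δ / 2 :=
      (h.wu_le f').trans ((mul_le_mul_of_nonneg_left hf'n hT.le).trans hε3)
    have hwf : wu P c v f ≤ T1 * R := (h.wu_le f).trans (mul_le_mul_of_nonneg_left (hFR f hf) hT.le)
    simp only [hπ]
    split_ifs with hw
    · have e1 : Real.exp (l * (wu P c v f + wu P c v f' - (1 + δ))) ≤ W := by
        refine Real.exp_le_exp.2 (mul_le_mul_of_nonneg_left (by linarith) hlp.le)
      have e2 := (hk1 f hf hw).2
      have e3 : 0 ≤ 1 - tq P c v ((1 + wu P c v f) / 2 * k) (k • f) := by linarith [h.tq_le_one ((1 + wu P c v f) / 2 * k) (k • f)]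
      refine (mul_le_mul_of_nonneg_left e1 (by positivity)).trans ?_
      have : 1 / N = 1 / (2 * N) + 1 / (2 * N) := by field_simp; norm_num
      rw [this, add_mul]
      linarith
    · have e1 : Real.exp (l * (wu P c v f + wu P c v f' - (1 + δ))) ≤ Real.exp (-x) := by
        refine Real.exp_le_exp.2 ?_
        rw [← hlx, ← mul_neg]
        exact mul_le_mul_of_nonneg_left (by linarith) hlp.le
      refine (mul_le_mul (by linarith : (1:ℝ) + φ ≤ 2) e1 (Real.exp_pos _).le (by norm_num)).trans hx.le

lemma outer (h : RE p T1 P c v) {δ : ℝ} (hδ : 0 < δ) : ∃ Kp u ρ : ℝ, 0 < Kp ∧ 0 ≤ u ∧ 0 ≤ ρ ∧ 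
    ∀ (s0 : ℝ) (y0 : Euc d) (n : ℕ), ∃ Ev : Set Ω, P.real Ev ≤ (1 / 2) ^ n ∧ ∀ ω, ω ∉ Ev → ∀ a b,
      ‖a - y0‖ ≤ ρ → Rch c v ω (s0 + u) a (s0 + u + n * Kp) b → wu P c v (b - y0) ≤ (1 + δ) * (n * Kp) + T1 * ρ := by
  haveI := h.prob
  have hT := h.T1_pos
  have hK := p.K_pos
  obtain ⟨ε, R, l, g, k, φ, F, π, hεp, hε1, hR, hlp, hg, hk, hφp, hF, hku, hkg, hmix, hπ, hsum⟩ := outer_params h hδ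
  set C2 := 2 + 2 * p.K * (1 + 2 * T1) with hC2
  set u := T1 * (1 + k * ε) with hu
  have hu0 : 0 ≤ u := by positivity
  refine ⟨k + g, u, k * ε, by positivity, hu0, by positivity, ?_⟩
  intro s0 y0 n
  classical
  let J : Type := ↥F × ↥(F.filter fun f => ‖f‖ ≤ C2 * ε)
  set B : J → ℝ → Euc d → Set Ω := fun j s y => AA p c v k s y (y + k • j.1.1) with hB
  set D : J → ℝ := fun _ => k + g with hD
  set e : J → Euc d := fun j => k • (j.1.1 + j.2.1) with he
  set f : J → ℝ := fun j => l * (wu P c v j.1.1 + wu P c v j.2.1 - (1 + δ)) with hf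
  have hpat := pattern (P := P) hφp.le hmix B D e f (fun j => π j.1.1) (fun j => by simp only [hD]; positivity)
    (fun j s y => AEv_plus) (fun j s y => AEv_minus (by simp only [hD]; linarith))
    (fun j s y => hπ _ j.1.2 s y) s0 y0 n
  refine ⟨_, hpat.trans ?_, ?_⟩
  · have hπ0 : ∀ f ∈ F, 0 ≤ π f := fun f hf => measureReal_nonneg.trans (hπ f hf 0 0)
    refine pow_le_pow_left₀ (Finset.sum_nonneg fun j _ => ?_) ?_ n
    · have := hπ0 j.1.1 j.1.2
      positivity
    refine (Finset.sum_le_card_nsmul _ _ (1 / (2 * ((F.card:ℝ) ^ 2 + 1))) ?_).trans ?_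
    · intro j _
      have hj2 := Finset.mem_filter.1 j.2.2
      exact hsum _ j.1.2 _ hj2.1 hj2.2
    · have hcard : (Finset.univ : Finset J).card ≤ F.card ^ 2 := by
        rw [Finset.card_univ, Fintype.card_prod, Fintype.card_coe, Fintype.card_coe, sq]
        exact Nat.mul_le_mul_left _ (Finset.card_filter_le _ _)
      have hcard' : ((Finset.univ : Finset J).card : ℝ) ≤ (F.card:ℝ) ^ 2 := by exact_mod_cast hcard
      rw [nsmul_eq_mul, mul_one_div, div_le_iff₀ (by positivity)]
      linarith
  · intro ω hω a b ha hr
    obtain ⟨γ, hγ0, hγ1, hpath⟩ := reach_path hr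
    have hkg0 : 0 < k + g := by positivity
    have key : ∀ i : ℕ, i ≤ n → ∃ L : List J, L.length = i ∧ ω ∈ AL B D e s0 y0 L ∧ lsum D L = i * (k + g) ∧
        ‖γ (s0 + u + i * (k + g)) - (y0 + lsum e L)‖ ≤ k * ε ∧
        wu P c v (lsum e L) * l ≤ k * (lsum f L + l * (1 + δ) * i) := by
      intro i
      induction i with
      | zero =>
        intro _
        refine ⟨[], rfl, Set.mem_univ _, by simp [lsum], ?_, ?_⟩
        · simpa [lsum, hγ0] using ha
        · simp [lsum, h.wu_zero]
      | succ i ih =>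
        intro hi
        obtain ⟨L, h1, h2, h3, h4, h5⟩ := ih (by omega)
        have hi' : ((i + 1 : ℕ) : ℝ) ≤ n := by exact_mod_cast hi
        have hin : ((i + 1 : ℕ) : ℝ) * (k + g) ≤ n * (k + g) := mul_le_mul_of_nonneg_right hi' hkg0.le
        have hi0 : 0 ≤ (i:ℝ) * (k + g) := by positivity
        set s := s0 + i * (k + g) with hs
        have es : s0 + u + i * (k + g) = s + u := by rw [hs]; ring
        have es' : s0 + u + ((i + 1 : ℕ) : ℝ) * (k + g) = s + k + g + u := by rw [hs]; push_cast; ring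
        have r1 := hpath (s + u) (s + k - u) (by linarith) (by linarith) (by push_cast at hin; linarith)
        have r2 := hpath (s + k - u) (s + k + g + u) (by linarith) (by linarith) (by push_cast at hin; linarith)
        rw [es] at h4
        obtain ⟨f1, hf1, f2, hf2, hf2n, hA, hb⟩ := outer_step h hεp hε1 hR hF hg hu hk hku hkg h4 r1 r2
        let j : J := (⟨f1, hf1⟩, ⟨f2, Finset.mem_filter.2 ⟨hf2, hf2n⟩⟩)
        refine ⟨j :: L, by simp [h1], ⟨?_, h2⟩, ?_, ?_, ?_⟩
        · rw [h3]; exact hA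
        · rw [lsum, h3]; simp only [hD]; push_cast; ring
        · rw [es', lsum]
          have : y0 + (e j + lsum e L) = y0 + lsum e L + k • (f1 + f2) := by simp only [he, j]; abel
          rw [this]; exact hb
        · rw [lsum, lsum]
          have w1 := h.wu_add (e j) (lsum e L)
          have w2 : wu P c v (e j) ≤ k * (wu P c v f1 + wu P c v f2) := by
            simp only [he, j]
            rw [h.wu_smul hk]
            exact mul_le_mul_of_nonneg_left (h.wu_add _ _) hk.le
          have w3 : f j = l * (wu P c v f1 + wu P c v f2 - (1 + δ)) := rfl
          rw [w3]
          have w4 := mul_le_mul_of_nonneg_right (w1.trans (add_le_add_left w2 _)) hlp.le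
          push_cast
          linarith
    obtain ⟨L, h1, h2, h3, h4, h5⟩ := key n le_rfl
    have hneg : lsum f L < 0 := by
      by_contra hcon
      exact hω ⟨L, h1, not_lt.1 hcon, h2⟩
    rw [hγ1] at h4
    have h6 := h.wu_sub (b - y0) (lsum e L)
    rw [sub_sub] at h6
    have h7 : wu P c v (lsum e L) ≤ (1 + δ) * (n * k) := by
      have : wu P c v (lsum e L) * l ≤ ((1 + δ) * (n * k)) * l := by nlinarith
      exact le_of_mul_le_mul_right this hlp
    have h8 : (1 + δ) * (n * k) ≤ (1 + δ) * (n * (k + g)) := by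
      have : 0 ≤ (n:ℝ) * g := by positivity
      refine mul_le_mul_of_nonneg_left (by linarith) (by linarith)
    have h9 := mul_le_mul_of_nonneg_left h4 hT.le
    linarith

end GEq

namespace GEq
open scoped NNReal ENNReal
variable {d : ℕ} {p : Par}
variable {Ω : Type*} [MeasurableSpace Ω] {P : Measure Ω} {T1 : ℝ}
  {c : ℝ → Euc d → Ω → ℝ} {v : ℝ → Euc d → Ω → Euc d}

lemma bc_one [IsProbabilityMeasure P] (Ev : ℕ → Set Ω) {C κ : ℝ} (hκ : 0 < κ)
    (hE : ∀ m : ℕ, P.real (Ev m) ≤ C * Real.exp (-(κ * m))) : ∀ᵐ ω ∂P, ∀ᶠ m in atTop, ω ∉ Ev m := by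
  apply ae_eventually_notMem
  have hs : Summable fun m : ℕ => C * Real.exp (-(κ * m)) := by
    apply Summable.mul_left
    have := Real.summable_exp_nat_mul_iff.2 (neg_lt_zero.2 hκ)
    refine this.congr fun m => ?_
    congr 1; ring
  have hle : ∀ m, P (Ev m) ≤ ENNReal.ofReal (C * Real.exp (-(κ * m))) := fun m => by
    rw [← ofReal_measureReal (measure_ne_top P _)]
    exact ENNReal.ofReal_le_ofReal (hE m)
  refine ne_top_of_le_ne_top ?_ (ENNReal.tsum_le_tsum hle)
  exact hs.tsum_ofReal_ne_top

lemma bc {ι : Type*} [IsProbabilityMeasure P] (F : Finset ι) (Ev : ι → ℕ → Set Ω)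
    (hE : ∀ i ∈ F, ∃ C κ : ℝ, 0 < κ ∧ ∀ m : ℕ, P.real (Ev i m) ≤ C * Real.exp (-(κ * m))) :
    ∀ᵐ ω ∂P, ∀ᶠ m in atTop, ∀ i ∈ F, ω ∉ Ev i m := by
  have h1 : ∀ᵐ ω ∂P, ∀ i ∈ F, ∀ᶠ m in atTop, ω ∉ Ev i m := by
    rw [Filter.eventually_all_finset]
    intro i hi
    obtain ⟨C, κ, hκ, hb⟩ := hE i hi
    exact bc_one _ hκ hb
  filter_upwards [h1] with ω hω
  rw [Filter.eventually_all_finset]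
  exact hω

lemma inner_ae (h : RE p T1 P c v) {δ Λ : ℝ} (hδ : 0 < δ) (hδ1 : δ < 1) (hΛ : 0 < Λ) :
    ∀ᵐ ω ∂P, ∃ T : ℝ, 0 < T ∧ ∀ t, T ≤ t → ∀ x0 x : Euc d, ‖x0‖ ≤ Λ * t →
      wu P c v (x - x0) ≤ (1 - δ) * t → Rch c v ω 0 x0 t x := by
  have hT := h.T1_pos
  have hK := p.K_pos
  haveI := h.prob
  set ε : ℝ := δ / 2 / (4 * T1 + 1) with hε
  have hεp : 0 < ε := by positivity
  have hε' : ε * (4 * T1 + 1) = δ / 2 := by rw [hε]; field_simp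
  obtain ⟨F, hF, -⟩ := exists_net d (2 * Λ) hεp
  obtain ⟨G, hG, -⟩ := exists_net d (4 * p.K) hεp
  have hb := bc (P := P) (F ×ˢ G) (fun i m => {ω | (wu P c v i.2 + ε) * (m : ℝ) ≤
    tau c v ω (T1 * (1 + m * ε)) ((m : ℝ) • i.1) ((m : ℝ) • i.1 + (m : ℝ) • i.2)}) (by
      intro i _
      obtain ⟨C, κ, -, hκ, hb⟩ := h.good_of_wu (z := i.2) (s := wu P c v i.2 + ε) (by linarith)
      refine ⟨C, κ, hκ, fun m => ?_⟩
      rw [h.stat]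
      exact hb m (by positivity))
  filter_upwards [hb] with ω hω
  obtain ⟨m0, hm0⟩ := eventually_atTop.1 hω
  refine ⟨max (m0 + 1) (6 * T1 / δ), by positivity, fun t ht x0 x hx0 hx => ?_⟩
  have ht1 : (m0 : ℝ) + 1 ≤ t := (le_max_left _ _).trans ht
  have ht2 : 6 * T1 ≤ t * δ := by
    rw [← div_le_iff₀ hδ]; exact (le_max_right _ _).trans ht
  have hm00 : (0 : ℝ) ≤ m0 := by positivity
  set m := ⌊t⌋₊ with hm
  have hm1 : (m : ℝ) ≤ t := Nat.floor_le (by linarith)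
  have hm2 : t < m + 1 := Nat.lt_floor_add_one t
  have hm3 : m0 ≤ m := Nat.le_floor (by linarith)
  have hm4 : 1 ≤ m := Nat.le_floor (by push_cast; linarith)
  have hm4' : (1 : ℝ) ≤ m := by exact_mod_cast hm4
  have hmp : (0 : ℝ) < m := by linarith
  obtain ⟨f, hf, hfx, -⟩ := net_scaled hF hmp x0 (hx0.trans (by nlinarith))
  have hz : ‖x - x0‖ ≤ m * (4 * p.K) := by
    have h1 := h.le_wu (x - x0)
    have h2 : wu P c v (x - x0) ≤ 2 * m := by
      have : (1 - δ) * t ≤ t := by nlinarith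
      linarith
    nlinarith
  obtain ⟨g, hg, hgz, -⟩ := net_scaled hG hmp (x - x0) hz
  have hev := hm0 m hm3 (f, g) (Finset.mk_mem_product hf hg)
  simp only [Set.mem_setOf_eq, not_le] at hev
  have r1 : Rch c v ω 0 x0 (T1 * (1 + m * ε)) ((m : ℝ) • f) := by
    refine h.ctrl ω _ _ _ _ ?_
    rw [sub_zero]; gcongr
  have r2 := h.reach_of_tau hev le_rfl
  refine h.loop (reach_trans r1 r2) ?_
  have hw : m * wu P c v g ≤ (1 - δ) * t + T1 * (m * ε) := by
    rw [← h.wu_smul hmp]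
    refine (h.wu_sub _ (x - x0)).trans ?_
    gcongr
  have hd : ‖x - ((m : ℝ) • f + (m : ℝ) • g)‖ ≤ m * ε + m * ε := by
    have e : x - ((m : ℝ) • f + (m : ℝ) • g) = -((m : ℝ) • g - (x - x0)) - ((m : ℝ) • f - x0) := by abel
    rw [e]
    refine (norm_sub_le _ _).trans ?_
    rw [norm_neg]; linarith
  have h3 : T1 * ‖x - ((m : ℝ) • f + (m : ℝ) • g)‖ ≤ T1 * (m * ε + m * ε) := by gcongr
  have h4 : m * (ε * (4 * T1 + 1)) ≤ t * (δ / 2) := by rw [hε']; gcongr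
  linarith

lemma outer_ae (h : RE p T1 P c v) {δ Λ : ℝ} (hδ : 0 < δ) (hΛ : 0 < Λ) :
    ∀ᵐ ω ∂P, ∃ T : ℝ, 0 < T ∧ ∀ t, T ≤ t → ∀ x0 x : Euc d, ‖x0‖ ≤ Λ * t →
      Rch c v ω 0 x0 t x → wu P c v (x - x0) < (1 + δ) * t := by
  have hT := h.T1_pos
  have hK := p.K_pos
  haveI := h.prob
  set ε : ℝ := δ / 4 / (T1 * (2 + δ / 4)) with hε
  have hεp : 0 < ε := by positivity
  have hε' : T1 * ε * (2 + δ / 4) = δ / 4 := by rw [hε]; field_simp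
  obtain ⟨F, hF, -⟩ := exists_net d (2 * Λ) hεp
  obtain ⟨Kp, u, ρ, hKp, hu, hρ, hout⟩ := outer h (δ := δ / 4) (by positivity)
  choose Ev hEv hEv2 using hout
  set n : ℕ → ℕ := fun m => ⌈((m : ℝ) + 1 + T1 * (1 + m * ε) + T1) / Kp⌉₊ with hn
  have hn1 : ∀ m : ℕ, (m : ℝ) + 1 + T1 * (1 + m * ε) + T1 ≤ n m * Kp := fun m => by
    rw [← div_le_iff₀ hKp]; exact Nat.le_ceil _
  have hn2 : ∀ m : ℕ, n m * Kp ≤ (m : ℝ) + 1 + T1 * (1 + m * ε) + T1 + Kp := fun m => by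
    have h1 : (n m : ℝ) < ((m : ℝ) + 1 + T1 * (1 + m * ε) + T1) / Kp + 1 := Nat.ceil_lt_add_one (by positivity)
    have h2 := mul_le_mul_of_nonneg_right h1.le hKp.le
    rw [add_mul, div_mul_cancel₀ _ hKp.ne'] at h2
    linarith
  have hb := bc (P := P) F (fun f m => Ev (-(T1 * (1 + m * ε)) - u) ((m : ℝ) • f) (n m)) (by
      intro f _
      refine ⟨1, Real.log 2 / Kp, by have := Real.log_pos one_lt_two; positivity, fun m => (hEv _ _ _).trans ?_⟩
      have e : (1 / 2 : ℝ) ^ (n m) = Real.exp (-(Real.log 2 * n m)) := by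
        rw [one_div, inv_pow, Real.exp_neg, ← Real.rpow_natCast, Real.rpow_def_of_pos two_pos]
      rw [one_mul, e, Real.exp_le_exp, neg_le_neg_iff, div_mul_eq_mul_div, div_le_iff₀ hKp]
      have h1 := hn1 m
      have h2 := Real.log_pos one_lt_two
      have h3 : (m : ℝ) ≤ n m * Kp := by
        have : 0 ≤ T1 * (1 + m * ε) := by positivity
        linarith
      nlinarith)
  filter_upwards [hb] with ω hω
  obtain ⟨m0, hm0⟩ := eventually_atTop.1 hω
  set A := (1 + δ / 4) * (1 + 2 * T1 + Kp) + T1 * ρ with hA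
  have hAp : 0 < A := by positivity
  refine ⟨max (m0 + 1) (4 * A / δ), by positivity, fun t ht x0 x hx0 hx => ?_⟩
  have ht1 : (m0 : ℝ) + 1 ≤ t := (le_max_left _ _).trans ht
  have ht2 : 4 * A ≤ t * δ := by
    rw [← div_le_iff₀ hδ]; exact (le_max_right _ _).trans ht
  have hm00 : (0 : ℝ) ≤ m0 := by positivity
  set m := ⌊t⌋₊ with hm
  have hm1 : (m : ℝ) ≤ t := Nat.floor_le (by linarith)
  have hm2 : t < m + 1 := Nat.lt_floor_add_one t
  have hm3 : m0 ≤ m := Nat.le_floor (by linarith)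
  have hm4 : 1 ≤ m := Nat.le_floor (by push_cast; linarith)
  have hm4' : (1 : ℝ) ≤ m := by exact_mod_cast hm4
  have hmp : (0 : ℝ) < m := by linarith
  obtain ⟨f, hf, hfx, -⟩ := net_scaled hF hmp x0 (hx0.trans (by nlinarith))
  have hev := hm0 m hm3 f hf
  have r1 : Rch c v ω (-(T1 * (1 + m * ε)) - u + u) ((m : ℝ) • f) 0 x0 := by
    refine h.ctrl ω _ _ _ _ ?_
    rw [norm_sub_rev] at hfx
    have : T1 * ‖x0 - (m : ℝ) • f‖ ≤ T1 * (m * ε) := by gcongr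
    linarith
  have r2 := hEv2 _ _ _ ω hev ((m : ℝ) • f) x (by simpa using hρ) (h.loop (reach_trans r1 hx) (by
    have := hn1 m
    simp only [sub_self, norm_zero]
    linarith))
  have h2 := hn2 m
  have h1 : (1 + δ / 4) * (n m * Kp) ≤ (1 + δ / 4) * ((m : ℝ) + 1 + T1 * (1 + m * ε) + T1 + Kp) := by gcongr
  have h3 := h.wu_sub (x - x0) (x - (m : ℝ) • f)
  have h4 : T1 * ‖x - x0 - (x - (m : ℝ) • f)‖ ≤ T1 * (m * ε) := by
    gcongr
    rwa [sub_sub_sub_cancel_left]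
  have h5 : m * (T1 * ε * (2 + δ / 4)) ≤ t * (δ / 4) := by rw [hε']; gcongr
  have h6 : (1 + δ / 4) * m ≤ (1 + δ / 4) * t := by gcongr
  nlinarith

end GEq

namespace GEq
open scoped NNReal ENNReal
variable {d : ℕ} {p : Par}
variable {Ω : Type*} [MeasurableSpace Ω] {P : Measure Ω} {T1 : ℝ}
  {c : ℝ → Euc d → Ω → ℝ} {v : ℝ → Euc d → Ω → Euc d}

lemma all_ae (h : RE p T1 P c v) : ∀ᵐ ω ∂P, ∀ δ ∈ Set.Ioo (0:ℝ) 1, ∀ Λ : ℝ, 1 ≤ Λ →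
    ∃ T : ℝ, 0 < T ∧ ∀ t : ℝ, T ≤ t → ∀ x0 x : Euc d, ‖x0‖ ≤ Λ * t →
      (wu P c v (x - x0) ≤ (1 - δ) * t → Rch c v ω 0 x0 t x) ∧
      (Rch c v ω 0 x0 t x → wu P c v (x - x0) < (1 + δ) * t) := by
  have h1 : ∀ᵐ ω ∂P, ∀ k : ℕ, ∃ T : ℝ, 0 < T ∧ ∀ t, T ≤ t → ∀ x0 x : Euc d, ‖x0‖ ≤ (k + 1 : ℝ) * t →
      wu P c v (x - x0) ≤ (1 - 1 / (k + 2 : ℝ)) * t → Rch c v ω 0 x0 t x := by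
    rw [ae_all_iff]
    intro k
    refine inner_ae h (by positivity) ?_ (by positivity)
    rw [div_lt_one (by positivity)]
    have : (0 : ℝ) ≤ k := by positivity
    linarith
  have h2 : ∀ᵐ ω ∂P, ∀ k : ℕ, ∃ T : ℝ, 0 < T ∧ ∀ t, T ≤ t → ∀ x0 x : Euc d, ‖x0‖ ≤ (k + 1 : ℝ) * t →
      Rch c v ω 0 x0 t x → wu P c v (x - x0) < (1 + 1 / (k + 2 : ℝ)) * t := by
    rw [ae_all_iff]
    intro k
    exact outer_ae h (by positivity) (by positivity)
  filter_upwards [h1, h2] with ω g1 g2 δ hδ Λ hΛ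
  obtain ⟨k, hk⟩ := exists_nat_ge (max Λ (1 / δ))
  have hk1 : Λ ≤ k := (le_max_left _ _).trans hk
  have hk2 : 1 / δ ≤ k := (le_max_right _ _).trans hk
  have hkδ : 1 / (k + 2 : ℝ) ≤ δ := by
    rw [div_le_iff₀ hδ.1] at hk2
    rw [div_le_iff₀ (by positivity)]
    nlinarith [hδ.1]
  obtain ⟨T, hT, g1⟩ := g1 k
  obtain ⟨T', hT', g2⟩ := g2 k
  refine ⟨max T T', by positivity, fun t ht x0 x hx => ?_⟩
  have ht1 := (le_max_left T T').trans ht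
  have ht2 := (le_max_right T T').trans ht
  have ht0 : 0 < t := by linarith
  have hx' : ‖x0‖ ≤ (k + 1 : ℝ) * t := hx.trans (by gcongr; linarith)
  refine ⟨fun hw => g1 t ht1 x0 x hx' (hw.trans (by gcongr)), fun hr => (g2 t ht2 x0 x hx' hr).trans_le (by gcongr)⟩

lemma final (h : RE p T1 P c v) : ∃ M : ℝ, 1 ≤ M ∧ ∃ S : Set (Euc d), Convex ℝ S ∧ IsOpen S ∧
      Metric.ball 0 M⁻¹ ⊆ S ∧ S ⊆ Metric.ball 0 M ∧
      ∀ᵐ ω ∂P, ∀ δ ∈ Set.Ioo (0:ℝ) 1, ∀ Λ : ℝ, 1 ≤ Λ →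
        ∃ T : ℝ, ∀ t : ℝ, T ≤ t → ∀ x0 ∈ Metric.ball (0 : Euc d) (Λ * t),
          (fun p : Euc d => x0 + ((1 - δ) * t) • p) '' S
              ⊆ reachSet (fun a b => c a b ω) (fun a b => v a b ω) t 0 x0 ∧
            reachSet (fun a b => c a b ω) (fun a b => v a b ω) t 0 x0
              ⊆ (fun p : Euc d => x0 + ((1 + δ) * t) • p) '' S := by
  have hT := h.T1_pos
  have hK := p.K_pos
  have hM1 : T1 + 2 * p.K + 1 > 0 := by positivity
  refine ⟨T1 + 2 * p.K + 1, by linarith, {z | wu P c v z < 1}, ?_, ?_, ?_, ?_, ?_⟩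
  · rw [convex_iff_forall_pos]
    intro x hx y hy a b ha hb hab
    simp only [Set.mem_setOf_eq] at *
    have := h.wu_add (a • x) (b • y)
    rw [h.wu_smul ha, h.wu_smul hb] at this
    nlinarith
  · have hc : Continuous fun z : Euc d => wu P c v z := by
      refine LipschitzWith.continuous (K := T1.toNNReal) (LipschitzWith.of_le_add_mul _ fun x y => ?_)
      rw [Real.coe_toNNReal _ hT.le, dist_eq_norm]
      exact h.wu_sub x y
    exact isOpen_lt hc continuous_const
  · intro z hz
    rw [mem_ball_zero_iff, inv_eq_one_div, lt_div_iff₀ hM1] at hz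
    have h1 := h.wu_le z
    have h2 := norm_nonneg z
    simp only [Set.mem_setOf_eq]
    nlinarith
  · intro z hz
    simp only [Set.mem_setOf_eq] at hz
    rw [mem_ball_zero_iff]
    have := h.le_wu z
    nlinarith
  · filter_upwards [all_ae h] with ω hω δ hδ Λ hΛ
    obtain ⟨T, hT0, hT'⟩ := hω δ hδ Λ hΛ
    refine ⟨T, fun t ht x0 hx0 => ?_⟩
    have ht0 : 0 < t := by linarith
    have hx : ‖x0‖ ≤ Λ * t := (mem_ball_zero_iff.1 hx0).le
    have p1 : 0 < (1 - δ) * t := mul_pos (by linarith [hδ.2]) ht0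
    have p2 : 0 < (1 + δ) * t := mul_pos (by linarith [hδ.1]) ht0
    constructor
    · rintro _ ⟨z, hz, rfl⟩
      simp only [Set.mem_setOf_eq] at hz
      suffices hr : Rch c v ω 0 x0 (0 + t) (x0 + ((1 - δ) * t) • z) from hr
      rw [zero_add]
      refine (hT' t ht x0 _ hx).1 ?_
      rw [add_sub_cancel_left, h.wu_smul p1]
      nlinarith
    · intro x hr
      replace hr : Rch c v ω 0 x0 (0 + t) x := hr
      rw [zero_add] at hr
      have := (hT' t ht x0 x hx).2 hr
      refine ⟨((1 + δ) * t)⁻¹ • (x - x0), ?_, ?_⟩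
      · simp only [Set.mem_setOf_eq]
        rw [h.wu_smul (inv_pos.2 p2), inv_mul_lt_iff₀ p2]
        linarith
      · simp only
        rw [smul_inv_smul₀ p2.ne']; abel

end GEq

namespace GEq
open scoped NNReal ENNReal
variable {d : ℕ} 
variable {Ω : Type*} [MeasurableSpace Ω] {P : Measure Ω}
  {c : ℝ → Euc d → Ω → ℝ} {v : ℝ → Euc d → Ω → Euc d}

def modSet (c : ℝ → Euc d → Ω → ℝ) (v : ℝ → Euc d → Ω → Euc d) (u : ℝ) : Set ℝ :=
  {ε | 0 ≤ ε ∧ ∀ t t' x ω, |t - t'| ≤ u → |c t x ω - c t' x ω| ≤ ε ∧ ‖v t x ω - v t' x ω‖ ≤ ε}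

lemma modSet_bdd (u : ℝ) : BddBelow (modSet c v u) := ⟨0, fun _ h => h.1⟩

lemma tt_shift (c : ℝ → Euc d → ℝ) (v : ℝ → Euc d → Euc d) (s : ℝ) (y z : Euc d) :
    travelTime (fun a b => c (a + s) (b + y)) (fun a b => v (a + s) (b + y)) 0 0 z =
      travelTime c v s y (y + z) := by
  unfold travelTime
  congr 1
  ext t
  have := reach_shift_iff (c := c) (v := v) s y (t0 := 0) (t1 := 0 + t) (x0 := 0) (x1 := z)
  rw [zero_add, zero_add, zero_add, add_comm t s, add_comm z y] at this
  simp only [reachSet, Set.mem_setOf_eq, zero_add]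
  rw [this]

lemma mix_of (P : Measure Ω) [IsProbabilityMeasure P] (α : ℝ) (hα : 0 < α)
    (hmix : Tendsto (fun s : ℝ => s ^ α * phiH P c v s) atTop (nhds 0)) :
    ∀ ε : ℝ, 0 < ε → ∃ g, 0 ≤ g ∧ MixG P c v g ε := by
  intro ε hε
  have h1 := (hmix.eventually (gt_mem_nhds hε)).and (eventually_ge_atTop 1)
  obtain ⟨g, hg, hg1⟩ := h1.exists
  refine ⟨g, by linarith, fun t E F hE hF => ?_⟩
  by_cases hPE : P E = 0
  · have h2 : P (F ∩ E) = 0 := measure_mono_null Set.inter_subset_right hPE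
    simp [Measure.real, hPE, h2]
  have hpos : 0 < P E := pos_iff_ne_zero.2 hPE
  have hposr : 0 < P.real E := ENNReal.toReal_pos hPE (measure_ne_top _ _)
  have hphi : |P.real (F ∩ E) / P.real E - P.real F| ≤ phiH P c v g := by
    unfold phiH
    refine le_csSup ⟨1, ?_⟩ ⟨t, E, F, hE, hF, hpos, rfl⟩
    rintro r ⟨t', E', F', hE', hF', hp', rfl⟩
    have a1 : (P (F' ∩ E')).toReal ≤ (P E').toReal := measureReal_mono (μ := P) Set.inter_subset_right
    have a2 : 0 < (P E').toReal := ENNReal.toReal_pos hp'.ne' (measure_ne_top _ _)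
    have a3 : (P F').toReal ≤ 1 := measureReal_le_one (μ := P)
    have a4 : 0 ≤ (P F').toReal := ENNReal.toReal_nonneg
    have a5 : (P (F' ∩ E')).toReal / (P E').toReal ≤ 1 := (div_le_one a2).2 a1
    have a6 : 0 ≤ (P (F' ∩ E')).toReal / (P E').toReal := by positivity
    rw [abs_le]; constructor <;> linarith
  have hphi0 : 0 ≤ phiH P c v g := (abs_nonneg _).trans hphi
  have h3 : phiH P c v g ≤ ε := by
    have h4 : 1 ≤ g ^ α := Real.one_le_rpow hg1 hα.le
    nlinarith
  have h5 : P.real (F ∩ E) / P.real E ≤ P.real F + ε := by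
    have := (abs_le.1 hphi).2
    linarith
  rw [div_le_iff₀ hposr] at h5
  linarith

lemma build_RE
    (P : Measure Ω) [IsProbabilityMeasure P]
    (c : ℝ → Euc d → Ω → ℝ) (v : ℝ → Euc d → Ω → Euc d)
    (hc_pos : ∀ t x ω, 0 < c t x ω)
    (hbdd : ∃ K : ℝ, ∀ t x ω, c t x ω ≤ K ∧ ‖v t x ω‖ ≤ K)
    (huct : ∀ ε : ℝ, 0 < ε → ∃ δ : ℝ, 0 < δ ∧ ∀ t t' : ℝ, |t - t'| ≤ δ → ∀ x ω,
      |c t x ω - c t' x ω| ≤ ε ∧ ‖v t x ω - v t' x ω‖ ≤ ε)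
    (hlip : ∃ L : ℝ, ∀ t : ℝ, ∀ x x' : Euc d, ∀ ω,
      |c t x ω - c t x' ω| ≤ L * ‖x - x'‖ ∧ ‖v t x ω - v t x' ω‖ ≤ L * ‖x - x'‖)
    (hdiv : ∀ t : ℝ, ∀ ω, ∀ᵐ x ∂(volume : Measure (Euc d)),
      LinearMap.trace ℝ (Euc d) (fderiv ℝ (fun y => v t y ω) x).toLinearMap = 0)
    (hGc4 : ∃ L : ℝ, 0 < L ∧ ∃ a b : ℝ, a < b ∧
      (∀ t x ω,
        ‖(L ^ d)⁻¹ • ∫ y in {y : Euc d | ∀ i, y i ∈ Set.Icc (0:ℝ) L}, v t (x + y) ω‖ ≤ a) ∧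
      (∀ t x ω, b ≤ c t x ω))
    (Υ : ℝ × Euc d → Ω → Ω)
    (hmp : ∀ p, MeasurePreserving (Υ p) P P)
    (hstat : ∀ t s : ℝ, ∀ x y : Euc d, ∀ ω,
      c t x (Υ (s, y) ω) = c (t + s) (x + y) ω ∧ v t x (Υ (s, y) ω) = v (t + s) (x + y) ω)
    (hτmeas : ∀ t0 : ℝ, ∀ x0 x : Euc d,
      Measurable fun ω => travelTime (fun a b => c a b ω) (fun a b => v a b ω) t0 x0 x)
    (α : ℝ) (hα : 0 < α)
    (hmix : Tendsto (fun s : ℝ => s ^ α * phiH P c v s) atTop (nhds 0)) :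
    ∃ p T1, RE p T1 P c v := by
  obtain ⟨K, hK⟩ := hbdd
  obtain ⟨L, hL⟩ := hlip
  obtain ⟨L0, hL0, a, b, hab, havg, hcb⟩ := hGc4
  have hne : Nonempty Ω := nonempty_of_isProbabilityMeasure P
  obtain ⟨ω0⟩ := hne
  have hKm : ∀ u, 2 * max K 1 ∈ modSet c v u := fun u => by
    refine ⟨by positivity, fun t t' x ω _ => ⟨?_, ?_⟩⟩
    · have h1 := hK t x ω; have h2 := hK t' x ω; have h3 := hc_pos t x ω; have h4 := hc_pos t' x ω
      have := le_max_left K 1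
      rw [abs_le]; constructor <;> linarith
    · have h1 := hK t x ω; have h2 := hK t' x ω
      have := le_max_left K 1
      refine (norm_sub_le _ _).trans ?_
      linarith
  have hcM : ∀ t t' x ω, |c t x ω - c t' x ω| ≤ sInf (modSet c v |t - t'|) := fun t t' x ω =>
    le_csInf ⟨_, hKm _⟩ fun r hr => (hr.2 t t' x ω le_rfl).1
  have hvM : ∀ t t' x ω, ‖v t x ω - v t' x ω‖ ≤ sInf (modSet c v |t - t'|) := fun t t' x ω =>
    le_csInf ⟨_, hKm _⟩ fun r hr => (hr.2 t t' x ω le_rfl).2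
  let p : Par :=
    { K := max K 1, Lp := max L 0, a := a, b := b, L0 := L0, M := fun u => sInf (modSet c v u)
      K_pos := by positivity
      Lp_nonneg := le_max_right _ _
      a_nonneg := (norm_nonneg _).trans (havg 0 0 ω0)
      a_lt_b := hab
      L0_pos := hL0
      M_nonneg := fun u => Real.sInf_nonneg fun _ h => h.1
      M_mono := fun u u' huu => csInf_le_csInf (modSet_bdd _) ⟨_, hKm _⟩ 
        fun r hr => ⟨hr.1, fun t t' x ω ht => hr.2 t t' x ω (ht.trans huu)⟩
      M_le := fun u => csInf_le (modSet_bdd _) (hKm u)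
      M_small := fun η hη => by
        obtain ⟨δ, hδ, h⟩ := huct η hη
        exact ⟨δ, hδ, fun u hu => csInf_le (modSet_bdd _) ⟨hη.le, fun t t' x ω ht => h t t' (ht.trans hu) x ω⟩⟩ }
  obtain ⟨T1, hT1, hctrl⟩ := ctrl d p
  have henv : ∀ ω, Env p (fun a b => c a b ω) (fun a b => v a b ω) := fun ω =>
    { cb := fun t x => hcb t x ω
      cK := fun t x => (hK t x ω).1.trans (le_max_left _ _)
      vK := fun t x => (hK t x ω).2.trans (le_max_left _ _)
      cM := fun t t' x => hcM t t' x ω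
      vM := fun t t' x => hvM t t' x ω
      cL := fun t x x' => (hL t x x' ω).1.trans (mul_le_mul_of_nonneg_right (le_max_left _ _) (norm_nonneg _))
      vL := fun t x x' => (hL t x x' ω).2.trans (mul_le_mul_of_nonneg_right (le_max_left _ _) (norm_nonneg _))
      div0 := fun t => hdiv t ω
      avg := fun t x => havg t x ω }
  refine ⟨p, T1, ⟨inferInstance, henv, hT1, fun ω => hctrl _ _ (henv ω), hτmeas, ?_, ?_⟩⟩
  · intro s t y z
    have hS : MeasurableSet {ω | t ≤ travelTime (fun a b => c a b ω) (fun a b => v a b ω) 0 0 z} :=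
      measurableSet_le measurable_const (hτmeas 0 0 z)
    have h1 := (hmp (s, y)).measure_preimage hS.nullMeasurableSet
    unfold Measure.real
    rw [← h1]
    congr 2
    ext ω
    simp only [Set.mem_setOf_eq, Set.mem_preimage]
    have e1 : (fun a b => c a b (Υ (s, y) ω)) = fun a b => c (a + s) (b + y) ω := by
      funext a b; exact (hstat a s b y ω).1
    have e2 : (fun a b => v a b (Υ (s, y) ω)) = fun a b => v (a + s) (b + y) ω := by
      funext a b; exact (hstat a s b y ω).2
    rw [e1, e2, tt_shift (fun a b => c a b ω) (fun a b => v a b ω)]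
  · exact mix_of P α hα hmix

end GEq

/-- **Almost-sure strong Wulff shape for reachable sets of the G-equation.**
Under the G-equation hypotheses and polynomial decay of `φ_H`, there are `M ≥ 1` and a convex
bounded open set `S` with `B_{1/M}(0) ⊆ S ⊆ B_M(0)` such that almost surely, for all
`δ ∈ (0,1)` and `Λ ≥ 1`, for all large `t` and all `|x₀| < Λt`:
`x₀ + (1−δ)tS ⊆ Γ(t,ω;0,x₀) ⊆ x₀ + (1+δ)tS`. -/
theorem gequation_wulff_shape_almost_sure
    {d : ℕ} {Ω : Type*} [MeasurableSpace Ω] (P : Measure Ω) [IsProbabilityMeasure P]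
    (c : ℝ → Euc d → Ω → ℝ) (v : ℝ → Euc d → Ω → Euc d)
    -- `c` is positive, `(c,v)` are bounded
    (hc_pos : ∀ t x ω, 0 < c t x ω)
    (hbdd : ∃ K : ℝ, ∀ t x ω, c t x ω ≤ K ∧ ‖v t x ω‖ ≤ K)
    -- uniform continuity in `t`, uniformly in `(x,ω)`
    (huct : ∀ ε : ℝ, 0 < ε → ∃ δ : ℝ, 0 < δ ∧ ∀ t t' : ℝ, |t - t'| ≤ δ → ∀ x ω,
      |c t x ω - c t' x ω| ≤ ε ∧ ‖v t x ω - v t' x ω‖ ≤ ε)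
    -- uniform Lipschitz continuity in `x`
    (hlip : ∃ L : ℝ, ∀ t : ℝ, ∀ x x' : Euc d, ∀ ω,
      |c t x ω - c t x' ω| ≤ L * ‖x - x'‖ ∧ ‖v t x ω - v t x' ω‖ ≤ L * ‖x - x'‖)
    -- `v(t,·,ω)` is divergence-free (a.e. vanishing trace of the a.e. derivative)
    (hdiv : ∀ t : ℝ, ∀ ω, ∀ᵐ x ∂(volume : Measure (Euc d)),
      LinearMap.trace ℝ (Euc d) (fderiv ℝ (fun y => v t y ω) x).toLinearMap = 0)
    -- the averaged smallness condition (1.14): inf_L sup |avg of v over L-boxes| < inf c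
    (hGc4 : ∃ L : ℝ, 0 < L ∧ ∃ a b : ℝ, a < b ∧
      (∀ t x ω,
        ‖(L ^ d)⁻¹ • ∫ y in {y : Euc d | ∀ i, y i ∈ Set.Icc (0:ℝ) L}, v t (x + y) ω‖ ≤ a) ∧
      (∀ t x ω, b ≤ c t x ω))
    -- space-time stationarity with respect to a measure-preserving group
    (Υ : ℝ × Euc d → Ω → Ω)
    (hmp : ∀ p, MeasurePreserving (Υ p) P P)
    (hid : Υ 0 = id)
    (hgrp : ∀ p q, Υ p ∘ Υ q = Υ (p + q))
    (hstat : ∀ t s : ℝ, ∀ x y : Euc d, ∀ ω,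
      c t x (Υ (s, y) ω) = c (t + s) (x + y) ω ∧ v t x (Υ (s, y) ω) = v (t + s) (x + y) ω)
    -- measurability in ω of the travel times
    (hτmeas : ∀ t0 : ℝ, ∀ x0 x : Euc d,
      Measurable fun ω => travelTime (fun a b => c a b ω) (fun a b => v a b ω) t0 x0 x)
    -- polynomial decay of the mixing coefficient
    (α : ℝ) (hα : 0 < α)
    (hmix : Tendsto (fun s : ℝ => s ^ α * phiH P c v s) atTop (nhds 0)) :
    ∃ M : ℝ, 1 ≤ M ∧ ∃ S : Set (Euc d), Convex ℝ S ∧ IsOpen S ∧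
      Metric.ball 0 M⁻¹ ⊆ S ∧ S ⊆ Metric.ball 0 M ∧
      ∀ᵐ ω ∂P, ∀ δ ∈ Set.Ioo (0:ℝ) 1, ∀ Λ : ℝ, 1 ≤ Λ →
        ∃ T : ℝ, ∀ t : ℝ, T ≤ t → ∀ x0 ∈ Metric.ball (0 : Euc d) (Λ * t),
          (fun p : Euc d => x0 + ((1 - δ) * t) • p) '' S
              ⊆ reachSet (fun a b => c a b ω) (fun a b => v a b ω) t 0 x0 ∧
            reachSet (fun a b => c a b ω) (fun a b => v a b ω) t 0 x0
              ⊆ (fun p : Euc d => x0 + ((1 + δ) * t) • p) '' S := by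
  obtain ⟨p, T1, h⟩ := GEq.build_RE P c v hc_pos hbdd huct hlip hdiv hGc4 Υ hmp hstat hτmeas α hα hmix
  exact GEq.final h
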